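/- arXiv:2108.07989 — 2 statements merged into one kernel-verified Lean document; each statement's English description precedes it below -/
import Mathlib

section
/- Let Ω ⊂ ℝ^N be a smooth bounded domain and for p > 1 let C_p = inf{∫_Ω H(∇u)^N dx : u ∈ C_c^∞(Ω), ∫_Ω |u|^{p+1} dx = 1}. Then lim_{p→∞} p^{N-1} C_p = ((Ne/(N-1)) β_N)^{N-1}. -/
open MeasureTheory Filter Real Set
open scoped RealInnerProductSpace Topology NNReal

noncomputable section

abbrev Euc (N : ℕ) := EuclideanSpace ℝ (Fin N)

/-- `H` is a norm on `ℝ^N`: convex, nonnegative, vanishing exactly at `0`,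
and absolutely homogeneous. -/
def IsFinslerNorm (N : ℕ) (H : Euc N → ℝ) : Prop :=
  ConvexOn ℝ Set.univ H ∧
  (∀ ξ, 0 ≤ H ξ) ∧
  (∀ ξ, H ξ = 0 ↔ ξ = 0) ∧
  (∀ (t : ℝ) (ξ : Euc N), H (t • ξ) = |t| * H ξ)

/-- Regularity assumptions: `H ∈ C²(ℝ^N \ {0})`, `H^N ∈ C¹(ℝ^N)`, and the Hessian of
`H^N` is positive definite away from the origin. -/
def FinslerRegular (N : ℕ) (H : Euc N → ℝ) : Prop :=
  ContDiffOn ℝ 2 H {(0 : Euc N)}ᶜ ∧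
  ContDiff ℝ 1 (fun ξ => H ξ ^ N) ∧
  ∀ ξ : Euc N, ξ ≠ 0 → ∀ v : Euc N, v ≠ 0 →
    0 < iteratedFDeriv ℝ 2 (fun ξ => H ξ ^ N) ξ ![v, v]

/-- The dual norm `H⁰(x) = sup_{ξ ≠ 0} ⟪x, ξ⟫ / H(ξ)`. -/
def dualNorm {N : ℕ} (H : Euc N → ℝ) (x : Euc N) : ℝ :=
  sSup {r : ℝ | ∃ ξ : Euc N, ξ ≠ 0 ∧ r = ⟪x, ξ⟫ / H ξ}

/-- `κ_N`, the volume of the Wulff ball `{H⁰ < 1}`. -/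
def wulffVol (N : ℕ) (H : Euc N → ℝ) : ℝ :=
  (volume {x : Euc N | dualNorm H x < 1}).toReal

/-- `β_N = N (N κ_N)^{1/(N-1)}`. -/
def betaN (N : ℕ) (H : Euc N → ℝ) : ℝ :=
  N * (N * wulffVol N H) ^ ((1 : ℝ) / ((N : ℝ) - 1))

/-- `u` is a weak solution of `-Q_N u = g` on the open set `U`:
`∫_U H(∇u)^{N-1} ⟪∇H(∇u), ∇φ⟫ = ∫_U g φ` for all test functions `φ`. -/
def IsWeakSolution (N : ℕ) (H : Euc N → ℝ) (U : Set (Euc N)) (u g : Euc N → ℝ) : Prop :=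
  ∀ φ : Euc N → ℝ, ContDiff ℝ (⊤ : ℕ∞) φ → HasCompactSupport φ → tsupport φ ⊆ U →
    (∫ x in U, H (gradient u x) ^ (N - 1) * ⟪gradient H (gradient u x), gradient φ x⟫)
      = ∫ x in U, g x * φ x

/-- `C_p`, the infimum of `∫_Ω H(∇u)^N` over test functions normalized in `L^{p+1}`. -/
def energyInf (N : ℕ) (H : Euc N → ℝ) (Ω : Set (Euc N)) (p : ℝ) : ℝ :=
  sInf {c : ℝ | ∃ u : Euc N → ℝ, ContDiff ℝ (⊤ : ℕ∞) u ∧ HasCompactSupport u ∧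
    tsupport u ⊆ Ω ∧ (∫ x in Ω, |u x| ^ (p + 1)) = 1 ∧
    c = ∫ x in Ω, H (gradient u x) ^ N}

/-- A least energy solution of the Finsler Lane–Emden problem on `Ω` with exponent `p`. -/
def IsLeastEnergySolution (N : ℕ) (H : Euc N → ℝ) (Ω : Set (Euc N)) (p : ℝ)
    (u : Euc N → ℝ) : Prop :=
  ContDiffOn ℝ 1 u (closure Ω) ∧
  (∀ x ∈ Ω, 0 < u x) ∧
  (∀ x ∈ frontier Ω, u x = 0) ∧
  IsWeakSolution N H Ω u (fun x => u x ^ p) ∧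
  (∫ x in Ω, H (gradient u x) ^ N)
    = energyInf N H Ω p * (∫ x in Ω, u x ^ (p + 1)) ^ ((N : ℝ) / (p + 1))

/-- The blow-up set of a sequence of functions `v n` on `Ω`. -/
def BlowUpSet {N : ℕ} (Ω : Set (Euc N)) (v : ℕ → Euc N → ℝ) : Set (Euc N) :=
  {x | x ∈ closure Ω ∧ ∃ σ : ℕ → ℕ, StrictMono σ ∧ ∃ xs : ℕ → Euc N,
    (∀ n, xs n ∈ Ω) ∧ Tendsto xs atTop (𝓝 x) ∧
    Tendsto (fun n => v (σ n) (xs n)) atTop atTop}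

open Module (finrank)
open scoped ENNReal

theorem enorm_le_lintegral_Ioi_fderiv {E : Type*} [NormedAddCommGroup E] [NormedSpace ℝ E]
    {u : E → ℝ} (hu : ContDiff ℝ 1 u)
    (hc : HasCompactSupport u) (x : E) {ω : E} (hω : ‖ω‖ = 1) :
    ‖u x‖ₑ ≤ ∫⁻ r in Ioi (0 : ℝ), ‖fderiv ℝ u (x + r • ω)‖ₑ := by
  have hemb : Topology.IsClosedEmbedding fun r : ℝ => x + r • ω := by
    refine Isometry.isClosedEmbedding (Isometry.of_dist_eq fun a b => ?_)
    rw [dist_add_left, dist_eq_norm, ← sub_smul, norm_smul, hω, mul_one, Real.dist_eq]; rfl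
  have hd : ∀ r : ℝ, HasDerivAt (fun r : ℝ => u (x + r • ω)) (fderiv ℝ u (x + r • ω) ω) r := by
    intro r
    have h1 : HasDerivAt (fun r : ℝ => x + r • ω) ω r := by
      simpa using ((hasDerivAt_id r).smul_const ω).const_add x
    exact ((hu.differentiable one_ne_zero) _).hasFDerivAt.comp_hasDerivAt r h1
  have hf : ContDiff ℝ 1 fun r : ℝ => u (x + r • ω) := hu.comp (by fun_prop)
  have h := (hc.comp_isClosedEmbedding hemb).integral_Ioi_deriv_eq hf 0
  have h0 : u x = -∫ r in Ioi (0 : ℝ), deriv (fun r : ℝ => u (x + r • ω)) r := by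
    rw [show ∫ r in Ioi (0 : ℝ), deriv (fun r : ℝ => u (x + r • ω)) r = _ from h]
    simp
  rw [h0, enorm_neg]
  refine (enorm_integral_le_lintegral_enorm _).trans (lintegral_mono fun r => ?_)
  rw [(hd r).deriv]
  have := (fderiv ℝ u (x + r • ω)).le_opNorm ω
  rw [hω, mul_one] at this
  rw [← ofReal_norm, ← ofReal_norm]
  exact ENNReal.ofReal_le_ofReal this

section SphereMass

variable {E : Type*} [NormedAddCommGroup E] [NormedSpace ℝ E] [FiniteDimensional ℝ E]
  [MeasurableSpace E] (μ : Measure E) [μ.IsAddHaarMeasure]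

/-- The total mass of the sphere in the polar decomposition of `μ`. -/
def sphereMass {E : Type*} [NormedAddCommGroup E] [NormedSpace ℝ E] [MeasurableSpace E]
    (μ : Measure E) : ℝ :=
  finrank ℝ E * μ.real (Metric.ball 0 1)

theorem sphereMass_pos [Nontrivial E] : 0 < sphereMass μ := by
  have h1 : 0 < finrank ℝ E := Module.finrank_pos
  have h2 : 0 < μ.real (Metric.ball (0 : E) 1) :=
    ENNReal.toReal_pos (Metric.measure_ball_pos μ 0 one_pos).ne' measure_ball_lt_top.ne
  unfold sphereMass
  positivity

theorem ofReal_sphereMass :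
    ENNReal.ofReal (sphereMass μ) = finrank ℝ E * μ (Metric.ball 0 1) := by
  rw [sphereMass, ENNReal.ofReal_mul (by positivity), ENNReal.ofReal_natCast,
    ofReal_measureReal measure_ball_lt_top.ne]

end SphereMass

theorem rpow_le_mul_exp_rpow {q a m s : ℝ} (hq : 0 < q) (ha : 0 < a) (hm : 0 < m) (hs : 0 < s) :
    s ^ q ≤ (q / (m * a * Real.exp 1)) ^ (q / m) * Real.exp (a * s ^ m) := by
  have ht : 0 < s ^ m := Real.rpow_pos_of_pos hs m
  have hr : 0 < q / m := by positivity
  have h := Real.add_one_le_exp (a * s ^ m / (q / m) - 1)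
  rw [sub_add_cancel] at h
  have h1 : s ^ m ≤ q / (m * a * Real.exp 1) * Real.exp (a * s ^ m / (q / m)) := by
    rw [Real.exp_sub] at h
    calc s ^ m = q / (m * a) * (a * s ^ m / (q / m)) := by field_simp
      _ ≤ q / (m * a) * (Real.exp (a * s ^ m / (q / m)) / Real.exp 1) := by gcongr
      _ = _ := by field_simp
  calc s ^ q = (s ^ m) ^ (q / m) := by
        rw [← Real.rpow_mul hs.le, mul_div_cancel₀ _ hm.ne']
    _ ≤ (q / (m * a * Real.exp 1) * Real.exp (a * s ^ m / (q / m))) ^ (q / m) := by gcongr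
    _ = _ := by
      rw [Real.mul_rpow (by positivity) (by positivity), ← Real.exp_mul,
        div_mul_cancel₀ _ hr.ne']

/-- An `L^q` bound from an exponential tail bound, with sharp dependence on `q`. -/
theorem lintegral_rpow_le_of_measure_lt_le {α : Type*} [MeasurableSpace α] {μ : Measure α}
    {g : α → ℝ} (hg : Measurable g) (hg0 : ∀ x, 0 ≤ g x) {V C m a δ q : ℝ} (hV : 0 ≤ V)
    (hC : 0 ≤ C) (hm : 1 ≤ m) (ha : 0 < a) (hδ : 0 < δ) (hq : 1 ≤ q)
    (h1 : ∀ s, 0 < s → μ {x | s < g x} ≤ ENNReal.ofReal V)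
    (h2 : ∀ s, 1 ≤ s → μ {x | s < g x} ≤ ENNReal.ofReal (C * Real.exp (-((a + δ) * s ^ m)))) :
    ∫⁻ x, ENNReal.ofReal (g x ^ q) ∂μ ≤
      ENNReal.ofReal (V + q * (C / δ) * (q / (m * a * Real.exp 1)) ^ (q / m)) := by
  have hq0 : 0 < q := by linarith
  have hm0 : 0 < m := by linarith
  set M := (q / (m * a * Real.exp 1)) ^ (q / m)
  have hM : 0 ≤ M := by positivity
  rw [lintegral_rpow_eq_lintegral_meas_lt_mul μ (ae_of_all _ hg0) hg.aemeasurable hq0]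
  have hA : ∫⁻ t in Ioc (0 : ℝ) 1, μ {x | t < g x} * ENNReal.ofReal (t ^ (q - 1)) ≤
      ENNReal.ofReal (V / q) := by
    calc _ ≤ ∫⁻ t in Ioc (0 : ℝ) 1, ENNReal.ofReal V * ENNReal.ofReal (t ^ (q - 1)) := by
          refine setLIntegral_mono' measurableSet_Ioc fun t ht => ?_
          gcongr
          exact h1 t ht.1
      _ = ENNReal.ofReal V * ENNReal.ofReal (1 / q) := by
          rw [lintegral_const_mul' _ _ ENNReal.ofReal_ne_top,
            ← ofReal_integral_eq_lintegral_ofReal]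
          · rw [← intervalIntegral.integral_of_le zero_le_one, integral_rpow (by left; linarith)]
            simp [hq0.ne']
          · rw [← IntegrableOn, ← intervalIntegrable_iff_integrableOn_Ioc_of_le zero_le_one]
            exact intervalIntegral.intervalIntegrable_rpow' (by linarith)
          · filter_upwards [ae_restrict_mem measurableSet_Ioc] with t ht
            exact Real.rpow_nonneg ht.1.le _
      _ = _ := by rw [← ENNReal.ofReal_mul hV, mul_one_div]
  have hB : ∫⁻ t in Ioi (1 : ℝ), μ {x | t < g x} * ENNReal.ofReal (t ^ (q - 1)) ≤
      ENNReal.ofReal (C * M / δ) := by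
    calc _ ≤ ∫⁻ t in Ioi (1 : ℝ), ENNReal.ofReal (C * M * Real.exp (-δ * t)) := by
          refine setLIntegral_mono' measurableSet_Ioi fun t (ht : 1 < t) => ?_
          have ht0 : 0 < t := by linarith
          have htm : t ≤ t ^ m := Real.self_le_rpow_of_one_le ht.le hm
          calc _ ≤ ENNReal.ofReal (C * Real.exp (-((a + δ) * t ^ m))) *
                ENNReal.ofReal (t ^ (q - 1)) := by
                gcongr
                exact h2 t ht.le
            _ ≤ _ := by
              rw [← ENNReal.ofReal_mul (by positivity)]
              refine ENNReal.ofReal_le_ofReal ?_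
              have e1 : t ^ (q - 1) ≤ M * Real.exp (a * t ^ m) :=
                (Real.rpow_le_rpow_of_exponent_le ht.le (by linarith)).trans
                  (rpow_le_mul_exp_rpow hq0 ha hm0 ht0)
              calc _ ≤ C * Real.exp (-((a + δ) * t ^ m)) * (M * Real.exp (a * t ^ m)) := by
                    gcongr
                _ = C * M * Real.exp (-δ * t ^ m) := by
                    rw [show -((a + δ) * t ^ m) = -δ * t ^ m - a * t ^ m by ring, Real.exp_sub]
                    field_simp
                _ ≤ _ := by
                    gcongr C * M * Real.exp ?_
                    nlinarith
      _ ≤ _ := by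
          rw [← ofReal_integral_eq_lintegral_ofReal]
          · refine ENNReal.ofReal_le_ofReal ?_
            rw [integral_const_mul, integral_exp_mul_Ioi (by linarith), div_eq_mul_inv _ δ]
            gcongr
            rw [neg_div_neg_eq, div_eq_mul_inv]
            exact mul_le_of_le_one_left (by positivity) (Real.exp_le_one_iff.2 (by linarith))
          · exact (integrableOn_exp_mul_Ioi (by linarith) 1).const_mul _
          · exact ae_of_all _ fun t => by positivity
  rw [← Ioc_union_Ioi_eq_Ioi zero_le_one]
  calc _ ≤ ENNReal.ofReal q * (ENNReal.ofReal (V / q) + ENNReal.ofReal (C * M / δ)) := by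
        gcongr
        exact (lintegral_union_le _ _ _).trans (add_le_add hA hB)
    _ = _ := by
        rw [← ENNReal.ofReal_add (by positivity) (by positivity), ← ENNReal.ofReal_mul hq0.le]
        congr 1
        field_simp

section Polar

variable {E : Type*} [NormedAddCommGroup E] [NormedSpace ℝ E] [FiniteDimensional ℝ E]
  [Nontrivial E] [MeasurableSpace E] [BorelSpace E] (μ : Measure E) [μ.IsAddHaarMeasure]

theorem lintegral_eq_lintegral_toSphere {g : E → ℝ≥0∞} (hg : Measurable g) :
    ∫⁻ y, g y ∂μ = ∫⁻ ω, (∫⁻ r in Ioi (0 : ℝ),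
      ENNReal.ofReal (r ^ (finrank ℝ E - 1)) * g (r • (ω : E))) ∂μ.toSphere := by
  have h1 : ∫⁻ y, g y ∂μ = ∫⁻ y : ({0}ᶜ : Set E), g y ∂(μ.comap (↑)) := by
    rw [lintegral_subtype_comap (measurableSet_singleton _).compl, restrict_compl_singleton]
  have h2 := (μ.measurePreserving_homeomorphUnitSphereProd).symm
    (homeomorphUnitSphereProd E).toMeasurableEquiv
  have h3 := h2.lintegral_comp (f := fun y : ({0}ᶜ : Set E) => g y)
    (hg.comp measurable_subtype_coe)
  rw [h1, ← h3, lintegral_prod]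
  · refine lintegral_congr fun ω => ?_
    have hm : Measurable fun r : Ioi (0 : ℝ) => g (r.1 • (ω : E)) := by fun_prop
    rw [Measure.volumeIoiPow]
    rw [← lintegral_subtype_comap measurableSet_Ioi
      fun r => ENNReal.ofReal (r ^ (finrank ℝ E - 1)) * g (r • (ω : E))]
    exact lintegral_withDensity_eq_lintegral_mul _ (by fun_prop) hm
  · exact ((hg.comp measurable_subtype_coe).comp h2.measurable).aemeasurable

/-- The Riesz-potential bound: `u` is controlled by the convolution of its gradient with
`‖·‖ ^ (1 - n)`, with the sharp constant. -/
theorem mul_enorm_le_lintegral_fderiv {u : E → ℝ} (hu : ContDiff ℝ 1 u)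
    (hc : HasCompactSupport u) (x : E) :
    ENNReal.ofReal (sphereMass μ) * ‖u x‖ₑ ≤
      ∫⁻ y, ‖fderiv ℝ u (x + y)‖ₑ * ENNReal.ofReal ((‖y‖ ^ (finrank ℝ E - 1))⁻¹) ∂μ := by
  have hm : Measurable fun y => ‖fderiv ℝ u (x + y)‖ₑ *
      ENNReal.ofReal ((‖y‖ ^ (finrank ℝ E - 1))⁻¹) := by
    have := (hu.continuous_fderiv one_ne_zero)
    have : Measurable fun y => ‖fderiv ℝ u (x + y)‖ₑ := by
      apply Continuous.measurable; fun_prop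
    fun_prop
  rw [lintegral_eq_lintegral_toSphere μ hm, ofReal_sphereMass, ← Measure.toSphere_apply_univ, mul_comm,
    ← lintegral_const]
  refine lintegral_mono fun ω => ?_
  have hω : ‖(ω : E)‖ = 1 := by simp
  refine (enorm_le_lintegral_Ioi_fderiv hu hc x hω).trans_eq ?_
  refine setLIntegral_congr_fun measurableSet_Ioi fun r (hr : 0 < r) => ?_
  rw [norm_smul, hω, mul_one, Real.norm_of_nonneg hr.le, mul_comm, mul_assoc,
    ← ENNReal.ofReal_mul (by positivity), inv_mul_cancel₀ (by positivity)]
  simp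

theorem lintegral_fun_norm {F : ℝ → ℝ≥0∞} (hF : Measurable F) :
    ∫⁻ y, F ‖y‖ ∂μ = ENNReal.ofReal (sphereMass μ) *
      ∫⁻ r in Ioi (0 : ℝ), ENNReal.ofReal (r ^ (finrank ℝ E - 1)) * F r := by
  rw [lintegral_eq_lintegral_toSphere μ (g := fun y => F ‖y‖) (by fun_prop), ofReal_sphereMass,
    ← Measure.toSphere_apply_univ, mul_comm, ← lintegral_const]
  refine lintegral_congr fun ω => setLIntegral_congr_fun measurableSet_Ioi
    fun r (hr : 0 < r) => ?_
  have hω : ‖(ω : E)‖ = 1 := by simp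
  simp only [norm_smul, hω, mul_one, Real.norm_of_nonneg hr.le]

theorem setLIntegral_ball_inv_norm_pow (ρ : ℝ) :
    ∫⁻ y in {y | ‖y‖ < ρ}, ENNReal.ofReal ((‖y‖ ^ (finrank ℝ E - 1))⁻¹) ∂μ =
      ENNReal.ofReal (sphereMass μ * ρ) := by
  have hs : MeasurableSet {y : E | ‖y‖ < ρ} := measurableSet_lt measurable_norm measurable_const
  have h := lintegral_fun_norm μ
    (F := (Iio ρ).indicator fun r => ENNReal.ofReal ((r ^ (finrank ℝ E - 1))⁻¹))
    (Measurable.indicator (by fun_prop) measurableSet_Iio)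
  rw [← lintegral_indicator hs, ENNReal.ofReal_mul (sphereMass_pos μ).le]
  refine Eq.trans (lintegral_congr fun y => ?_) (h.trans ?_)
  · simp [indicator]
  · congr 1
    calc _ = ∫⁻ r in Ioi (0 : ℝ), (Iio ρ).indicator 1 r := by
          refine setLIntegral_congr_fun measurableSet_Ioi fun r (hr : 0 < r) => ?_
          by_cases h : r < ρ
          · simp only [mem_Iio, h, indicator_of_mem, Pi.one_apply]
            rw [← ENNReal.ofReal_mul (by positivity), mul_inv_cancel₀ (by positivity),
              ENNReal.ofReal_one]
          · simp [h]
      _ = _ := by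
          rw [lintegral_indicator_one measurableSet_Iio, Measure.restrict_apply measurableSet_Iio,
            Iio_inter_Ioi]
          simp

theorem setLIntegral_annulus_inv_norm_pow {a b : ℝ} (ha : 0 < a) (hab : a ≤ b) :
    ∫⁻ y in {y | a ≤ ‖y‖ ∧ ‖y‖ ≤ b}, ENNReal.ofReal ((‖y‖ ^ finrank ℝ E)⁻¹) ∂μ =
      ENNReal.ofReal (sphereMass μ * Real.log (b / a)) := by
  have hs : MeasurableSet {y : E | a ≤ ‖y‖ ∧ ‖y‖ ≤ b} :=
    (measurableSet_le measurable_const measurable_norm).inter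
      (measurableSet_le measurable_norm measurable_const)
  have hn : 0 < finrank ℝ E := Module.finrank_pos
  have hsub : Icc a b ⊆ Ioi 0 := fun r hr => ha.trans_le hr.1
  have h := lintegral_fun_norm μ
    (F := (Icc a b).indicator fun r => ENNReal.ofReal ((r ^ finrank ℝ E)⁻¹))
    (Measurable.indicator (by fun_prop) measurableSet_Icc)
  rw [← lintegral_indicator hs, ENNReal.ofReal_mul (sphereMass_pos μ).le]
  refine Eq.trans (lintegral_congr fun y => ?_) (h.trans ?_)
  · simp [indicator]
  · congr 1
    calc _ = ∫⁻ r in Ioi (0 : ℝ), (Icc a b).indicator (fun r => ENNReal.ofReal r⁻¹) r := by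
          refine setLIntegral_congr_fun measurableSet_Ioi fun r (hr : 0 < r) => ?_
          by_cases h : r ∈ Icc a b
          · simp only [h, indicator_of_mem]
            rw [← ENNReal.ofReal_mul (by positivity)]
            congr 1
            obtain ⟨k, hk⟩ : ∃ k, finrank ℝ E = k + 1 := ⟨_, (Nat.succ_pred_eq_of_pos hn).symm⟩
            rw [hk, Nat.add_sub_cancel]
            field_simp
            ring
          · simp [h]
      _ = ∫⁻ r in Icc a b, ENNReal.ofReal r⁻¹ := by
          rw [lintegral_indicator measurableSet_Icc, Measure.restrict_restrict measurableSet_Icc,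
            inter_eq_left.2 hsub]
      _ = _ := by
          rw [← integral_inv_of_pos ha (ha.trans_le hab), intervalIntegral.integral_of_le hab,
            ← integral_Icc_eq_integral_Ioc, ofReal_integral_eq_lintegral_ofReal]
          · refine ContinuousOn.integrableOn_compact isCompact_Icc ?_
            exact continuousOn_inv₀.mono fun r hr => (ha.trans_le hr.1).ne'
          · filter_upwards [ae_restrict_mem measurableSet_Icc] with r hr
            exact inv_nonneg.2 (ha.le.trans hr.1)

theorem setLIntegral_annulus_mul_le (hn : 2 ≤ finrank ℝ E) {f : E → ℝ≥0∞} (hf : Measurable f)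
    (hf1 : ∫⁻ y, f y ^ finrank ℝ E ∂μ ≤ 1) {a b : ℝ} (ha : 0 < a) (hab : a ≤ b) (x : E) :
    ∫⁻ y in {y | a ≤ ‖y‖ ∧ ‖y‖ ≤ b},
        f (x + y) * ENNReal.ofReal ((‖y‖ ^ (finrank ℝ E - 1))⁻¹) ∂μ ≤
      ENNReal.ofReal ((sphereMass μ * Real.log (b / a)) ^
        (((finrank ℝ E : ℝ) - 1) / finrank ℝ E)) := by
  have hn1 : (1 : ℝ) < finrank ℝ E := by exact_mod_cast hn
  have hconj := Real.HolderConjugate.conjExponent hn1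
  have hs : MeasurableSet {y : E | a ≤ ‖y‖ ∧ ‖y‖ ≤ b} :=
    (measurableSet_le measurable_const measurable_norm).inter
      (measurableSet_le measurable_norm measurable_const)
  have hlog : 0 ≤ sphereMass μ * Real.log (b / a) :=
    mul_nonneg (sphereMass_pos μ).le (Real.log_nonneg ((one_le_div ha).2 hab))
  have h := ENNReal.lintegral_mul_le_Lp_mul_Lq
    (μ.restrict {y : E | a ≤ ‖y‖ ∧ ‖y‖ ≤ b}) hconj
    (f := fun y => f (x + y)) (g := fun y => ENNReal.ofReal ((‖y‖ ^ (finrank ℝ E - 1))⁻¹))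
    (by fun_prop) (by fun_prop)
  refine h.trans ?_
  have h1 : ∫⁻ y in {y : E | a ≤ ‖y‖ ∧ ‖y‖ ≤ b}, f (x + y) ^ (finrank ℝ E : ℝ) ∂μ ≤ 1 := by
    simp only [ENNReal.rpow_natCast]
    refine (setLIntegral_le_lintegral _ _).trans ?_
    rwa [lintegral_add_left_eq_self (fun y => f y ^ finrank ℝ E) x]
  have h2 : ∫⁻ y in {y : E | a ≤ ‖y‖ ∧ ‖y‖ ≤ b},
      ENNReal.ofReal ((‖y‖ ^ (finrank ℝ E - 1))⁻¹) ^ (finrank ℝ E : ℝ).conjExponent ∂μ =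
      ENNReal.ofReal (sphereMass μ * Real.log (b / a)) := by
    rw [← setLIntegral_annulus_inv_norm_pow μ ha hab]
    refine setLIntegral_congr_fun hs fun y hy => ?_
    have hy0 : 0 < ‖y‖ := ha.trans_le hy.1
    rw [ENNReal.ofReal_rpow_of_nonneg (by positivity) hconj.symm.nonneg]
    rw [Real.inv_rpow (by positivity), ← Real.rpow_natCast, ← Real.rpow_natCast,
      ← Real.rpow_mul hy0.le, Nat.cast_sub (by omega), Real.conjExponent]
    congr 3
    push_cast
    have : (finrank ℝ E : ℝ) - 1 ≠ 0 := by linarith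
    field_simp
  rw [h2, ENNReal.ofReal_rpow_of_nonneg hlog (by have := hconj.symm.pos; positivity)]
  have h3 : 1 / (finrank ℝ E : ℝ).conjExponent = ((finrank ℝ E : ℝ) - 1) / finrank ℝ E := by
    rw [Real.conjExponent, one_div_div]
  rw [h3]
  exact mul_le_of_le_one_left zero_le (ENNReal.rpow_le_one h1 (by positivity))

theorem lintegral_setLIntegral_ball_mul_pow_le (hn : 2 ≤ finrank ℝ E) {f : E → ℝ≥0∞}
    (hf : Measurable f) (hf1 : ∫⁻ y, f y ^ finrank ℝ E ∂μ ≤ 1) (ρ : ℝ) :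
    ∫⁻ x, (∫⁻ y in {y | ‖y‖ < ρ},
        f (x + y) * ENNReal.ofReal ((‖y‖ ^ (finrank ℝ E - 1))⁻¹) ∂μ) ^ finrank ℝ E ∂μ ≤
      ENNReal.ofReal (sphereMass μ * ρ) ^ finrank ℝ E := by
  have hn1 : (1 : ℝ) < finrank ℝ E := by exact_mod_cast hn
  have hconj := Real.HolderConjugate.conjExponent hn1
  set n := finrank ℝ E
  set k : E → ℝ≥0∞ := fun y => ENNReal.ofReal ((‖y‖ ^ (n - 1))⁻¹)
  have hk : Measurable k := by fun_prop
  set ν := μ.restrict {y : E | ‖y‖ < ρ}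
  set A := ENNReal.ofReal (sphereMass μ * ρ)
  have hA : ∫⁻ y, k y ∂ν = A := setLIntegral_ball_inv_norm_pow μ ρ
  have hne : ∀ y, k y ≠ ∞ := fun y => ENNReal.ofReal_ne_top
  have hpt : ∀ x, (∫⁻ y, f (x + y) * k y ∂ν) ^ n ≤ A ^ (n - 1) * ∫⁻ y, f (x + y) ^ n * k y ∂ν := by
    intro x
    have h := ENNReal.lintegral_mul_le_Lp_mul_Lq ν hconj
      (f := fun y => f (x + y) * k y ^ (1 / (n : ℝ)))
      (g := fun y => k y ^ (1 / (n : ℝ).conjExponent)) (by fun_prop) (by fun_prop)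
    have e1 : ∀ y, f (x + y) * k y ^ (1 / (n : ℝ)) * k y ^ (1 / (n : ℝ).conjExponent) =
        f (x + y) * k y := by
      intro y
      rw [mul_assoc, ← ENNReal.rpow_add_of_nonneg _ _ (by positivity)
        (by have := hconj.symm.pos; positivity)]
      have : 1 / (n : ℝ) + 1 / (n : ℝ).conjExponent = 1 := by
        simpa using hconj.inv_add_inv_eq_one
      rw [this, ENNReal.rpow_one]
    have e2 : ∀ y, (f (x + y) * k y ^ (1 / (n : ℝ))) ^ (n : ℝ) = f (x + y) ^ n * k y := by
      intro y
      rw [ENNReal.mul_rpow_of_nonneg _ _ (by positivity), ← ENNReal.rpow_mul,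
        one_div_mul_cancel (by positivity), ENNReal.rpow_one, ENNReal.rpow_natCast]
    have e3 : ∀ y, (k y ^ (1 / (n : ℝ).conjExponent)) ^ (n : ℝ).conjExponent = k y := by
      intro y
      rw [← ENNReal.rpow_mul, one_div_mul_cancel hconj.symm.ne_zero, ENNReal.rpow_one]
    simp only [Pi.mul_apply, e1, e2, e3, hA] at h
    calc _ ≤ ((∫⁻ y, f (x + y) ^ n * k y ∂ν) ^ (1 / (n : ℝ)) *
          A ^ (1 / (n : ℝ).conjExponent)) ^ n := by gcongr
      _ = _ := by
        rw [← ENNReal.rpow_natCast, ENNReal.mul_rpow_of_nonneg _ _ (by positivity),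
          ← ENNReal.rpow_mul, ← ENNReal.rpow_mul, one_div_mul_cancel (by positivity),
          ENNReal.rpow_one, mul_comm, ← ENNReal.rpow_natCast A]
        congr 2
        rw [Nat.cast_sub (by omega), Real.conjExponent]
        have : (n : ℝ) - 1 ≠ 0 := by linarith
        push_cast
        field_simp
  calc _ ≤ ∫⁻ x, A ^ (n - 1) * ∫⁻ y, f (x + y) ^ n * k y ∂ν ∂μ := lintegral_mono hpt
    _ = A ^ (n - 1) * ∫⁻ y, ∫⁻ x, f (x + y) ^ n * k y ∂μ ∂ν := by
      rw [lintegral_const_mul' _ _ (by simp [A]), lintegral_lintegral_swap]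
      exact Measurable.aemeasurable (by fun_prop)
    _ = A ^ (n - 1) * ∫⁻ y, (∫⁻ x, f x ^ n ∂μ) * k y ∂ν := by
      congr 1
      refine lintegral_congr fun y => ?_
      rw [lintegral_mul_const' _ _ (hne y), lintegral_add_right_eq_self (fun x => f x ^ n) y]
    _ ≤ A ^ (n - 1) * ∫⁻ y, 1 * k y ∂ν := by gcongr
    _ = A ^ n := by
      simp only [one_mul, hA]
      rw [← pow_succ, Nat.sub_add_cancel (by omega)]

theorem measure_lt_abs_le (hn : 2 ≤ finrank ℝ E) {u : E → ℝ} (hu : ContDiff ℝ 1 u)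
    (hc : HasCompactSupport u) (hu1 : ∫⁻ y, ‖fderiv ℝ u y‖ₑ ^ finrank ℝ E ∂μ ≤ 1)
    {D : ℝ} (hD : 0 < D) (hdiam : ∀ x ∈ tsupport u, ∀ z ∈ tsupport u, ‖z - x‖ ≤ D)
    {s ε : ℝ} (hs : 0 < s) (hε : 0 < ε) (hε1 : ε < 1) :
    μ {x | s < |u x|} ≤ ENNReal.ofReal ((D / (ε * s)) ^ finrank ℝ E *
      Real.exp (-(finrank ℝ E * (((1 - ε) * (sphereMass μ * s)) ^
        ((finrank ℝ E : ℝ) / (finrank ℝ E - 1)) / sphereMass μ)))) := by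
  set n := finrank ℝ E
  have hn1 : (1 : ℝ) < n := by exact_mod_cast hn
  have hn10 : (n : ℝ) - 1 ≠ 0 := by linarith
  have hS := sphereMass_pos μ
  set S := sphereMass μ
  set T := ((1 - ε) * (S * s)) ^ ((n : ℝ) / (n - 1)) / S with hT
  have h1ε : 0 < 1 - ε := by linarith
  have hb : 0 < (1 - ε) * (S * s) := by positivity
  have hT0 : 0 ≤ T := by positivity
  set ρ := D * Real.exp (-T) with hρdef
  have hρ : 0 < ρ := by positivity
  have hρD : ρ ≤ D := by
    have : Real.exp (-T) ≤ 1 := Real.exp_le_one_iff.2 (by linarith)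
    nlinarith
  have hlog : Real.log (D / ρ) = T := by
    rw [hρdef, Real.exp_neg, div_mul_eq_div_div, div_self hD.ne', one_div, inv_inv, Real.log_exp]
  have hST : (S * Real.log (D / ρ)) ^ (((n : ℝ) - 1) / n) = (1 - ε) * (S * s) := by
    rw [hlog, hT, mul_div_cancel₀ _ hS.ne', ← Real.rpow_mul hb.le]
    rw [show (n : ℝ) / (n - 1) * ((n - 1) / n) = 1 by field_simp, Real.rpow_one]
  set f : E → ℝ≥0∞ := fun y => ‖fderiv ℝ u y‖ₑ
  have hf : Measurable f := by
    have := hu.continuous_fderiv one_ne_zero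
    exact (by fun_prop : Continuous f).measurable
  set k : E → ℝ≥0∞ := fun y => ENNReal.ofReal ((‖y‖ ^ (n - 1))⁻¹)
  have hk : Measurable k := by fun_prop
  set V : E → ℝ≥0∞ := fun x => ∫⁻ y in {y | ‖y‖ < ρ}, f (x + y) * k y ∂μ with hV
  have hVm : Measurable V := by
    refine Measurable.lintegral_prod_right' (f := fun p : E × E => f (p.1 + p.2) * k p.2) ?_
    fun_prop
  have hsub : {x | s < |u x|} ⊆ {x | ENNReal.ofReal (ε * (S * s)) ^ n ≤ V x ^ n} := by
    intro x (hx : s < |u x|)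
    have hxt : x ∈ tsupport u := subset_tsupport u fun h0 => by
      rw [h0, abs_zero] at hx; exact absurd hx hs.not_gt
    have h1 := mul_enorm_le_lintegral_fderiv μ hu hc x
    have hms : MeasurableSet {y : E | ‖y‖ < ρ} := measurableSet_lt measurable_norm measurable_const
    have h2 : ∫⁻ y, f (x + y) * k y ∂μ ≤ V x + ENNReal.ofReal ((1 - ε) * (S * s)) := by
      rw [← lintegral_add_compl _ hms]
      gcongr
      rw [← hST]
      refine le_trans ?_ (setLIntegral_annulus_mul_le μ hn hf hu1 hρ hρD x)
      have hms2 : MeasurableSet {y : E | ρ ≤ ‖y‖ ∧ ‖y‖ ≤ D} :=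
        (measurableSet_le measurable_const measurable_norm).inter
          (measurableSet_le measurable_norm measurable_const)
      rw [← lintegral_indicator hms.compl, ← lintegral_indicator hms2]
      refine lintegral_mono fun y => ?_
      by_cases h1 : ‖y‖ < ρ
      · simp [h1, indicator]
      by_cases h2 : ‖y‖ ≤ D
      · simp [indicator, h1, h2, not_lt.1 h1, k, f, n]
      · have h0 : fderiv ℝ u (x + y) = 0 := by
          by_contra h0
          refine h2 ?_
          simpa using hdiam x hxt (x + y) (support_fderiv_subset ℝ h0)
        have hf0 : f (x + y) = 0 := by
          show ‖fderiv ℝ u (x + y)‖ₑ = 0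
          rw [h0, ← ofReal_norm, norm_zero, ENNReal.ofReal_zero]
        simp [indicator, hf0]
    have h3 : ENNReal.ofReal (S * s) ≤ ENNReal.ofReal S * ‖u x‖ₑ := by
      rw [ENNReal.ofReal_mul hS.le]
      gcongr
      rw [← ofReal_norm]
      exact ENNReal.ofReal_le_ofReal hx.le
    have h4 : ENNReal.ofReal (ε * (S * s)) + ENNReal.ofReal ((1 - ε) * (S * s)) ≤
        V x + ENNReal.ofReal ((1 - ε) * (S * s)) := by
      rw [← ENNReal.ofReal_add (by positivity) (by positivity), ← add_mul]
      simp only [add_sub_cancel, one_mul]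
      exact h3.trans (h1.trans h2)
    have h5 := (ENNReal.add_le_add_iff_right ENNReal.ofReal_ne_top).1 h4
    show ENNReal.ofReal (ε * (S * s)) ^ n ≤ V x ^ n
    gcongr
  have hpos : 0 < ENNReal.ofReal (ε * (S * s)) ^ n :=
    ENNReal.pow_pos (ENNReal.ofReal_pos.2 (by positivity)) _
  calc μ {x | s < |u x|} ≤ μ {x | ENNReal.ofReal (ε * (S * s)) ^ n ≤ V x ^ n} := measure_mono hsub
    _ ≤ (∫⁻ x, V x ^ n ∂μ) / ENNReal.ofReal (ε * (S * s)) ^ n :=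
      meas_ge_le_lintegral_div (by fun_prop) hpos.ne' (by simp)
    _ ≤ ENNReal.ofReal (S * ρ) ^ n / ENNReal.ofReal (ε * (S * s)) ^ n := by
      gcongr
      exact lintegral_setLIntegral_ball_mul_pow_le μ hn hf hu1 ρ
    _ = _ := by
      rw [← ENNReal.ofReal_pow (by positivity), ← ENNReal.ofReal_pow (by positivity),
        ← ENNReal.ofReal_div_of_pos (by positivity)]
      congr 1
      rw [← mul_neg, Real.exp_nat_mul, ← mul_pow, ← div_pow, hρdef]
      congr 1
      field_simp

theorem lintegral_abs_rpow_le (hn : 2 ≤ finrank ℝ E) {u : E → ℝ} (hu : ContDiff ℝ 1 u)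
    (hc : HasCompactSupport u) (hu1 : ∫⁻ y, ‖fderiv ℝ u y‖ₑ ^ finrank ℝ E ∂μ ≤ 1)
    {D V : ℝ} (hD : 0 < D) (hdiam : ∀ x ∈ tsupport u, ∀ z ∈ tsupport u, ‖z - x‖ ≤ D)
    (hV : 0 ≤ V) (hvol : μ (tsupport u) ≤ ENNReal.ofReal V)
    {ε a δ q m : ℝ} (hε : 0 < ε) (hε1 : ε < 1) (ha : 0 < a) (hδ : 0 < δ) (hq : 1 ≤ q)
    (hm : m = (finrank ℝ E : ℝ) / (finrank ℝ E - 1))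
    (haδ : a + δ = finrank ℝ E * ((1 - ε) * sphereMass μ) ^ m / sphereMass μ) :
    ∫⁻ x, ENNReal.ofReal (|u x| ^ q) ∂μ ≤ ENNReal.ofReal
      (V + q * ((D / ε) ^ finrank ℝ E / δ) * (q / (m * a * Real.exp 1)) ^ (q / m)) := by
  have hn1 : (1 : ℝ) < finrank ℝ E := by exact_mod_cast hn
  have hm1 : 1 ≤ m := by rw [hm, le_div_iff₀ (by linarith)]; linarith
  have hS := sphereMass_pos μ
  refine lintegral_rpow_le_of_measure_lt_le hu.continuous.abs.measurable
    (fun x => abs_nonneg _) hV (by positivity) hm1 ha hδ hq (fun s hs => ?_) fun s hs => ?_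
  · refine (measure_mono fun x (hx : s < |u x|) => subset_tsupport u fun h0 => ?_).trans hvol
    rw [h0, abs_zero] at hx
    exact absurd hx hs.not_gt
  · have hs0 : 0 < s := by linarith
    refine (measure_lt_abs_le μ hn hu hc hu1 hD hdiam hs0 hε hε1).trans
      (ENNReal.ofReal_le_ofReal ?_)
    rw [← hm, haδ, ← mul_assoc (1 - ε), Real.mul_rpow (by nlinarith) hs0.le]
    have h1 : D / (ε * s) ≤ D / ε := by
      gcongr
      nlinarith
    have h2 : (finrank ℝ E : ℝ) * (((1 - ε) * sphereMass μ) ^ m * s ^ m / sphereMass μ) =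
      finrank ℝ E * ((1 - ε) * sphereMass μ) ^ m / sphereMass μ * s ^ m := by ring
    rw [h2]
    gcongr

theorem rpow_neg_le_integral_norm_fderiv (hn : 2 ≤ finrank ℝ E) {u : E → ℝ} (hu : ContDiff ℝ 1 u)
    (hc : HasCompactSupport u) {q : ℝ} (hq : 1 ≤ q) (hu1 : ∫ x, |u x| ^ q ∂μ = 1)
    {D V : ℝ} (hD : 0 < D) (hdiam : ∀ x ∈ tsupport u, ∀ z ∈ tsupport u, ‖z - x‖ ≤ D)
    (hV : 0 ≤ V) (hvol : μ (tsupport u) ≤ ENNReal.ofReal V)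
    {ε a δ m : ℝ} (hε : 0 < ε) (hε1 : ε < 1) (ha : 0 < a) (hδ : 0 < δ)
    (hm : m = (finrank ℝ E : ℝ) / (finrank ℝ E - 1))
    (haδ : a + δ = finrank ℝ E * ((1 - ε) * sphereMass μ) ^ m / sphereMass μ) :
    (V + q * ((D / ε) ^ finrank ℝ E / δ) * (q / (m * a * Real.exp 1)) ^ (q / m)) ^
      (-((finrank ℝ E : ℝ) / q)) ≤ ∫ x, ‖fderiv ℝ u x‖ ^ finrank ℝ E ∂μ := by
  set n := finrank ℝ E
  have hn1 : (1 : ℝ) < n := by exact_mod_cast hn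
  have hm0 : 0 < m := by rw [hm]; exact div_pos (by linarith) (by linarith)
  have hq0 : 0 < q := by linarith
  set K := V + q * ((D / ε) ^ n / δ) * (q / (m * a * Real.exp 1)) ^ (q / m)
  have hK : 0 < K := by positivity
  refine le_of_forall_gt_imp_ge_of_dense fun c hlt => ?_
  have hc0 : 0 < c := lt_of_le_of_lt (integral_nonneg fun x => by positivity) hlt
  set t := c ^ (-(1 / (n : ℝ))) with ht
  have ht0 : 0 < t := by positivity
  have htn : t ^ n = c⁻¹ := by
    rw [ht, ← Real.rpow_natCast, ← Real.rpow_mul hc0.le, neg_mul, one_div_mul_cancel (by linarith),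
      Real.rpow_neg_one]
  have hts : tsupport (t • u) ⊆ tsupport u := closure_mono (Function.support_const_smul_subset t u)
  have hfd : Continuous (fderiv ℝ u) := hu.continuous_fderiv one_ne_zero
  have hint : Integrable (fun x => ‖fderiv ℝ u x‖ ^ n) μ := by
    refine Continuous.integrable_of_hasCompactSupport (by fun_prop) ?_
    exact (hc.fderiv ℝ).comp_left (g := fun L : E →L[ℝ] ℝ => ‖L‖ ^ n) (by simp [n]; omega)
  have hintq : Integrable (fun x => |u x| ^ q) μ := by
    by_contra h
    rw [integral_undef h] at hu1
    exact zero_ne_one hu1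
  have hv1 : ∫⁻ y, ‖fderiv ℝ (t • u) y‖ₑ ^ n ∂μ ≤ 1 := by
    have h1 : ∀ y, ‖fderiv ℝ (t • u) y‖ₑ ^ n = ENNReal.ofReal (c⁻¹ * ‖fderiv ℝ u y‖ ^ n) := by
      intro y
      rw [fderiv_const_smul ((hu.differentiable one_ne_zero) y), ← ofReal_norm, norm_smul,
        Real.norm_of_nonneg ht0.le, ← ENNReal.ofReal_pow (by positivity), mul_pow, htn]
    simp only [h1]
    rw [← ofReal_integral_eq_lintegral_ofReal (hint.const_mul _)
      (ae_of_all _ fun x => by positivity), integral_const_mul, ENNReal.ofReal_le_one]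
    rw [inv_mul_le_iff₀ hc0, mul_one]
    exact hlt.le
  have h := lintegral_abs_rpow_le μ hn (u := t • u) (hu.const_smul t) (hc.smul_left (f := fun _ => t)) hv1 hD
    (fun x hx z hz => hdiam x (hts hx) z (hts hz)) hV ((measure_mono hts).trans hvol)
    hε hε1 ha hδ hq hm haδ
  have h2 : ∀ x, |(t • u) x| ^ q = t ^ q * |u x| ^ q := by
    intro x
    rw [Pi.smul_apply, smul_eq_mul, abs_mul, abs_of_pos ht0,
      Real.mul_rpow ht0.le (abs_nonneg _)]
  simp only [h2] at h
  rw [← ofReal_integral_eq_lintegral_ofReal (hintq.const_mul _)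
      (ae_of_all _ fun x => by positivity), integral_const_mul, hu1, mul_one,
      ENNReal.ofReal_le_ofReal_iff hK.le] at h
  have h3 : t ^ q = c ^ (-(q / n)) := by
    rw [ht, ← Real.rpow_mul hc0.le]; congr 1; ring
  rw [h3] at h
  have h4 : (c ^ (-(q / n))) ^ (-((n : ℝ) / q)) = c := by
    rw [← Real.rpow_mul hc0.le]
    rw [show -(q / n) * -((n : ℝ) / q) = 1 by field_simp, Real.rpow_one]
  rw [← h4]
  exact Real.rpow_le_rpow_of_nonpos (by positivity) h (neg_nonpos.2 (by positivity))


end Polar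

section SmoothedNorm

variable {E : Type*} [NormedAddCommGroup E] [NormedSpace ℝ E] [FiniteDimensional ℝ E]

theorem exists_contDiff_lipschitz_norm_approx {ε : ℝ} (hε : 0 < ε) :
    ∃ η : E → ℝ, ContDiff ℝ (⊤ : ℕ∞) η ∧ LipschitzWith 1 η ∧ ∀ y, |η y - ‖y‖| ≤ ε := by
  borelize E
  set μ : Measure E := Measure.addHaar
  set φ : ContDiffBump (0 : E) := ⟨ε / 2, ε, by positivity, by linarith⟩
  have hloc : LocallyIntegrable (fun y : E => ‖y‖) μ := continuous_norm.locallyIntegrable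
  have hφi : Integrable (φ.normed μ) μ := φ.integrable_normed
  have hex : ∀ x, ConvolutionExistsAt (φ.normed μ) (fun y : E => ‖y‖) x
      (ContinuousLinearMap.lsmul ℝ ℝ) μ := fun x =>
    φ.hasCompactSupport_normed.convolutionExists_left _ φ.continuous_normed hloc x
  refine ⟨convolution (φ.normed μ) (fun y : E => ‖y‖) (ContinuousLinearMap.lsmul ℝ ℝ) μ,
    φ.hasCompactSupport_normed.contDiff_convolution_left _ φ.contDiff_normed hloc, ?_, ?_⟩
  · refine LipschitzWith.of_dist_le_mul fun x y => ?_
    rw [Real.dist_eq, convolution_def, convolution_def, ← integral_sub (hex x) (hex y)]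
    calc _ ≤ ∫ t, φ.normed μ t * ‖x - y‖ ∂μ := by
          rw [← Real.norm_eq_abs]
          refine norm_integral_le_of_norm_le (hφi.mul_const _) (ae_of_all _ fun t => ?_)
          simp only [ContinuousLinearMap.lsmul_apply, smul_eq_mul, ← mul_sub]
          rw [norm_mul, Real.norm_of_nonneg (φ.nonneg_normed t)]
          gcongr
          · exact φ.nonneg_normed t
          · simpa using abs_norm_sub_norm_le (x - t) (y - t)
      _ = _ := by
          rw [integral_mul_const, φ.integral_normed, dist_eq_norm]; simp
  · intro y
    have := φ.dist_normed_convolution_le (μ := μ) (g := fun y : E => ‖y‖) (x₀ := y) (ε := ε)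
      hloc.aestronglyMeasurable fun x hx => by
        rw [Real.dist_eq]
        refine (abs_norm_sub_norm_le x y).trans ?_
        rw [← dist_eq_norm]
        exact (Metric.mem_ball.1 hx).le
    rwa [Real.dist_eq] at this

end SmoothedNorm

/-- A smooth truncation of `s ↦ log (R / s)`. -/
theorem exists_contDiff_log_profile {l R : ℝ} (hl : 0 < l) (hR : 4 * l < R) :
    ∃ G : ℝ → ℝ, ContDiff ℝ (⊤ : ℕ∞) G ∧ (∀ s, R ≤ s → G s = 0) ∧
      (∀ s, s ≤ 2 * l → Real.log (R / l) - Real.log 4 ≤ G s) ∧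
      (∀ s, s ∉ Icc l R → deriv G s = 0) ∧ ∀ s ∈ Icc l R, |deriv G s| ≤ s⁻¹ := by
  set χ : ContDiffBump ((R + l) / 2 : ℝ) :=
    ⟨(R - l) / 2 - l, (R - l) / 2, by linarith, by linarith⟩
  have hχ0 : ∀ t, t ≤ l ∨ R ≤ t → χ t = 0 := by
    intro t ht
    refine χ.zero_of_le_dist ?_
    show (R - l) / 2 ≤ dist t _
    rw [Real.dist_eq]
    rcases ht with h | h
    · exact le_trans (by linarith) (neg_le_abs _)
    · exact le_trans (by linarith) (le_abs_self _)
  have hχ1 : ∀ t ∈ Icc (2 * l) (R - l), χ t = 1 := by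
    intro t ht
    refine χ.one_of_mem_closedBall ?_
    rw [Metric.mem_closedBall, Real.dist_eq, abs_le]
    constructor
    · show -((R - l) / 2 - l) ≤ _; linarith [ht.1]
    · show _ ≤ (R - l) / 2 - l; linarith [ht.2]
  set g : ℝ → ℝ := fun t => χ t * t⁻¹
  have hg : ContDiff ℝ (⊤ : ℕ∞) g := by
    rw [contDiff_iff_contDiffAt]
    intro t
    rcases lt_or_ge t l with h | h
    · refine (contDiffAt_const (c := (0 : ℝ))).congr_of_eventuallyEq ?_
      filter_upwards [Iio_mem_nhds h] with x (hx : x < l)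
      simp [g, hχ0 x (Or.inl hx.le)]
    · exact χ.contDiffAt.mul (contDiffAt_inv ℝ (by linarith))
  have hg0 : ∀ t, 0 ≤ g t := by
    intro t
    rcases le_total t l with h | h
    · simp [g, hχ0 t (Or.inl h)]
    · exact mul_nonneg χ.nonneg (inv_nonneg.2 (by linarith))
  have hi : ∀ a b, IntervalIntegrable g volume a b := fun a b => hg.continuous.intervalIntegrable a b
  set G : ℝ → ℝ := fun s => ∫ t in s..R, g t
  have hd : ∀ s, HasDerivAt G (-g s) s := fun s =>
    intervalIntegral.integral_hasDerivAt_left (hi s R)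
      hg.continuous.stronglyMeasurable.stronglyMeasurableAtFilter hg.continuous.continuousAt
  have hdG : deriv G = fun s => -g s := funext fun s => (hd s).deriv
  refine ⟨G, ?_, fun s hs => ?_, fun s hs => ?_, fun s hs => ?_, fun s hs => ?_⟩
  · rw [contDiff_infty_iff_deriv, hdG]
    exact ⟨fun s => (hd s).differentiableAt, hg.neg⟩
  · show ∫ t in s..R, g t = 0
    rw [intervalIntegral.integral_symm, neg_eq_zero]
    refine (intervalIntegral.integral_congr (g := fun _ => 0) fun t ht => ?_).trans (by simp)
    rw [uIcc_of_le hs] at ht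
    simp [g, hχ0 t (Or.inr ht.1)]
  · have h1 : G s = (∫ t in s..(2 * l), g t) + (∫ t in (2 * l)..(R - l), g t) +
        ∫ t in (R - l)..R, g t := by
      rw [intervalIntegral.integral_add_adjacent_intervals (hi _ _) (hi _ _),
        intervalIntegral.integral_add_adjacent_intervals (hi _ _) (hi _ _)]
    have h2 : ∫ t in (2 * l)..(R - l), g t = Real.log ((R - l) / (2 * l)) := by
      rw [← integral_inv_of_pos (by linarith) (by linarith)]
      refine intervalIntegral.integral_congr fun t ht => ?_
      rw [uIcc_of_le (by linarith)] at ht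
      simp [g, hχ1 t ht]
    have h3 : 0 ≤ ∫ t in s..(2 * l), g t := intervalIntegral.integral_nonneg hs fun t _ => hg0 t
    have h4 : 0 ≤ ∫ t in (R - l)..R, g t :=
      intervalIntegral.integral_nonneg (by linarith) fun t _ => hg0 t
    have h5 : Real.log (R / l) - Real.log 4 ≤ Real.log ((R - l) / (2 * l)) := by
      rw [← Real.log_div (div_pos (by linarith) hl).ne' (by norm_num), div_div]
      refine Real.log_le_log (div_pos (by linarith) (by linarith)) ?_
      rw [div_le_div_iff₀ (by linarith) (by linarith)]
      nlinarith
    linarith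
  · have : s ≤ l ∨ R ≤ s := by
      by_contra! h
      exact hs ⟨h.1.le, h.2.le⟩
    simp [hdG, g, hχ0 s this]
  · have hs0 : 0 < s := hl.trans_le hs.1
    rw [hdG, abs_neg, abs_of_nonneg (hg0 s)]
    exact mul_le_of_le_one_left (by positivity) χ.le_one


section LogTest

variable {E : Type*} [NormedAddCommGroup E] [NormedSpace ℝ E] [FiniteDimensional ℝ E]
  [Nontrivial E] [MeasurableSpace E] [BorelSpace E] (μ : Measure E) [μ.IsAddHaarMeasure]

/-- Smooth truncated logarithms (Moser functions) with almost sharp energy. -/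
theorem exists_log_test_function (x₀ : E) {R δ Λ : ℝ} (hR : 0 < R) (hδ : 0 < δ) (hδ1 : δ ≤ 1 / 2)
    (hΛ : Real.log 4 < Λ) :
    ∃ w : E → ℝ, ContDiff ℝ (⊤ : ℕ∞) w ∧ tsupport w ⊆ Metric.closedBall x₀ (2 * R) ∧
      (∀ y ∈ Metric.ball x₀ (R * Real.exp (-Λ)), Λ - Real.log 4 ≤ w y) ∧
      ∫ y, ‖fderiv ℝ w y‖ ^ finrank ℝ E ∂μ ≤
        (1 + δ) ^ finrank ℝ E * sphereMass μ * (Λ + Real.log 4) := by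
  set n := finrank ℝ E
  have hn : n ≠ 0 := Module.finrank_pos.ne'
  set l := R * Real.exp (-Λ) with hl
  have hl0 : 0 < l := by positivity
  have hRl : R / l = Real.exp Λ := by rw [hl, Real.exp_neg]; field_simp
  have hlR : 4 * l < R := by
    rw [← lt_div_iff₀ hl0, hRl]
    exact (Real.log_lt_iff_lt_exp (by norm_num)).1 hΛ
  have hlog : Real.log (R / l) = Λ := by rw [hRl, Real.log_exp]
  obtain ⟨η, hη, hηL, hηa⟩ := exists_contDiff_lipschitz_norm_approx (E := E) (mul_pos hδ hl0)
  obtain ⟨G, hG, hG0, hG1, hGd0, hGd⟩ := exists_contDiff_log_profile hl0 hlR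
  have hδl : δ * l ≤ l / 2 := by nlinarith
  have hηs : ContDiff ℝ (⊤ : ℕ∞) fun y => η (y - x₀) := hη.comp (contDiff_id.sub contDiff_const)
  have hw : ContDiff ℝ (⊤ : ℕ∞) fun y => G (η (y - x₀)) := hG.comp hηs
  have hb : ∀ y, ‖fderiv ℝ (fun y => G (η (y - x₀))) y‖ ≤ |deriv G (η (y - x₀))| := by
    intro y
    have h1 : HasFDerivAt (fun y => η (y - x₀)) (fderiv ℝ η (y - x₀)) y := by
      have := ((hη.differentiable (by simp)) (y - x₀)).hasFDerivAt
      exact this.comp y ((hasFDerivAt_id y).sub_const x₀)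
    have h2 : HasDerivAt G (deriv G (η (y - x₀))) (η (y - x₀)) :=
      ((hG.differentiable (by simp)) _).hasDerivAt
    have h3 : HasFDerivAt (fun y => G (η (y - x₀)))
        (deriv G (η (y - x₀)) • fderiv ℝ η (y - x₀)) y := h2.comp_hasFDerivAt y h1
    rw [h3.fderiv, norm_smul, Real.norm_eq_abs]
    refine mul_le_of_le_one_right (abs_nonneg _) ?_
    simpa using norm_fderiv_le_of_lipschitz ℝ hηL (x₀ := y - x₀)
  refine ⟨fun y => G (η (y - x₀)), hw, ?_, fun y hy => ?_, ?_⟩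
  · refine closure_minimal (fun y hy => ?_) Metric.isClosed_closedBall
    by_contra h
    rw [Metric.mem_closedBall, dist_eq_norm, not_le] at h
    have := (abs_le.1 (hηa (y - x₀))).1
    exact hy (hG0 _ (by linarith))
  · rw [mem_ball_iff_norm] at hy
    have := (abs_le.1 (hηa (y - x₀))).2
    rw [← hlog]
    exact hG1 _ (by linarith)
  · have hlam := Real.log_nonneg (show (1 : ℝ) ≤ 4 by norm_num)
    have hΛ0 : 0 < Λ := by linarith
    have hS := sphereMass_pos μ
    set A : Set E := {z | l / 2 ≤ ‖z‖ ∧ ‖z‖ ≤ 2 * R}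
    have hA : MeasurableSet A :=
      (measurableSet_le measurable_const measurable_norm).inter
        (measurableSet_le measurable_norm measurable_const)
    rw [integral_eq_lintegral_of_nonneg_ae (ae_of_all _ fun y => by positivity)
      (by have := hw.continuous_fderiv (by simp); exact (by fun_prop : Continuous _).aestronglyMeasurable)]
    refine ENNReal.toReal_le_of_le_ofReal (by positivity) ?_
    calc _ ≤ ∫⁻ y, A.indicator (fun z => ENNReal.ofReal ((1 + δ) ^ n) *
            ENNReal.ofReal ((‖z‖ ^ n)⁻¹)) (y - x₀) ∂μ := by
          refine lintegral_mono fun y => ?_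
          dsimp only
          by_cases hs : η (y - x₀) ∈ Icc l R
          · have h1 := abs_le.1 (hηa (y - x₀))
            have hyA : y - x₀ ∈ A := ⟨by linarith [hs.1], by linarith [hs.2]⟩
            have hs0 : 0 < η (y - x₀) := hl0.trans_le hs.1
            have hz : 0 < ‖y - x₀‖ := by linarith [hyA.1]
            rw [indicator_of_mem hyA, ← ENNReal.ofReal_mul (by positivity)]
            refine ENNReal.ofReal_le_ofReal ?_
            rw [← inv_pow, ← mul_pow]
            gcongr
            refine (hb y).trans ((hGd _ hs).trans ?_)
            rw [← div_eq_mul_inv, inv_eq_one_div, div_le_div_iff₀ hs0 hz]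
            nlinarith [hs.1]
          · have h1 := hb y
            rw [hGd0 _ hs, abs_zero] at h1
            rw [le_antisymm h1 (norm_nonneg _), zero_pow hn]
            simp
      _ = ∫⁻ y, A.indicator (fun z => ENNReal.ofReal ((1 + δ) ^ n) *
            ENNReal.ofReal ((‖z‖ ^ n)⁻¹)) y ∂μ := lintegral_sub_right_eq_self _ x₀
      _ = ENNReal.ofReal ((1 + δ) ^ n) * ENNReal.ofReal (sphereMass μ *
            Real.log (2 * R / (l / 2))) := by
          rw [lintegral_indicator hA, lintegral_const_mul' _ _ ENNReal.ofReal_ne_top,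
            setLIntegral_annulus_inv_norm_pow μ (by linarith) (by linarith)]
      _ = _ := by
          rw [← ENNReal.ofReal_mul (by positivity),
            show 2 * R / (l / 2) = R / l * 4 by field_simp; ring,
            Real.log_mul (by positivity) (by norm_num), hlog, mul_assoc]

/-- Normalised test functions supported in a given ball. -/
theorem exists_test_function_integral_le (x₀ : E) {R δ Λ q : ℝ} (hR : 0 < R) (hδ : 0 < δ)
    (hδ1 : δ ≤ 1 / 2) (hΛ : Real.log 4 < Λ) (hq : 0 < q) :
    ∃ u : E → ℝ, ContDiff ℝ (⊤ : ℕ∞) u ∧ tsupport u ⊆ Metric.closedBall x₀ (2 * R) ∧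
      ∫ y, |u y| ^ q ∂μ = 1 ∧
      ∫ y, ‖fderiv ℝ u y‖ ^ finrank ℝ E ∂μ ≤
        (1 + δ) ^ finrank ℝ E * sphereMass μ * (Λ + Real.log 4) /
          ((μ.real (Metric.ball 0 1) * (R * Real.exp (-Λ)) ^ finrank ℝ E) ^ ((finrank ℝ E : ℝ) / q) *
            (Λ - Real.log 4) ^ finrank ℝ E) := by
  obtain ⟨w, hw, hws, hwb, hwe⟩ := exists_log_test_function μ x₀ hR hδ hδ1 hΛ
  set n := finrank ℝ E
  set B := Metric.ball x₀ (R * Real.exp (-Λ))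
  have hc : HasCompactSupport w := (isCompact_closedBall x₀ (2 * R)).of_isClosed_subset
    (isClosed_tsupport w) hws
  have hκ : 0 < μ.real (Metric.ball (0 : E) 1) :=
    ENNReal.toReal_pos (Metric.measure_ball_pos μ 0 one_pos).ne' measure_ball_lt_top.ne
  have hB : μ.real B = μ.real (Metric.ball (0 : E) 1) * (R * Real.exp (-Λ)) ^ n := by
    rw [Measure.real, μ.addHaar_ball x₀ (by positivity), ENNReal.toReal_mul,
      ENNReal.toReal_ofReal (by positivity), mul_comm]; rfl
  have hB0 : 0 < μ.real B := by rw [hB]; positivity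
  have hΛ0 : 0 < Λ - Real.log 4 := by linarith
  have hi : Integrable (fun y => |w y| ^ q) μ := by
    refine Continuous.integrable_of_hasCompactSupport
      (hw.continuous.abs.rpow_const fun _ => Or.inr hq.le) ?_
    exact hc.comp_left (g := fun r : ℝ => |r| ^ q) (by simp [Real.zero_rpow hq.ne'])
  set I := ∫ y, |w y| ^ q ∂μ with hI
  have hIB : (Λ - Real.log 4) ^ q * μ.real B ≤ I := by
    calc (Λ - Real.log 4) ^ q * μ.real B = ∫ y in B, (Λ - Real.log 4) ^ q ∂μ := by
          rw [setIntegral_const, smul_eq_mul, mul_comm]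
      _ ≤ ∫ y in B, |w y| ^ q ∂μ := by
          refine setIntegral_mono_on (integrableOn_const measure_ball_lt_top.ne)
            hi.integrableOn measurableSet_ball fun y hy => ?_
          exact Real.rpow_le_rpow hΛ0.le ((hwb y hy).trans (le_abs_self _)) hq.le
      _ ≤ I := setIntegral_le_integral hi (ae_of_all _ fun y => by positivity)
  have hI0 : 0 < I := lt_of_lt_of_le (by positivity) hIB
  set t := I ^ (-(1 / q)) with ht
  have ht0 : 0 < t := by positivity
  have htq : t ^ q = I⁻¹ := by
    rw [ht, ← Real.rpow_mul hI0.le, neg_mul, one_div_mul_cancel hq.ne', Real.rpow_neg_one]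
  have htn : t ^ n = (I ^ ((n : ℝ) / q))⁻¹ := by
    rw [ht, ← Real.rpow_natCast, ← Real.rpow_mul hI0.le, ← Real.rpow_neg hI0.le]
    congr 1; ring
  have hIn : μ.real B ^ ((n : ℝ) / q) * (Λ - Real.log 4) ^ n ≤ I ^ ((n : ℝ) / q) := by
    refine le_trans (le_of_eq ?_) (Real.rpow_le_rpow (by positivity) hIB (by positivity))
    rw [Real.mul_rpow (by positivity) hB0.le, ← Real.rpow_mul hΛ0.le,
      mul_div_cancel₀ _ hq.ne', Real.rpow_natCast, mul_comm]
  refine ⟨t • w, hw.const_smul t, (closure_mono (Function.support_const_smul_subset t w)).trans hws,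
    ?_, ?_⟩
  · have h2 : ∀ x, |(t • w) x| ^ q = t ^ q * |w x| ^ q := by
      intro x
      rw [Pi.smul_apply, smul_eq_mul, abs_mul, abs_of_pos ht0,
        Real.mul_rpow ht0.le (abs_nonneg _)]
    simp only [h2]
    rw [integral_const_mul, htq, ← hI, inv_mul_cancel₀ hI0.ne']
  · have h1 : ∀ y, ‖fderiv ℝ (t • w) y‖ ^ n = t ^ n * ‖fderiv ℝ w y‖ ^ n := by
      intro y
      rw [fderiv_const_smul ((hw.differentiable (by simp)) y), norm_smul,
        Real.norm_of_nonneg ht0.le, mul_pow]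
    simp only [h1]
    rw [integral_const_mul, htn, inv_mul_eq_div, ← hB]
    exact div_le_div₀ ((integral_nonneg fun y => by positivity).trans hwe) hwe (by positivity) hIn

end LogTest

section Asymptotics

theorem tendsto_const_mul_rpow_neg_div {K : ℝ} (hK : 0 < K) (c : ℝ) :
    Tendsto (fun q : ℝ => (K * q) ^ (-(c / q))) atTop (𝓝 1) := by
  have h1 : Tendsto (fun q : ℝ => K ^ (-(c / q))) atTop (𝓝 1) := by
    have h : Tendsto (fun q : ℝ => -(c / q)) atTop (𝓝 0) := by
      simpa using (tendsto_const_nhds (x := c)).div_atTop tendsto_id |>.neg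
    simpa using (tendsto_const_nhds (x := K)).rpow h (Or.inl hK.ne')
  have h2 : Tendsto (fun q : ℝ => q ^ (-(c / q))) atTop (𝓝 1) := by
    refine (tendsto_rpow_div_mul_add (-c) 1 0 (by norm_num)).congr fun q => ?_
    congr 1
    ring
  refine (by simpa using h1.mul h2 : Tendsto _ atTop (𝓝 (1 : ℝ))).congr' ?_
  filter_upwards [eventually_gt_atTop 0] with q hq
  rw [Real.mul_rpow hK.le hq.le]

theorem exists_tendsto_le_pow_mul_rpow_neg {n : ℕ} (hn : 2 ≤ n) {b C V m : ℝ} (hb : 0 < b)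
    (hC : 0 < C) (hV : 0 ≤ V) (hm : m = (n : ℝ) / (n - 1)) :
    ∃ g : ℝ → ℝ, Tendsto g atTop (𝓝 (b ^ (n - 1))) ∧ ∀ᶠ q : ℝ in atTop,
      g q ≤ q ^ (n - 1) * (V + q * C * (q / b) ^ (q / m)) ^ (-((n : ℝ) / q)) := by
  have hn1 : (1 : ℝ) < n := by exact_mod_cast hn
  have hm0 : 0 < m := by rw [hm]; exact div_pos (by linarith) (by linarith)
  refine ⟨fun q => b ^ (n - 1) * ((V + C) * q) ^ (-((n : ℝ) / q)), ?_, ?_⟩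
  · simpa using (tendsto_const_mul_rpow_neg_div (by positivity : 0 < V + C) n).const_mul
      (b ^ (n - 1))
  · filter_upwards [eventually_ge_atTop 1, eventually_ge_atTop b] with q hq1 hqb
    have hq0 : 0 < q := by linarith
    have hM : 1 ≤ (q / b) ^ (q / m) :=
      Real.one_le_rpow ((one_le_div hb).2 hqb) (by positivity)
    have hle : V + q * C * (q / b) ^ (q / m) ≤ (V + C) * q * (q / b) ^ (q / m) := by
      have : V ≤ V * q * (q / b) ^ (q / m) := by
        rw [mul_assoc]
        exact le_mul_of_one_le_right hV (one_le_mul_of_one_le_of_one_le hq1 hM)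
      nlinarith
    have hbq : ((q / b) ^ (q / m)) ^ (-((n : ℝ) / q)) = b ^ (n - 1) / q ^ (n - 1) := by
      rw [← Real.rpow_mul (by positivity), show q / m * -((n : ℝ) / q) = -((n - 1 : ℕ) : ℝ) by
        rw [Nat.cast_sub (by omega), hm]; field_simp; simp, Real.rpow_neg (by positivity),
        Real.rpow_natCast, div_pow, inv_div]
    calc b ^ (n - 1) * ((V + C) * q) ^ (-((n : ℝ) / q))
        = q ^ (n - 1) * ((V + C) * q * (q / b) ^ (q / m)) ^ (-((n : ℝ) / q)) := by
          rw [Real.mul_rpow (x := (V + C) * q) (by positivity) (by positivity), hbq]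
          field_simp
      _ ≤ _ := by
          refine mul_le_mul_of_nonneg_left ?_ (by positivity)
          exact Real.rpow_le_rpow_of_nonpos (by positivity) hle (neg_nonpos.2 (by positivity))

theorem tendsto_pow_mul_log_test_energy {n : ℕ} (hn : 2 ≤ n) {κ R A a c : ℝ} (hκ : 0 < κ)
    (hR : 0 < R) (hc : c = ((n : ℝ) - 1) / n ^ 2) :
    Tendsto (fun q : ℝ => q ^ (n - 1) * (A * (c * q + a) /
      ((κ * (R * Real.exp (-(c * q))) ^ n) ^ ((n : ℝ) / q) * (c * q - a) ^ n))) atTop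
      (𝓝 (A * (Real.exp 1 / c) ^ (n - 1))) := by
  have hn1 : (1 : ℝ) < n := by exact_mod_cast hn
  have hc0 : 0 < c := by rw [hc]; exact div_pos (by linarith) (by positivity)
  have h0 : ∀ d : ℝ, Tendsto (fun q : ℝ => d / q) atTop (𝓝 0) := fun d =>
    tendsto_const_nhds.div_atTop tendsto_id
  have h1 : Tendsto (fun q : ℝ => (κ * R ^ n) ^ ((n : ℝ) / q)) atTop (𝓝 1) := by
    simpa using (tendsto_const_nhds (x := κ * R ^ n)).rpow (h0 n) (Or.inl (by positivity))
  have h2 : Tendsto (fun q : ℝ => A * (c + a / q) /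
      ((κ * R ^ n) ^ ((n : ℝ) / q) * Real.exp (-1) ^ (n - 1) * (c - a / q) ^ n)) atTop
      (𝓝 (A * (c + 0) / (1 * Real.exp (-1) ^ (n - 1) * (c - 0) ^ n))) :=
    (((h0 a).const_add c).const_mul A).div ((h1.mul_const _).mul (((h0 a).const_sub c).pow n))
      (by simp [hc0.ne'])
  have h3 : A * (c + 0) / (1 * Real.exp (-1) ^ (n - 1) * (c - 0) ^ n) =
      A * (Real.exp 1 / c) ^ (n - 1) := by
    obtain ⟨k, rfl⟩ : ∃ k, n = k + 1 := ⟨n - 1, by omega⟩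
    rw [Real.exp_neg, Nat.add_sub_cancel, inv_pow, div_pow, pow_succ, add_zero, sub_zero, one_mul]
    field_simp
  rw [h3] at h2
  refine h2.congr' ?_
  filter_upwards [eventually_gt_atTop 0] with q hq
  have h4 : (κ * (R * Real.exp (-(c * q))) ^ n) ^ ((n : ℝ) / q) =
      (κ * R ^ n) ^ ((n : ℝ) / q) * Real.exp (-1) ^ (n - 1) := by
    rw [mul_pow, ← mul_assoc, Real.mul_rpow (by positivity) (by positivity)]
    congr 1
    rw [← Real.exp_nat_mul, ← Real.exp_mul, ← Real.exp_nat_mul, hc, Nat.cast_sub (by omega)]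
    congr 1
    field_simp
    simp
  have h5 : c * q + a = q * (c + a / q) := by field_simp
  have h6 : (c * q - a) ^ n = q ^ (n - 1) * q * (c - a / q) ^ n := by
    rw [← pow_succ, show n - 1 + 1 = n by omega, ← mul_pow]
    congr 1; field_simp
  rw [h4, h5, h6]
  by_cases h7 : (c - a / q) ^ n = 0
  · simp [h7]
  · field_simp

end Asymptotics

section DirichletInf

variable {E : Type*} [NormedAddCommGroup E] [NormedSpace ℝ E] [FiniteDimensional ℝ E]
  [Nontrivial E] [MeasurableSpace E] [BorelSpace E] (μ : Measure E) [μ.IsAddHaarMeasure]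

/-- The conformal Dirichlet energies of the test functions on `Ω` normalised in `L^q`. -/
def dirichletEnergies {E : Type*} [NormedAddCommGroup E] [NormedSpace ℝ E] [MeasurableSpace E]
    (μ : Measure E) (Ω : Set E) (q : ℝ) : Set ℝ :=
  {c | ∃ u : E → ℝ, ContDiff ℝ (⊤ : ℕ∞) u ∧ HasCompactSupport u ∧ tsupport u ⊆ Ω ∧
    ∫ x, |u x| ^ q ∂μ = 1 ∧ c = ∫ x, ‖fderiv ℝ u x‖ ^ finrank ℝ E ∂μ}

theorem dirichletEnergies_bddBelow {E : Type*} [NormedAddCommGroup E] [NormedSpace ℝ E]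
    [MeasurableSpace E] (μ : Measure E) (Ω : Set E) (q : ℝ) :
    BddBelow (dirichletEnergies μ Ω q) := by
  refine ⟨0, ?_⟩
  rintro c ⟨u, -, -, -, -, rfl⟩
  exact integral_nonneg fun x => by positivity

theorem exists_dirichletEnergies_le {Ω : Set E} {x₀ : E} {R δ Λ q : ℝ}
    (hΩ : Metric.closedBall x₀ (2 * R) ⊆ Ω) (hR : 0 < R) (hδ : 0 < δ)
    (hδ1 : δ ≤ 1 / 2) (hΛ : Real.log 4 < Λ) (hq : 0 < q) :
    ∃ c ∈ dirichletEnergies μ Ω q, c ≤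
      (1 + δ) ^ finrank ℝ E * sphereMass μ * (Λ + Real.log 4) /
        ((μ.real (Metric.ball 0 1) * (R * Real.exp (-Λ)) ^ finrank ℝ E) ^ ((finrank ℝ E : ℝ) / q) *
          (Λ - Real.log 4) ^ finrank ℝ E) := by
  obtain ⟨u, hu, hus, hu1, hue⟩ := exists_test_function_integral_le μ x₀ hR hδ hδ1 hΛ hq
  exact ⟨_, ⟨u, hu, (isCompact_closedBall x₀ (2 * R)).of_isClosed_subset (isClosed_tsupport u) hus,
    hus.trans hΩ, hu1, rfl⟩, hue⟩

/-- The sharp asymptotics of the embedding constants `W₀^{1,n} ⊂ L^q` as `q → ∞`. -/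
theorem tendsto_pow_mul_sInf_dirichletEnergies (hn : 2 ≤ finrank ℝ E) {Ω : Set E} (hΩo : IsOpen Ω)
    (hΩb : Bornology.IsBounded Ω) (hΩ : Ω.Nonempty) :
    Tendsto (fun q : ℝ => q ^ (finrank ℝ E - 1) * sInf (dirichletEnergies μ Ω q)) atTop
      (𝓝 ((finrank ℝ E * Real.exp 1 / ((finrank ℝ E : ℝ) - 1) *
        (finrank ℝ E * sphereMass μ ^ ((1 : ℝ) / ((finrank ℝ E : ℝ) - 1)))) ^
          (finrank ℝ E - 1))) := by
  have hS := sphereMass_pos μ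
  set S := sphereMass μ
  set n := finrank ℝ E
  have hn1 : (1 : ℝ) < n := by exact_mod_cast hn
  have hn0 : (0 : ℝ) < n - 1 := by linarith
  obtain ⟨x₀, hx₀⟩ := hΩ
  obtain ⟨r, hr, hrΩ⟩ := Metric.nhds_basis_closedBall.mem_iff.1 (hΩo.mem_nhds hx₀)
  have hrΩ' : Metric.closedBall x₀ (2 * (r / 2)) ⊆ Ω := by rwa [mul_div_cancel₀ _ two_ne_zero]
  refine tendsto_order.2 ⟨fun L hL => ?_, fun L hL => ?_⟩
  · set m : ℝ := n / (n - 1) with hm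
    have hm0 : 0 < m := by positivity
    set F : ℝ → ℝ := fun ε => (m * ((1 - ε) * (n * ((1 - ε) * S) ^ m / S)) * Real.exp 1) ^ (n - 1)
    have hF : Continuous F := by
      have : Continuous fun ε : ℝ => ((1 - ε) * S) ^ m :=
        (by fun_prop : Continuous fun ε : ℝ => (1 - ε) * S).rpow_const fun _ => Or.inr hm0.le
      fun_prop
    have hF0 : F 0 = (n * Real.exp 1 / ((n : ℝ) - 1) *
        (n * S ^ ((1 : ℝ) / ((n : ℝ) - 1)))) ^ (n - 1) := by
      have hSm : S ^ m = S * S ^ ((1 : ℝ) / ((n : ℝ) - 1)) := by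
        rw [← Real.rpow_one_add' hS.le (by positivity), hm]
        congr 1; field_simp; ring
      simp only [F, sub_zero, one_mul, hSm]
      rw [hm]
      congr 1; field_simp
    rw [← hF0] at hL
    have hev : ∀ᶠ ε in 𝓝[>] (0 : ℝ), L < F ε :=
      (hF.continuousAt.eventually_const_lt hL).filter_mono nhdsWithin_le_nhds
    obtain ⟨ε, hLε, hε0, hε1⟩ := (hev.and (Ioo_mem_nhdsGT one_pos)).exists
    set lam := n * ((1 - ε) * S) ^ m / S
    have h1ε : 0 < 1 - ε := by linarith
    have hlam : 0 < lam := by positivity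
    obtain ⟨C, hC⟩ := Metric.isBounded_iff.1 hΩb
    obtain ⟨g, hg, hgle⟩ := exists_tendsto_le_pow_mul_rpow_neg (n := n) hn
      (b := m * ((1 - ε) * lam) * Real.exp 1) (C := (max C 1 / ε) ^ n / (ε * lam))
      (V := μ.real Ω) (m := m) (by positivity) (by positivity) (by positivity) hm
    filter_upwards [hg.eventually_const_lt hLε, hgle, eventually_ge_atTop 1,
      eventually_gt_atTop (Real.log 4)] with q hLg hgq hq1 hq4
    refine hLg.trans_le (hgq.trans (mul_le_mul_of_nonneg_left ?_ (by positivity)))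
    obtain ⟨c, hc, -⟩ := exists_dirichletEnergies_le μ hrΩ' (by positivity) one_half_pos le_rfl hq4
      (by linarith : 0 < q)
    refine le_csInf ⟨c, hc⟩ ?_
    rintro c ⟨u, hu, huc, hus, hu1, rfl⟩
    refine rpow_neg_le_integral_norm_fderiv μ hn (hu.of_le (by simp)) huc hq1 hu1
      (D := max C 1) (by positivity) (fun x hx z hz => ?_) measureReal_nonneg ?_ hε0 hε1
      (by positivity) (by positivity) hm ?_
    · rw [← dist_eq_norm]
      exact (hC (hus hz) (hus hx)).trans (le_max_left _ _)
    · rw [ofReal_measureReal hΩb.measure_lt_top.ne]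
      exact measure_mono hus
    · show (1 - ε) * lam + ε * lam = lam
      ring
  · set c : ℝ := ((n : ℝ) - 1) / n ^ 2 with hc
    have hc0 : 0 < c := by positivity
    have hlim : S * (Real.exp 1 / c) ^ (n - 1) = (n * Real.exp 1 / ((n : ℝ) - 1) *
        (n * S ^ ((1 : ℝ) / ((n : ℝ) - 1)))) ^ (n - 1) := by
      have hSm : (S ^ ((1 : ℝ) / ((n : ℝ) - 1))) ^ (n - 1) = S := by
        rw [← Real.rpow_natCast, ← Real.rpow_mul hS.le, Nat.cast_sub (by omega), Nat.cast_one,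
          one_div_mul_cancel hn0.ne', Real.rpow_one]
      rw [← mul_assoc, mul_pow _ (S ^ _), hSm, mul_comm, hc]
      congr 2; field_simp
    rw [← hlim] at hL
    have hF : Continuous fun δ : ℝ => (1 + δ) ^ n * S * (Real.exp 1 / c) ^ (n - 1) := by fun_prop
    have hev : ∀ᶠ δ in 𝓝[>] (0 : ℝ), (1 + δ) ^ n * S * (Real.exp 1 / c) ^ (n - 1) < L :=
      (hF.continuousAt.eventually_lt_const (by simpa using hL)).filter_mono nhdsWithin_le_nhds
    obtain ⟨δ, hδL, hδ0, hδ1⟩ := (hev.and (Ioo_mem_nhdsGT one_half_pos)).exists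
    have hκ : 0 < μ.real (Metric.ball (0 : E) 1) :=
      ENNReal.toReal_pos (Metric.measure_ball_pos μ 0 one_pos).ne' measure_ball_lt_top.ne
    have ht := tendsto_pow_mul_log_test_energy hn (A := (1 + δ) ^ n * S) (a := Real.log 4) hκ
      (half_pos hr) hc
    filter_upwards [ht.eventually_lt_const hδL, eventually_gt_atTop 0,
      eventually_gt_atTop (Real.log 4 / c)] with q hq hq0 hq4
    refine lt_of_le_of_lt (mul_le_mul_of_nonneg_left ?_ (by positivity)) hq
    rw [div_lt_iff₀' hc0] at hq4
    obtain ⟨e, he, hle⟩ := exists_dirichletEnergies_le μ hrΩ' (half_pos hr) hδ0 hδ1.le hq4 hq0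
    exact (csInf_le (dirichletEnergies_bddBelow μ Ω q) he).trans hle

end DirichletInf

section Finsler

variable {N : ℕ} {H : Euc N → ℝ}

/-- `ℝ^N` as a normed space with the norm `H`. -/
def FinslerSpace {N : ℕ} {H : Euc N → ℝ} (_ : IsFinslerNorm N H) : Type := Euc N

namespace FinslerSpace

variable (h : IsFinslerNorm N H)

instance : AddCommGroup (FinslerSpace h) := inferInstanceAs (AddCommGroup (Euc N))

instance : Module ℝ (FinslerSpace h) := inferInstanceAs (Module ℝ (Euc N))

/-- The identity map from `ℝ^N` to `FinslerSpace h`. -/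
def ofEuc : Euc N ≃ₗ[ℝ] FinslerSpace h := LinearEquiv.refl ℝ (Euc N)

instance : Norm (FinslerSpace h) := ⟨fun x => H ((ofEuc h).symm x)⟩

theorem normedSpaceCore : NormedSpace.Core ℝ (FinslerSpace h) where
  norm_nonneg x := h.2.1 _
  norm_smul c x := h.2.2.2 c _
  norm_triangle x y := by
    have h1 := h.1.2 (mem_univ ((ofEuc h).symm x)) (mem_univ ((ofEuc h).symm y))
      one_half_pos.le one_half_pos.le (add_halves 1)
    rw [← smul_add, h.2.2.2, abs_of_pos one_half_pos, smul_eq_mul, smul_eq_mul, ← map_add] at h1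
    change H ((ofEuc h).symm (x + y)) ≤ H ((ofEuc h).symm x) + H ((ofEuc h).symm y)
    linarith
  norm_eq_zero_iff x := h.2.2.1 _

instance : NormedAddCommGroup (FinslerSpace h) := NormedAddCommGroup.ofCore (normedSpaceCore h)

instance : NormedSpace ℝ (FinslerSpace h) := NormedSpace.ofCore (normedSpaceCore h)

instance : FiniteDimensional ℝ (FinslerSpace h) := Module.Finite.equiv (ofEuc h)

theorem norm_ofEuc (ξ : Euc N) : ‖ofEuc h ξ‖ = H ξ := rfl

/-- The identification of `ℝ^N` with the dual of `FinslerSpace h` by the inner product. -/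
def toDual : Euc N →ₗ[ℝ] StrongDual ℝ (FinslerSpace h) where
  toFun x := LinearMap.toContinuousLinearMap ((innerₗ (Euc N) x).comp (ofEuc h).symm.toLinearMap)
  map_add' x y := by ext z; simp
  map_smul' c x := by ext z; simp

theorem toDual_apply_ofEuc (x ξ : Euc N) : toDual h x (ofEuc h ξ) = ⟪x, ξ⟫ := by
  simp [toDual]

theorem toDual_injective : Function.Injective (toDual h) := by
  refine (injective_iff_map_eq_zero _).2 fun x hx => ?_
  have := toDual_apply_ofEuc h x x
  rw [hx, zero_apply] at this
  exact inner_self_eq_zero.1 this.symm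

theorem finrank_dual : finrank ℝ (StrongDual ℝ (FinslerSpace h)) = N := by
  rw [← (LinearMap.toContinuousLinearMap : (FinslerSpace h →ₗ[ℝ] ℝ) ≃ₗ[ℝ] _).finrank_eq,
    Subspace.dual_finrank_eq, ← (ofEuc h).finrank_eq, finrank_euclideanSpace_fin]

/-- `FinslerSpace.toDual` as a continuous linear equivalence. -/
def dualEquiv : Euc N ≃L[ℝ] StrongDual ℝ (FinslerSpace h) :=
  ((toDual h).linearEquivOfInjective (toDual_injective h)
    (by rw [finrank_dual, finrank_euclideanSpace_fin])).toContinuousLinearEquiv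

theorem dualEquiv_apply_ofEuc (x ξ : Euc N) : dualEquiv h x (ofEuc h ξ) = ⟪x, ξ⟫ :=
  toDual_apply_ofEuc h x ξ

theorem norm_dualEquiv (hN : N ≠ 0) (x : Euc N) : ‖dualEquiv h x‖ = dualNorm H x := by
  have : Nontrivial (Euc N) := by
    have : Nonempty (Fin N) := ⟨⟨0, Nat.pos_of_ne_zero hN⟩⟩
    infer_instance
  have hpos : ∀ ξ : Euc N, ξ ≠ 0 → 0 < H ξ := fun ξ hξ =>
    lt_of_le_of_ne (h.2.1 ξ) fun h0 => hξ ((h.2.2.1 ξ).1 h0.symm)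
  obtain ⟨ξ₀, hξ₀⟩ := exists_ne (0 : Euc N)
  have hlub : IsLUB {r : ℝ | ∃ ξ : Euc N, ξ ≠ 0 ∧ r = ⟪x, ξ⟫ / H ξ} ‖dualEquiv h x‖ := by
    refine ⟨?_, fun B hB => ?_⟩
    · rintro r ⟨ξ, hξ, rfl⟩
      rw [div_le_iff₀ (hpos ξ hξ), ← dualEquiv_apply_ofEuc h, ← norm_ofEuc h]
      exact (le_abs_self _).trans ((dualEquiv h x).le_opNorm _)
    · have hle : ∀ ξ : Euc N, |⟪x, ξ⟫| ≤ B * H ξ := by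
        intro ξ
        rcases eq_or_ne ξ 0 with rfl | hξ
        · simp [(h.2.2.1 0).2 rfl]
        · have h1 := hB ⟨ξ, hξ, rfl⟩
          have h2 := hB ⟨-ξ, neg_ne_zero.2 hξ, rfl⟩
          have h3 : H (-ξ) = H ξ := by simpa using h.2.2.2 (-1) ξ
          rw [inner_neg_right, h3, div_le_iff₀ (hpos ξ hξ)] at h2
          rw [div_le_iff₀ (hpos ξ hξ)] at h1
          exact abs_le.2 ⟨by linarith, h1⟩
      refine ContinuousLinearMap.opNorm_le_bound _ ?_ fun z => ?_
      · exact nonneg_of_mul_nonneg_left ((abs_nonneg _).trans (hle ξ₀)) (hpos ξ₀ hξ₀)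
      · obtain ⟨ξ, rfl⟩ := (ofEuc h).surjective z
        rw [dualEquiv_apply_ofEuc, norm_ofEuc]
        exact hle ξ
  exact (hlub.csSup_eq ⟨_, ξ₀, hξ₀, rfl⟩).symm

theorem norm_fderiv_eq (v : StrongDual ℝ (FinslerSpace h) → ℝ) (x : Euc N) :
    ‖fderiv ℝ v (dualEquiv h x)‖ = H (gradient (v ∘ dualEquiv h) x) := by
  rw [← norm_ofEuc h, ← (NormedSpace.inclusionInDoubleDualLi ℝ).norm_map]
  congr 1
  ext f
  obtain ⟨y, rfl⟩ := (dualEquiv h).surjective f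
  have h1 : fderiv ℝ (v ∘ dualEquiv h) x y = fderiv ℝ v (dualEquiv h x) (dualEquiv h y) := by
    rw [(dualEquiv h).comp_right_fderiv]; rfl
  rw [← h1, ← inner_gradient_left, real_inner_comm, ← dualEquiv_apply_ofEuc h]
  rfl

end FinslerSpace

open FinslerSpace

variable (h : IsFinslerNorm N H)

theorem energyInf_eq_sInf_dirichletEnergies (hN : N ≠ 0)
    [MeasurableSpace (StrongDual ℝ (FinslerSpace h))] [BorelSpace (StrongDual ℝ (FinslerSpace h))]
    (Ω : Set (Euc N)) (p : ℝ) (hp : p + 1 ≠ 0) :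
    energyInf N H Ω p = sInf (dirichletEnergies (volume.map (dualEquiv h))
      ((dualEquiv h).symm ⁻¹' Ω) (p + 1)) := by
  set L := dualEquiv h
  have hsurj : Function.Surjective fun v : StrongDual ℝ (FinslerSpace h) → ℝ => v ∘ L := fun u =>
    ⟨u ∘ L.symm, by ext x; simp⟩
  have hmap : ∀ g : StrongDual ℝ (FinslerSpace h) → ℝ, ∫ y, g y ∂(volume.map L) = ∫ x, g (L x) :=
    fun g => integral_map_equiv L.toHomeomorph.toMeasurableEquiv g
  have hsupp : ∀ v : StrongDual ℝ (FinslerSpace h) → ℝ, tsupport (v ∘ L) = L ⁻¹' tsupport v :=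
    fun v => tsupport_comp_eq_preimage v L.toHomeomorph
  rw [energyInf, dirichletEnergies]
  congr 1
  ext c
  rw [mem_ofPred_eq, mem_ofPred_eq, hsurj.exists]
  refine exists_congr fun v => and_congr L.contDiff_comp_iff (and_congr ?_ ?_)
  · rw [HasCompactSupport, HasCompactSupport, hsupp]
    exact L.toHomeomorph.isCompact_preimage
  · have hsub : tsupport (v ∘ L) ⊆ Ω ↔ tsupport v ⊆ L.symm ⁻¹' Ω := by
      rw [hsupp, ← L.image_symm_eq_preimage, image_subset_iff]
    rw [← hsub]
    refine and_congr_right fun hΩ => ?_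
    rw [hmap, hmap, finrank_dual]
    simp only [L, norm_fderiv_eq]
    rw [setIntegral_eq_integral_of_forall_compl_eq_zero fun x hx => ?_,
      setIntegral_eq_integral_of_forall_compl_eq_zero fun x hx => ?_]
    · rfl
    · have hx' : x ∉ tsupport (v ∘ L) := fun hmem => hx (hΩ hmem)
      have : gradient (v ∘ L) x = 0 := by
        rw [gradient, (notMem_tsupport_iff_eventuallyEq.1 hx').fderiv_eq]
        simp
      rw [this, (h.2.2.1 0).2 rfl, zero_pow hN]
    · have hx' : x ∉ tsupport (v ∘ L) := fun hmem => hx (hΩ hmem)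
      rw [image_eq_zero_of_notMem_tsupport hx', abs_zero, Real.zero_rpow hp]

theorem wulffVol_eq_measureReal_ball (hN : N ≠ 0)
    [MeasurableSpace (StrongDual ℝ (FinslerSpace h))] [BorelSpace (StrongDual ℝ (FinslerSpace h))] :
    wulffVol N H = (volume.map (dualEquiv h)).real (Metric.ball 0 1) := by
  rw [Measure.real, Measure.map_apply (dualEquiv h).continuous.measurable measurableSet_ball]
  simp only [wulffVol, ← norm_dualEquiv h hN]
  congr 2
  ext x
  simp

end Finsler

/-- Asymptotics of the least energy level `C_p` (Proposition 3.2). -/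
theorem energyInf_limit (N : ℕ) (hN : 2 ≤ N) (H : Euc N → ℝ)
    (hnorm : IsFinslerNorm N H) (hreg : FinslerRegular N H)
    (Ω : Set (Euc N)) (hΩo : IsOpen Ω) (hΩb : Bornology.IsBounded Ω) (hΩne : Ω.Nonempty) :
    Tendsto (fun p : ℝ => p ^ (N - 1) * energyInf N H Ω p) atTop
      (𝓝 ((N * Real.exp 1 / ((N : ℝ) - 1) * betaN N H) ^ (N - 1))) := by
  have hN0 : N ≠ 0 := by omega
  have hfin := FinslerSpace.finrank_dual hnorm
  borelize (StrongDual ℝ (FinslerSpace hnorm))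
  set L := FinslerSpace.dualEquiv hnorm
  have : Nontrivial (StrongDual ℝ (FinslerSpace hnorm)) :=
    Module.nontrivial_of_finrank_pos (R := ℝ) (by omega)
  have hlim := tendsto_pow_mul_sInf_dirichletEnergies (volume.map L) (by omega)
    (Ω := L.symm ⁻¹' Ω) (hΩo.preimage L.symm.continuous)
    (by rw [← L.image_eq_preimage_symm]; exact hΩb.image L.toContinuousLinearMap)
    (hΩne.preimage L.symm.surjective)
  rw [sphereMass, ← wulffVol_eq_measureReal_ball hnorm hN0, hfin] at hlim
  have hshift : Tendsto (fun p : ℝ => p + 1) atTop atTop := tendsto_atTop_add_const_right _ _ tendsto_id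
  have hratio : Tendsto (fun p : ℝ => (p / (p + 1)) ^ (N - 1)) atTop (𝓝 1) := by
    have h1 : Tendsto (fun p : ℝ => 1 - 1 / (p + 1)) atTop (𝓝 1) := by
      simpa using (tendsto_const_nhds (x := (1 : ℝ))).sub
        ((tendsto_const_nhds (x := (1 : ℝ))).div_atTop hshift)
    refine (by simpa using h1.pow (N - 1) : Tendsto _ atTop (𝓝 (1 : ℝ))).congr' ?_
    filter_upwards [eventually_gt_atTop 0] with p hp
    congr 1
    field_simp
    ring
  have := hratio.mul (hlim.comp hshift)
  rw [one_mul] at this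
  rw [betaN]
  refine this.congr' ?_
  filter_upwards [eventually_gt_atTop 0] with p hp
  rw [energyInf_eq_sInf_dirichletEnergies hnorm hN0 Ω p (by linarith), Function.comp_apply,
    ← mul_assoc, ← mul_pow, div_mul_cancel₀ _ (by linarith)]
end
end

section
/- Let z ∈ C¹(ℝ^N) satisfy z ≤ 0 on ℝ^N, ∫_{ℝ^N} e^{z(x)} dx < ∞, and let z be a weak solution of -Q_N z = e^z in ℝ^N, i.e. ∫_{ℝ^N} H(∇z)^{N-1}(∇H)(∇z)·∇φ dx = ∫_{ℝ^N} e^z φ dx for all φ ∈ C_c^∞(ℝ^N). Then ∫_{ℝ^N} e^{z(x)} dx ≥ (N/(N-1))^{N-1} N^N κ_N. -/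
open MeasureTheory Filter Real Set
open scoped RealInnerProductSpace Topology NNReal

noncomputable section

section

open scoped ENNReal Pointwise

theorem volume_add_le_of_isCompact {A B : Set ℝ} (hA : IsCompact A) (hB : IsCompact B)
    (hA0 : A.Nonempty) (hB0 : B.Nonempty) : volume A + volume B ≤ volume (A + B) := by
  obtain ⟨a, haA, ha⟩ := hA.exists_isGreatest hA0
  obtain ⟨b, hbB, hb⟩ := hB.exists_isLeast hB0
  have hX : volume (b +ᵥ A) = volume A := measure_vadd volume b A
  have hY : volume (a +ᵥ B) = volume B := measure_vadd volume a B
  have hYm : MeasurableSet (a +ᵥ B) := (hB.vadd a).measurableSet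
  have hsub : (b +ᵥ A) ∪ (a +ᵥ B) ⊆ A + B := by
    rintro _ (⟨x, hx, rfl⟩ | ⟨x, hx, rfl⟩)
    · exact ⟨x, hx, b, hbB, by simp [add_comm]⟩
    · exact ⟨a, haA, x, hx, by simp⟩
  have hint : (b +ᵥ A) ∩ (a +ᵥ B) ⊆ {a + b} := by
    rintro _ ⟨⟨x, hx, rfl⟩, ⟨y, hy, hxy⟩⟩
    have h1 := ha hx
    have h2 := hb hy
    simp only [vadd_eq_add, mem_singleton_iff] at *
    linarith
  have h0 : volume ((b +ᵥ A) ∩ (a +ᵥ B)) = 0 :=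
    measure_mono_null hint (by simp)
  have := measure_union_add_inter (μ := volume) (b +ᵥ A) hYm
  rw [h0, add_zero, hX, hY] at this
  rw [← this]
  exact measure_mono hsub

theorem volume_add_le_real {A B C : Set ℝ} (hA : MeasurableSet A) (hB : MeasurableSet B)
    (hA0 : A.Nonempty) (hB0 : B.Nonempty) (hC : A + B ⊆ C) :
    volume A + volume B ≤ volume C := by
  rcases eq_or_ne (volume A) 0 with h | h
  · obtain ⟨a, ha⟩ := hA0
    rw [h, zero_add, ← measure_vadd volume a B]
    refine measure_mono (Subset.trans ?_ hC)
    rintro _ ⟨x, hx, rfl⟩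
    exact ⟨a, ha, x, hx, rfl⟩
  rcases eq_or_ne (volume B) 0 with h' | h'
  · obtain ⟨b, hb⟩ := hB0
    rw [h', add_zero, ← measure_vadd volume b A]
    refine measure_mono (Subset.trans ?_ hC)
    rintro _ ⟨x, hx, rfl⟩
    exact ⟨x, hx, b, hb, by simp [add_comm]⟩
  have hne : ∀ K : Set ℝ, ∀ r : ℝ≥0∞, r < volume K → K.Nonempty := by
    intro K r hr
    rw [nonempty_iff_ne_empty]
    rintro rfl
    simp at hr
  rw [hA.measure_eq_iSup_isCompact, hB.measure_eq_iSup_isCompact]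
  simp only [iSup_and']
  refine ENNReal.biSup_add_biSup_le' (p := fun K => K ⊆ A ∧ IsCompact K)
    (q := fun K => K ⊆ B ∧ IsCompact K) ⟨∅, by simp⟩ ⟨∅, by simp⟩ ?_
  rintro K ⟨hKA, hK⟩ L ⟨hLB, hL⟩
  obtain ⟨a, ha⟩ := hA0
  obtain ⟨b, hb⟩ := hB0
  calc volume K + volume L ≤ volume (insert a K) + volume (insert b L) := by
        gcongr <;> exact subset_insert _ _
    _ ≤ volume (insert a K + insert b L) :=
        volume_add_le_of_isCompact (hK.insert a) (hL.insert b) ⟨a, by simp⟩ ⟨b, by simp⟩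
    _ ≤ volume C := by
        refine measure_mono (Subset.trans ?_ hC)
        exact add_subset_add (insert_subset ha hKA) (insert_subset hb hLB)

theorem ENNReal_geom_mean_le (x y : ℝ≥0∞) {p q : ℝ} (hp : 0 < p) (hq : 0 < q) (hpq : p + q = 1) :
    x ^ p * y ^ q ≤ ENNReal.ofReal p * x + ENNReal.ofReal q * y := by
  have hconj : (p⁻¹).HolderConjugate q⁻¹ := by
    rw [Real.holderConjugate_iff]
    refine ⟨?_, by simpa using hpq⟩
    exact (one_lt_inv₀ hp).2 (by linarith)
  have := ENNReal.young_inequality (x ^ p) (y ^ q) hconj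
  rw [← ENNReal.rpow_mul, ← ENNReal.rpow_mul, mul_inv_cancel₀ hp.ne', mul_inv_cancel₀ hq.ne',
    ENNReal.rpow_one, ENNReal.rpow_one, ENNReal.ofReal_inv_of_pos hp,
    ENNReal.ofReal_inv_of_pos hq, div_eq_mul_inv, div_eq_mul_inv, inv_inv, inv_inv] at this
  rwa [mul_comm _ x, mul_comm _ y]

theorem prekopa_leindler_normalized (f g h : ℝ → ℝ) (hf : Measurable f) (hg : Measurable g)
    (hh : Measurable h) (hf0 : ∀ x, 0 ≤ f x) (hg0 : ∀ x, 0 ≤ g x) (hh0 : ∀ x, 0 ≤ h x)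
    (hf1 : ∀ x, f x ≤ 1) (hg1 : ∀ x, g x ≤ 1) (hfs : ∀ t < 1, ∃ x, t < f x)
    (hgs : ∀ t < 1, ∃ x, t < g x) {p q : ℝ} (hp : 0 < p) (hq : 0 < q)
    (hfgh : ∀ t, 0 < t → ∀ x y, t < f x → t < g y → t < h (p * x + q * y)) :
    ENNReal.ofReal p * (∫⁻ x, ENNReal.ofReal (f x)) + ENNReal.ofReal q * (∫⁻ x, ENNReal.ofReal (g x))
      ≤ ∫⁻ x, ENNReal.ofReal (h x) := by
  rw [lintegral_eq_lintegral_meas_lt volume (ae_of_all _ hf0) hf.aemeasurable,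
    lintegral_eq_lintegral_meas_lt volume (ae_of_all _ hg0) hg.aemeasurable,
    lintegral_eq_lintegral_meas_lt volume (ae_of_all _ hh0) hh.aemeasurable]
  have hanti : ∀ u : ℝ → ℝ, Measurable fun t : ℝ => volume {a : ℝ | t < u a} := fun u =>
    Antitone.measurable fun s t hst => measure_mono fun x hx => lt_of_le_of_lt hst hx
  rw [← lintegral_const_mul _ (hanti f), ← lintegral_const_mul _ (hanti g),
    ← lintegral_add_left ((hanti f).const_mul _)]
  refine setLIntegral_mono (hanti h) fun t ht => ?_
  rcases lt_or_ge t 1 with h1 | h1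
  · have hs : ∀ r : ℝ, 0 < r → ∀ A : Set ℝ, ENNReal.ofReal r * volume A = volume (r • A) := by
      intro r hr A
      rw [Measure.addHaar_smul]
      simp [abs_of_pos hr]
    rw [hs p hp, hs q hq]
    obtain ⟨x, hx⟩ := hfs t h1
    obtain ⟨y, hy⟩ := hgs t h1
    refine volume_add_le_real ((measurableSet_lt measurable_const hf).const_smul₀ p)
      ((measurableSet_lt measurable_const hg).const_smul₀ q)
      (Set.Nonempty.smul_set ⟨x, hx⟩) (Set.Nonempty.smul_set ⟨y, hy⟩) ?_
    rintro _ ⟨_, ⟨x, hx, rfl⟩, _, ⟨y, hy, rfl⟩, rfl⟩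
    exact hfgh t ht x y hx hy
  · have e1 : {a : ℝ | t < f a} = ∅ := by
      ext a; simpa using (hf1 a).trans h1
    have e2 : {a : ℝ | t < g a} = ∅ := by
      ext a; simpa using (hg1 a).trans h1
    simp [e1, e2]

theorem prekopa_leindler_bounded (f g h : ℝ → ℝ≥0∞) (hf : Measurable f) (hg : Measurable g)
    (hh : Measurable h) (hfb : ⨆ x, f x ≠ ∞) (hgb : ⨆ x, g x ≠ ∞) {p q : ℝ} (hp : 0 < p)
    (hq : 0 < q) (hpq : p + q = 1) (hfgh : ∀ x y, f x ^ p * g y ^ q ≤ h (p * x + q * y)) :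
    (∫⁻ x, f x) ^ p * (∫⁻ x, g x) ^ q ≤ ∫⁻ x, h x := by
  set a := ⨆ x, f x with ha
  set b := ⨆ x, g x with hb
  have hfa : ∀ x, f x ≤ a := le_iSup f
  have hgb' : ∀ x, g x ≤ b := le_iSup g
  rcases eq_or_ne a 0 with ha0 | ha0
  · have : ∀ x, f x = 0 := fun x => le_antisymm ((hfa x).trans ha0.le) bot_le
    simp [this, ENNReal.zero_rpow_of_pos hp]
  rcases eq_or_ne b 0 with hb0 | hb0
  · have : ∀ x, g x = 0 := fun x => le_antisymm ((hgb' x).trans hb0.le) bot_le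
    simp [this, ENNReal.zero_rpow_of_pos hq]
  set c := a ^ p * b ^ q with hc
  have hap0 : a ^ p ≠ 0 := (ENNReal.rpow_pos (pos_iff_ne_zero.2 ha0) hfb).ne'
  have hbq0 : b ^ q ≠ 0 := (ENNReal.rpow_pos (pos_iff_ne_zero.2 hb0) hgb).ne'
  have hapt : a ^ p ≠ ∞ := ENNReal.rpow_ne_top_of_nonneg hp.le hfb
  have hbqt : b ^ q ≠ ∞ := ENNReal.rpow_ne_top_of_nonneg hq.le hgb
  have hc0 : c ≠ 0 := mul_ne_zero hap0 hbq0
  have hct : c ≠ ∞ := ENNReal.mul_ne_top hapt hbqt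
  have hfle : ∀ x, a⁻¹ * f x ≤ 1 := fun x => by
    rw [mul_comm, ← div_eq_mul_inv]; exact ENNReal.div_le_of_le_mul (by simpa using hfa x)
  have hgle : ∀ x, b⁻¹ * g x ≤ 1 := fun x => by
    rw [mul_comm, ← div_eq_mul_inv]; exact ENNReal.div_le_of_le_mul (by simpa using hgb' x)
  have hhle : ∀ x, min 1 (c⁻¹ * h x) ≤ 1 := fun x => min_le_left _ _
  have key : ∀ (u : ℝ → ℝ≥0∞) (s : ℝ≥0∞), s ≠ 0 → s ≠ ∞ → s = ⨆ x, u x →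
      (∀ x, s⁻¹ * u x ≤ 1) → ∀ t < 1, ∃ x, t < (s⁻¹ * u x).toReal := by
    intro u s hs0 hst hs hle t ht
    rcases lt_or_ge t 0 with h0 | h0
    · exact ⟨0, h0.trans_le ENNReal.toReal_nonneg⟩
    have : ENNReal.ofReal t * s < s := by
      conv_rhs => rw [← one_mul s]
      exact ENNReal.mul_lt_mul_left hs0 hst (by simpa using ht)
    conv_rhs at this => rw [hs]
    obtain ⟨x, hx⟩ := lt_iSup_iff.1 this
    refine ⟨x, ?_⟩
    rw [← ENNReal.ofReal_lt_iff_lt_toReal h0 (ne_top_of_le_ne_top ENNReal.one_ne_top (hle x))]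
    rw [mul_comm s⁻¹, ← div_eq_mul_inv]
    exact (ENNReal.lt_div_iff_mul_lt (Or.inl hs0) (Or.inl hst)).2 hx
  have hmain := prekopa_leindler_normalized (fun x => (a⁻¹ * f x).toReal)
    (fun x => (b⁻¹ * g x).toReal) (fun x => (min 1 (c⁻¹ * h x)).toReal)
    (hf.const_mul _).ennreal_toReal (hg.const_mul _).ennreal_toReal
    (measurable_const.min (hh.const_mul _)).ennreal_toReal
    (fun _ => ENNReal.toReal_nonneg) (fun _ => ENNReal.toReal_nonneg)
    (fun _ => ENNReal.toReal_nonneg)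
    (fun x => ENNReal.toReal_le_of_le_ofReal zero_le_one (by simpa using hfle x))
    (fun x => ENNReal.toReal_le_of_le_ofReal zero_le_one (by simpa using hgle x))
    (key f a ha0 hfb ha hfle) (key g b hb0 hgb hb hgle) hp hq (by
      intro t ht x y hx hy
      have nt : ∀ {r : ℝ≥0∞}, r ≤ 1 → r ≠ ∞ := fun hr => ne_top_of_le_ne_top ENNReal.one_ne_top hr
      rw [← ENNReal.ofReal_lt_iff_lt_toReal ht.le (nt (hfle _))] at hx
      rw [← ENNReal.ofReal_lt_iff_lt_toReal ht.le (nt (hgle _))] at hy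
      rw [← ENNReal.ofReal_lt_iff_lt_toReal ht.le (nt (hhle _))]
      refine lt_min (hx.trans_le (hfle _)) ?_
      have e : (a⁻¹ * f x) ^ p * (b⁻¹ * g y) ^ q ≤ c⁻¹ * h (p * x + q * y) := by
        rw [ENNReal.mul_rpow_of_nonneg _ _ hp.le, ENNReal.mul_rpow_of_nonneg _ _ hq.le, hc,
          ENNReal.mul_inv (Or.inl hap0) (Or.inl hapt), ENNReal.inv_rpow, ENNReal.inv_rpow]
        calc _ = (a ^ p)⁻¹ * (b ^ q)⁻¹ * (f x ^ p * g y ^ q) := by ring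
          _ ≤ _ := by gcongr; exact hfgh x y
      refine lt_of_lt_of_le ?_ e
      have e2 : ENNReal.ofReal t = ENNReal.ofReal t ^ p * ENNReal.ofReal t ^ q := by
        rw [← ENNReal.rpow_add_of_nonneg _ _ hp.le hq.le, hpq, ENNReal.rpow_one]
      rw [e2]
      exact ENNReal.mul_lt_mul (ENNReal.rpow_lt_rpow hx hp) (ENNReal.rpow_lt_rpow hy hq))
  have nt : ∀ {r : ℝ≥0∞}, r ≤ 1 → r ≠ ∞ := fun hr => ne_top_of_le_ne_top ENNReal.one_ne_top hr
  simp only [fun x => ENNReal.ofReal_toReal (nt (hfle x)), fun x => ENNReal.ofReal_toReal (nt (hgle x)),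
    fun x => ENNReal.ofReal_toReal (nt (hhle x))] at hmain
  rw [lintegral_const_mul _ hf, lintegral_const_mul _ hg] at hmain
  have h2 := (ENNReal_geom_mean_le _ _ hp hq hpq).trans (hmain.trans
    (lintegral_mono fun x => min_le_right 1 (c⁻¹ * h x)))
  rw [lintegral_const_mul _ hh, ENNReal.mul_rpow_of_nonneg _ _ hp.le,
    ENNReal.mul_rpow_of_nonneg _ _ hq.le, ENNReal.inv_rpow, ENNReal.inv_rpow] at h2
  have h3 : c⁻¹ * ((∫⁻ x, f x) ^ p * (∫⁻ x, g x) ^ q) ≤ c⁻¹ * ∫⁻ x, h x := by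
    refine le_trans (le_of_eq ?_) h2
    rw [hc, ENNReal.mul_inv (Or.inl hap0) (Or.inl hapt)]
    ring
  exact (ENNReal.mul_le_mul_iff_right (ENNReal.inv_ne_zero.2 hct) (ENNReal.inv_ne_top.2 hc0)).1 h3

theorem prekopa_leindler_real (f g h : ℝ → ℝ≥0∞) (hf : Measurable f) (hg : Measurable g)
    (hh : Measurable h) {p q : ℝ} (hp : 0 < p)
    (hq : 0 < q) (hpq : p + q = 1) (hfgh : ∀ x y, f x ^ p * g y ^ q ≤ h (p * x + q * y)) :
    (∫⁻ x, f x) ^ p * (∫⁻ x, g x) ^ q ≤ ∫⁻ x, h x := by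
  have hlim : ∀ u : ℝ → ℝ≥0∞, Measurable u →
      Tendsto (fun n : ℕ => ∫⁻ x, min (u x) n) atTop (𝓝 (∫⁻ x, u x)) := by
    intro u hu
    refine lintegral_tendsto_of_tendsto_of_monotone (fun n => (hu.min measurable_const).aemeasurable)
      (ae_of_all _ fun x m n hmn => ?_) (ae_of_all _ fun x => ?_)
    · exact min_le_min le_rfl (by exact_mod_cast hmn)
    · have := (tendsto_const_nhds (x := u x)).min ENNReal.tendsto_nat_nhds_top
      simpa using this
  have hb : ∀ (u : ℝ → ℝ≥0∞) (n : ℕ), ⨆ x, min (u x) (n : ℝ≥0∞) ≠ ∞ := fun u n =>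
    ne_top_of_le_ne_top (ENNReal.natCast_ne_top n) (iSup_le fun x => min_le_right _ _)
  have hn : ∀ n : ℕ, (∫⁻ x, min (f x) n) ^ p * (∫⁻ x, min (g x) n) ^ q ≤ ∫⁻ x, h x := fun n =>
    prekopa_leindler_bounded _ _ h (hf.min measurable_const) (hg.min measurable_const) hh
      (hb f n) (hb g n) hp hq hpq fun x y => le_trans (by gcongr <;> exact min_le_left _ _) (hfgh x y)
  have hmono : ∀ u : ℝ → ℝ≥0∞, Monotone fun n : ℕ => ∫⁻ x, min (u x) n := fun u m n hmn =>
    lintegral_mono fun x => min_le_min le_rfl (by exact_mod_cast hmn)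
  rw [tendsto_nhds_unique (hlim f hf) (tendsto_atTop_iSup (hmono f)),
    tendsto_nhds_unique (hlim g hg) (tendsto_atTop_iSup (hmono g))]
  have hor : ∀ (r : ℝ), 0 < r → ∀ u : ℕ → ℝ≥0∞, (⨆ n, u n) ^ r = ⨆ n, u n ^ r := fun r hr u =>
    (ENNReal.orderIsoRpow r hr).map_iSup u
  rw [hor p hp, hor q hq, ENNReal.iSup_mul]
  refine iSup_le fun m => ?_
  rw [ENNReal.mul_iSup]
  refine iSup_le fun n => le_trans ?_ (hn (max m n))
  gcongr
  · exact le_max_left m n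
  · exact le_max_right m n

theorem prekopa_leindler {n : ℕ} (f g h : (Fin n → ℝ) → ℝ≥0∞) (hf : Measurable f)
    (hg : Measurable g) (hh : Measurable h) {p q : ℝ} (hp : 0 < p)
    (hq : 0 < q) (hpq : p + q = 1) (hfgh : ∀ x y, f x ^ p * g y ^ q ≤ h (p • x + q • y)) :
    (∫⁻ x, f x) ^ p * (∫⁻ x, g x) ^ q ≤ ∫⁻ x, h x := by
  induction n with
  | zero =>
    have : ∀ u : (Fin 0 → ℝ) → ℝ≥0∞, ∫⁻ x, u x = u 0 := fun u => by
      rw [show u = fun _ => u 0 from funext fun x => congrArg u (Subsingleton.elim _ _)]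
      simp [volume_pi]
    simp only [this]
    simpa using hfgh 0 0
  | succ n ih =>
    have hmp := (volume_preserving_piFinSuccAbove (fun _ : Fin (n + 1) => ℝ) 0).symm
    set e := (MeasurableEquiv.piFinSuccAbove (fun _ : Fin (n + 1) => ℝ) 0).symm with he
    have hfub : ∀ u : (Fin (n + 1) → ℝ) → ℝ≥0∞, Measurable u →
        ∫⁻ x, u x = ∫⁻ t : ℝ, ∫⁻ x : Fin n → ℝ, u (e (t, x)) := by
      intro u hu
      rw [← hmp.lintegral_comp hu, Measure.volume_eq_prod, lintegral_prod]
      exact (hu.comp e.measurable).aemeasurable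
    have hms : ∀ u : (Fin (n + 1) → ℝ) → ℝ≥0∞, Measurable u →
        Measurable fun t : ℝ => ∫⁻ x : Fin n → ℝ, u (e (t, x)) := fun u hu =>
      (hu.comp e.measurable).lintegral_prod_right'
    rw [hfub f hf, hfub g hg, hfub h hh]
    refine prekopa_leindler_real _ _ _ (hms f hf) (hms g hg) (hms h hh) hp hq hpq fun s t => ?_
    refine ih _ _ _ (hf.comp (e.measurable.comp measurable_prodMk_left))
      (hg.comp (e.measurable.comp measurable_prodMk_left))
      (hh.comp (e.measurable.comp measurable_prodMk_left)) fun x y => ?_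
    convert hfgh (e (s, x)) (e (t, y)) using 2
    ext i
    refine Fin.cases ?_ (fun j => ?_) i <;>
      simp [he, MeasurableEquiv.piFinSuccAbove_symm_apply]

theorem prekopa_leindler_euc {n : ℕ} (f g h : Euc n → ℝ≥0∞) (hf : Measurable f)
    (hg : Measurable g) (hh : Measurable h) {p q : ℝ} (hp : 0 < p)
    (hq : 0 < q) (hpq : p + q = 1) (hfgh : ∀ x y, f x ^ p * g y ^ q ≤ h (p • x + q • y)) :
    (∫⁻ x, f x) ^ p * (∫⁻ x, g x) ^ q ≤ ∫⁻ x, h x := by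
  have hmp := PiLp.volume_preserving_toLp (Fin n)
  rw [← hmp.lintegral_comp hf, ← hmp.lintegral_comp hg, ← hmp.lintegral_comp hh]
  exact prekopa_leindler _ _ _ (hf.comp hmp.measurable) (hg.comp hmp.measurable)
    (hh.comp hmp.measurable) hp hq hpq fun x y => hfgh _ _

theorem brunn_minkowski {n : ℕ} {A B C : Set (Euc n)} (hA : MeasurableSet A)
    (hB : MeasurableSet B) (hC : MeasurableSet C) (hABC : A + B ⊆ C) {a b : ℝ} (ha : 0 < a)
    (hb : 0 < b) (hvA : volume A = ENNReal.ofReal (a ^ n)) (hvB : volume B = ENNReal.ofReal (b ^ n)) :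
    ENNReal.ofReal ((a + b) ^ n) ≤ volume C := by
  have hab : 0 < a + b := add_pos ha hb
  have hvol : ∀ (D : Set (Euc n)) (r : ℝ), 0 < r →
      volume (r⁻¹ • D) = ENNReal.ofReal ((r ^ n)⁻¹) * volume D := by
    intro D r hr
    rw [Measure.addHaar_smul]
    congr 2
    rw [finrank_euclideanSpace_fin, abs_of_pos (by positivity), inv_pow]
  have hmA : MeasurableSet (a⁻¹ • A) := hA.const_smul₀ _
  have hmB : MeasurableSet (b⁻¹ • B) := hB.const_smul₀ _
  have hmC : MeasurableSet ((a + b)⁻¹ • C) := hC.const_smul₀ _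
  have hp : 0 < a / (a + b) := by positivity
  have hq : 0 < b / (a + b) := by positivity
  have h := prekopa_leindler_euc ((a⁻¹ • A).indicator 1) ((b⁻¹ • B).indicator 1)
    (((a + b)⁻¹ • C).indicator 1) (measurable_one.indicator hmA) (measurable_one.indicator hmB)
    (measurable_one.indicator hmC) hp hq (by field_simp) (by
      intro x y
      by_cases hx : x ∈ a⁻¹ • A
      swap
      · simp [hx, ENNReal.zero_rpow_of_pos hp]
      by_cases hy : y ∈ b⁻¹ • B
      swap
      · simp [hy, ENNReal.zero_rpow_of_pos hq]
      obtain ⟨x, hx', rfl⟩ := hx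
      obtain ⟨y, hy', rfl⟩ := hy
      have : (a / (a + b)) • a⁻¹ • x + (b / (a + b)) • b⁻¹ • y ∈ (a + b)⁻¹ • C := by
        refine ⟨x + y, hABC ⟨x, hx', y, hy', rfl⟩, ?_⟩
        simp only [smul_smul, smul_add]
        congr 2 <;> field_simp
      rw [indicator_of_mem this]
      calc _ ≤ (1 : ℝ≥0∞) ^ (a / (a + b)) * 1 ^ (b / (a + b)) := by
            gcongr <;> exact indicator_le_self' (by simp) _
        _ = _ := by simp)
  rw [lintegral_indicator_one hmA, lintegral_indicator_one hmB, lintegral_indicator_one hmC,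
    hvol A a ha, hvol B b hb, hvol C _ hab, hvA, hvB, ← ENNReal.ofReal_mul (by positivity),
    ← ENNReal.ofReal_mul (by positivity), inv_mul_cancel₀ (by positivity),
    inv_mul_cancel₀ (by positivity), ENNReal.ofReal_one, ENNReal.one_rpow, ENNReal.one_rpow,
    one_mul] at h
  calc ENNReal.ofReal ((a + b) ^ n) = ENNReal.ofReal ((a + b) ^ n) * 1 := by simp
    _ ≤ ENNReal.ofReal ((a + b) ^ n) * (ENNReal.ofReal (((a + b) ^ n)⁻¹) * volume C) := by gcongr
    _ = volume C := by
      rw [← mul_assoc, ← ENNReal.ofReal_mul (by positivity), mul_inv_cancel₀ (by positivity)]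
      simp

theorem pow_add_mul_pow_le_add_pow {a b : ℝ} (ha : 0 ≤ a) (hb : 0 ≤ b) (n : ℕ) :
    a ^ n + n * b * a ^ (n - 1) ≤ (a + b) ^ n := by
  induction n with
  | zero => simp
  | succ n ih =>
    rw [pow_succ (a + b)]
    calc a ^ (n + 1) + (n + 1 : ℕ) * b * a ^ (n + 1 - 1)
        ≤ (a ^ n + n * b * a ^ (n - 1)) * (a + b) := by
          rcases n with _ | n
          · simp
          · have : 0 ≤ ((n + 1 : ℕ) : ℝ) * b * a ^ n * b := by positivity
            simp only [Nat.add_sub_cancel] at *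
            push_cast at *
            ring_nf at *
            linarith
      _ ≤ _ := by gcongr

theorem sub_le_of_mem_of_fderiv_close {N : ℕ} {H : Euc N → ℝ} (hH0 : ∀ ξ, 0 ≤ H ξ)
    {K : Set (Euc N)} {R : ℝ} (hR : 0 < R) (hKR : ∀ y ∈ K, ‖y‖ ≤ R)
    (hK : ∀ y ∈ K, ∀ ξ, |⟪ξ, y⟫| ≤ H ξ) {u : Euc N → ℝ} (hu : ContDiff ℝ 1 u)
    (hu0 : ∀ x, 0 ≤ u x) {δ ε : ℝ} (hδ : 0 < δ) (hε : 0 < ε) (hε1 : ε ≤ 1)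
    (hclose : ∀ x x', dist x x' ≤ ε * R → ‖fderiv ℝ u x' - fderiv ℝ u x‖ ≤ δ / R)
    (x y : Euc N) (hy : y ∈ K) :
    u (x - ε • y) ≤ u x + ε * (H (gradient u x) +
      (Metric.cthickening R (tsupport u)).indicator (fun _ => δ) x) := by
  have hεR : ‖ε • y‖ ≤ ε * R := by
    rw [norm_smul, Real.norm_of_nonneg hε.le]
    exact mul_le_mul_of_nonneg_left (hKR y hy) hε.le
  by_cases hx : x ∈ Metric.cthickening R (tsupport u)
  swap
  · have : u (x - ε • y) = 0 := by
      by_contra h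
      refine hx (Metric.mem_cthickening_of_dist_le x (x - ε • y) R _ (subset_tsupport u h) ?_)
      rw [dist_eq_norm, sub_sub_cancel]
      exact hεR.trans (by nlinarith)
    rw [this, indicator_of_notMem hx, add_zero]
    exact add_nonneg (hu0 x) (mul_nonneg hε.le (hH0 _))
  · rw [indicator_of_mem hx]
    have hmv := (convex_closedBall x (ε * R)).norm_image_sub_le_of_norm_fderiv_le' (𝕜 := ℝ) (f := u)
      (x := x) (y := x - ε • y) (φ := fderiv ℝ u x) (C := δ / R)
      (fun z _ => (hu.differentiable one_ne_zero) z)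
      (fun z hz => hclose x z (by rw [dist_comm]; exact hz))
      (Metric.mem_closedBall_self (by positivity)) (by
        rw [Metric.mem_closedBall, dist_eq_norm, sub_sub_cancel_left, norm_neg]; exact hεR)
    rw [sub_sub_cancel_left, norm_neg, Real.norm_eq_abs] at hmv
    have h1 := (abs_le.1 hmv).2
    have h2 : fderiv ℝ u x (-(ε • y)) = -(ε * ⟪gradient u x, y⟫) := by
      rw [map_neg, map_smul, smul_eq_mul, inner_gradient_left]
    have h3 := neg_le_of_abs_le (hK y hy (gradient u x))
    have h4 : δ / R * ‖ε • y‖ ≤ ε * δ := by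
      calc δ / R * ‖ε • y‖ ≤ δ / R * (ε * R) := by gcongr
        _ = ε * δ := by field_simp
    rw [h2] at h1
    nlinarith

theorem continuous_gradient_of_contDiff {N : ℕ} {u : Euc N → ℝ} (hu : ContDiff ℝ 1 u) :
    Continuous (gradient u) :=
  (InnerProductSpace.toDual ℝ (Euc N)).symm.continuous.comp (hu.continuous_fderiv one_ne_zero)

theorem hasCompactSupport_gradient {N : ℕ} {u : Euc N → ℝ} (hu : HasCompactSupport u) :
    HasCompactSupport (gradient u) :=
  (hu.fderiv ℝ).comp_left (map_zero _)

theorem isoperimetric_contDiff {N : ℕ} (hN : 2 ≤ N) {H : Euc N → ℝ} (hHc : Continuous H)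
    (hH0 : ∀ ξ, 0 ≤ H ξ) (hHz : H 0 = 0)
    {K : Set (Euc N)} (hKc : IsCompact K) (hK : ∀ y ∈ K, ∀ ξ, |⟪ξ, y⟫| ≤ H ξ)
    {u : Euc N → ℝ} (hu : ContDiff ℝ 1 u) (huc : HasCompactSupport u) (hu0 : ∀ x, 0 ≤ u x)
    {k a L : ℝ} (hk : 0 < k) (hkv : volume K = ENNReal.ofReal (k ^ N)) (ha : 0 < a)
    (hav : ENNReal.ofReal (a ^ N) ≤ volume {x | L ≤ u x}) (hL : 0 < L) :
    L * (N * k * a ^ (N - 1)) ≤ ∫ x, H (gradient u x) := by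
  have hN0 : N ≠ 0 := by omega
  have hHgc : Continuous fun x => H (gradient u x) :=
    hHc.comp (continuous_gradient_of_contDiff hu)
  have hHgi : Integrable fun x => H (gradient u x) :=
    hHgc.integrable_of_hasCompactSupport ((hasCompactSupport_gradient huc).comp_left hHz)
  have hui : Integrable u := hu.continuous.integrable_of_hasCompactSupport huc
  obtain ⟨R, hR, hKR⟩ : ∃ R : ℝ, 0 < R ∧ ∀ y ∈ K, ‖y‖ ≤ R := by
    obtain ⟨R, hR⟩ := hKc.isBounded.exists_norm_le
    exact ⟨max R 1, by positivity, fun y hy => (hR y hy).trans (le_max_left _ _)⟩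
  set S := Metric.cthickening R (tsupport u) with hS
  have hSc : IsCompact S := huc.isCompact.cthickening
  have hSm : MeasurableSet S := hSc.measurableSet
  have main : ∀ δ > 0, L * (N * k * a ^ (N - 1)) ≤
      (∫ x, H (gradient u x)) + δ * volume.real S := by
    intro δ hδ
    have hucont : UniformContinuous (fderiv ℝ u) :=
      (hu.continuous_fderiv one_ne_zero).uniformContinuous_of_tendsto_cocompact
        (x := 0) (huc.fderiv ℝ).is_zero_at_infty
    obtain ⟨η, hη, hclose⟩ := Metric.uniformContinuous_iff.1 hucont (δ / R) (by positivity)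
    set ε := min 1 (η / (2 * R)) with hε
    have hε0 : 0 < ε := by positivity
    have hεη : ε * R < η := by
      calc ε * R ≤ η / (2 * R) * R := by gcongr; exact min_le_right _ _
        _ = η / 2 := by field_simp
        _ < η := by linarith
    have hsub := sub_le_of_mem_of_fderiv_close hH0 hR hKR hK hu hu0 hδ hε0 (min_le_left _ _)
      (fun x x' h => by
        rw [← dist_eq_norm, dist_comm]
        exact (hclose (h.trans_lt hεη)).le)
    set g : Euc N → ℝ := fun x => u x + ε * (H (gradient u x) + S.indicator (fun _ => δ) x) with hg
    have hgm : Measurable g := by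
      refine hu.continuous.measurable.add (Measurable.const_mul (hHgc.measurable.add ?_) _)
      exact measurable_const.indicator hSm
    have hg0 : ∀ x, 0 ≤ g x := fun x =>
      add_nonneg (hu0 x) (mul_nonneg hε0.le (add_nonneg (hH0 _)
        (indicator_nonneg (fun _ _ => hδ.le) _)))
    have hgi : Integrable g := by
      refine hui.add (Integrable.const_mul (hHgi.add ?_) _)
      exact (integrable_indicator_iff hSm).2 (integrableOn_const hSc.measure_lt_top.ne)
    have hgint : ∫ x, g x = (∫ x, u x) + ε * ((∫ x, H (gradient u x)) + δ * volume.real S) := by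
      have hi : Integrable (S.indicator fun _ : Euc N => δ) :=
        (integrable_indicator_iff hSm).2 (integrableOn_const hSc.measure_lt_top.ne)
      have hsum : Integrable fun x => H (gradient u x) + S.indicator (fun _ => δ) x := hHgi.add hi
      simp only [hg]
      rw [integral_add hui (hsum.const_mul _), integral_const_mul,
        integral_add hHgi hi, integral_indicator_const _ hSm, smul_eq_mul, mul_comm δ]
    set c := N * (ε * k) * a ^ (N - 1) with hc
    have hc0 : 0 ≤ c := by positivity
    have hlevel : ∀ t, 0 < t → volume {x | t < u x} +
        (Ioo 0 L).indicator (fun _ => ENNReal.ofReal c) t ≤ volume {x | t < g x} := by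
      intro t ht
      by_cases htL : t ∈ Ioo 0 L
      swap
      · rw [indicator_of_notMem htL, add_zero]
        refine measure_mono fun x (hx : t < u x) => show t < g x from lt_of_lt_of_le hx ?_
        exact le_add_of_nonneg_right (mul_nonneg hε0.le (add_nonneg (hH0 _)
          (indicator_nonneg (fun _ _ => hδ.le) _)))
      rw [indicator_of_mem htL]
      have hfin : volume {x | t < u x} ≠ ∞ := by
        refine ((measure_mono fun x hx => subset_tsupport u ?_).trans_lt
          huc.isCompact.measure_lt_top).ne
        exact (ht.trans hx).ne'
      set α := (volume.real {x | t < u x}) ^ ((N : ℝ)⁻¹) with hα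
      have hαN : α ^ N = volume.real {x | t < u x} :=
        Real.rpow_inv_natCast_pow measureReal_nonneg hN0
      have hα0 : 0 ≤ α := Real.rpow_nonneg measureReal_nonneg _
      have hvol : volume {x | t < u x} = ENNReal.ofReal (α ^ N) := by
        rw [hαN]; exact (ofReal_measureReal hfin).symm
      have haα : a ≤ α := by
        have h1 : ENNReal.ofReal (a ^ N) ≤ ENNReal.ofReal (α ^ N) := by
          rw [← hvol]
          exact hav.trans (measure_mono fun x hx => htL.2.trans_le hx)
        rw [ENNReal.ofReal_le_ofReal_iff (by positivity)] at h1
        exact (pow_le_pow_iff_left₀ ha.le hα0 hN0).1 h1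
      have hbm := brunn_minkowski (A := {x | t < u x}) (B := ε • K) (C := {x | t < g x})
        (measurableSet_lt measurable_const hu.continuous.measurable)
        (hKc.measurableSet.const_smul₀ ε) (measurableSet_lt measurable_const hgm)
        (by
          rintro _ ⟨x, hx, _, ⟨y, hy, rfl⟩, rfl⟩
          have := hsub (x + ε • y) y hy
          rw [add_sub_cancel_right] at this
          exact lt_of_lt_of_le hx this) (ha.trans_le haα) (mul_pos hε0 hk) hvol (by
          rw [Measure.addHaar_smul, finrank_euclideanSpace_fin, hkv, mul_pow,
            ← ENNReal.ofReal_mul (by positivity), abs_of_pos (by positivity)])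
      refine le_trans ?_ hbm
      rw [hvol, ← ENNReal.ofReal_add (by positivity) hc0]
      refine ENNReal.ofReal_le_ofReal (le_trans ?_
        (pow_add_mul_pow_le_add_pow hα0 (mul_pos hε0 hk).le N))
      rw [hc]
      gcongr
    have hlc : ENNReal.ofReal (∫ x, u x) + ENNReal.ofReal (c * L) ≤ ENNReal.ofReal (∫ x, g x) := by
      rw [ofReal_integral_eq_lintegral_ofReal hui (ae_of_all _ hu0),
        ofReal_integral_eq_lintegral_ofReal hgi (ae_of_all _ hg0),
        lintegral_eq_lintegral_meas_lt volume (ae_of_all _ hu0) hu.continuous.measurable.aemeasurable,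
        lintegral_eq_lintegral_meas_lt volume (ae_of_all _ hg0) hgm.aemeasurable]
      have hanti : ∀ w : Euc N → ℝ, Measurable fun t : ℝ => volume {a | t < w a} := fun w =>
        Antitone.measurable fun s t hst => measure_mono fun x hx => lt_of_le_of_lt hst hx
      refine le_trans (le_of_eq ?_) (setLIntegral_mono (hanti g) fun t ht => hlevel t ht)
      rw [lintegral_add_left (hanti u)]
      congr 1
      rw [lintegral_indicator_const measurableSet_Ioo, Measure.restrict_apply measurableSet_Ioo,
        inter_eq_left.2 Ioo_subset_Ioi_self, Real.volume_Ioo, sub_zero, ← ENNReal.ofReal_mul hc0]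
    rw [← ENNReal.ofReal_add (integral_nonneg hu0) (by positivity),
      ENNReal.ofReal_le_ofReal_iff (integral_nonneg hg0), hgint] at hlc
    have h5 : ε * (L * (N * k * a ^ (N - 1))) ≤
        ε * ((∫ x, H (gradient u x)) + δ * volume.real S) := by
      rw [hc] at hlc
      linarith
    exact le_of_mul_le_mul_left h5 hε0
  refine le_of_forall_pos_le_add fun θ hθ => ?_
  refine (main (θ / (volume.real S + 1)) (div_pos hθ (by positivity))).trans ?_
  gcongr
  rw [div_mul_eq_mul_div, div_le_iff₀ (by positivity)]
  nlinarith [measureReal_nonneg (μ := volume) (s := S)]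

namespace IsFinslerNorm

variable {N : ℕ} {H : Euc N → ℝ}

theorem nonneg (h : IsFinslerNorm N H) (ξ : Euc N) : 0 ≤ H ξ := h.2.1 ξ

theorem map_zero (h : IsFinslerNorm N H) : H 0 = 0 := (h.2.2.1 0).2 rfl

theorem map_smul (h : IsFinslerNorm N H) (t : ℝ) (ξ : Euc N) : H (t • ξ) = |t| * H ξ :=
  h.2.2.2 t ξ

theorem map_neg (h : IsFinslerNorm N H) (ξ : Euc N) : H (-ξ) = H ξ := by
  simpa using h.map_smul (-1) ξ

theorem continuous (h : IsFinslerNorm N H) : Continuous H :=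
  h.1.locallyLipschitz.continuous

theorem add_le (h : IsFinslerNorm N H) (ξ η : Euc N) : H (ξ + η) ≤ H ξ + H η := by
  have h1 := h.1.2 (mem_univ ((2 : ℝ) • ξ)) (mem_univ ((2 : ℝ) • η))
    (show (0 : ℝ) ≤ 1 / 2 by norm_num) (show (0 : ℝ) ≤ 1 / 2 by norm_num) (by norm_num)
  rw [h.map_smul, h.map_smul, smul_smul, smul_smul] at h1
  norm_num at h1
  linarith

theorem exists_le_mul_norm (h : IsFinslerNorm N H) : ∃ C : ℝ, 0 < C ∧ ∀ ξ, H ξ ≤ C * ‖ξ‖ := by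
  obtain ⟨C, hC⟩ := (isCompact_sphere (0 : Euc N) 1).exists_bound_of_continuousOn
    h.continuous.continuousOn
  refine ⟨max C 1, by positivity, fun ξ => ?_⟩
  rcases eq_or_ne ξ 0 with rfl | hξ
  · simp [h.map_zero]
  have hn : 0 < ‖ξ‖ := norm_pos_iff.2 hξ
  have h1 := hC (‖ξ‖⁻¹ • ξ) (by simp [norm_smul, hn.ne'])
  rw [Real.norm_of_nonneg (h.nonneg _), h.map_smul, abs_of_pos (inv_pos.2 hn),
    inv_mul_le_iff₀ hn, mul_comm] at h1
  exact h1.trans (by gcongr; exact le_max_left _ _)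

theorem exists_mul_norm_le (h : IsFinslerNorm N H) : ∃ c : ℝ, 0 < c ∧ ∀ ξ, c * ‖ξ‖ ≤ H ξ := by
  have hpos : ∀ ξ ∈ Metric.sphere (0 : Euc N) 1, 0 < H ξ := fun ξ hξ =>
    lt_of_le_of_ne (h.nonneg ξ) fun h0 => by
      have := (h.2.2.1 ξ).1 h0.symm
      simp [this] at hξ
  obtain ⟨c, hc, hcH⟩ := (isCompact_sphere (0 : Euc N) 1).exists_forall_le'
    h.continuous.continuousOn hpos
  refine ⟨c, hc, fun ξ => ?_⟩
  rcases eq_or_ne ξ 0 with rfl | hξ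
  · simp [h.map_zero]
  have hn : 0 < ‖ξ‖ := norm_pos_iff.2 hξ
  have h1 := hcH (‖ξ‖⁻¹ • ξ) (by simp [norm_smul, hn.ne'])
  rw [h.map_smul, abs_of_pos (inv_pos.2 hn), le_inv_mul_iff₀ hn, mul_comm] at h1
  exact h1

theorem norm_gradient_le (h : IsFinslerNorm N H) {C : ℝ} (hC : 0 < C)
    (hHC : ∀ ξ, H ξ ≤ C * ‖ξ‖) (ξ : Euc N) : ‖gradient H ξ‖ ≤ C := by
  have : ‖gradient H ξ‖ = ‖fderiv ℝ H ξ‖ := LinearIsometryEquiv.norm_map _ _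
  rw [this]
  refine norm_fderiv_le_of_lip' ℝ hC.le (Eventually.of_forall fun x => ?_)
  rw [Real.norm_eq_abs, abs_le]
  have h1 := h.add_le (x - ξ) ξ
  have h2 := h.add_le (ξ - x) x
  have h3 := hHC (x - ξ)
  have h4 := hHC (ξ - x)
  rw [sub_add_cancel] at h1 h2
  rw [norm_sub_rev] at h4
  constructor <;> linarith

theorem inner_gradient_self (h : IsFinslerNorm N H) {ξ : Euc N} (hd : DifferentiableAt ℝ H ξ) :
    ⟪gradient H ξ, ξ⟫ = H ξ := by
  rw [inner_gradient_left]
  have hl : HasDerivAt (fun t : ℝ => t • ξ) ξ 1 := by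
    simpa using (hasDerivAt_id (1 : ℝ)).smul_const ξ
  have h1 : HasDerivAt (fun t : ℝ => H (t • ξ)) (fderiv ℝ H ξ ξ) 1 := by
    have hd' : HasFDerivAt H (fderiv ℝ H ξ) ((1 : ℝ) • ξ) := by simpa using hd.hasFDerivAt
    exact hd'.comp_hasDerivAt 1 hl
  have h2 : HasDerivAt (fun t : ℝ => t * H ξ) (H ξ) 1 := by
    simpa using (hasDerivAt_id (1 : ℝ)).mul_const (H ξ)
  refine h1.unique (h2.congr_of_eventuallyEq ?_)
  filter_upwards [lt_mem_nhds (zero_lt_one (α := ℝ))] with t ht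
  rw [h.map_smul, abs_of_pos ht]

end IsFinslerNorm

/-- The closed Wulff ball, described by its supporting half-spaces. -/
def closedWulff {N : ℕ} (H : Euc N → ℝ) : Set (Euc N) := {y | ∀ ξ, |⟪ξ, y⟫| ≤ H ξ}

theorem isCompact_closedWulff {N : ℕ} {H : Euc N → ℝ} (h : IsFinslerNorm N H) :
    IsCompact (closedWulff H) := by
  refine Metric.isCompact_of_isClosed_isBounded ?_ ?_
  · simp only [closedWulff, Set.ofPred_forall]
    exact isClosed_iInter fun ξ => isClosed_le (by fun_prop) continuous_const
  · obtain ⟨C, hC, hHC⟩ := h.exists_le_mul_norm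
    refine (Metric.isBounded_closedBall (x := (0 : Euc N)) (r := C)).subset fun y hy => ?_
    rw [mem_closedBall_zero_iff]
    rcases eq_or_ne y 0 with rfl | hy0
    · simpa using hC.le
    have h1 := (hy y).trans (hHC y)
    rw [real_inner_self_eq_norm_sq, abs_of_nonneg (by positivity), sq] at h1
    exact le_of_mul_le_mul_right h1 (norm_pos_iff.2 hy0)

theorem wulffVol_le {N : ℕ} {H : Euc N → ℝ} (h : IsFinslerNorm N H) :
    wulffVol N H ≤ (volume (closedWulff H)).toReal := by
  refine ENNReal.toReal_mono (isCompact_closedWulff h).measure_lt_top.ne (measure_mono ?_)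
  intro x hx
  obtain ⟨c, hc, hcH⟩ := h.exists_mul_norm_le
  have hbdd : BddAbove {r : ℝ | ∃ ξ : Euc N, ξ ≠ 0 ∧ r = ⟪x, ξ⟫ / H ξ} := by
    refine ⟨‖x‖ / c, ?_⟩
    rintro _ ⟨ξ, hξ, rfl⟩
    have hn : 0 < ‖ξ‖ := norm_pos_iff.2 hξ
    have hH : 0 < H ξ := lt_of_lt_of_le (by positivity) (hcH ξ)
    rw [div_le_div_iff₀ hH hc]
    calc ⟪x, ξ⟫ * c ≤ ‖x‖ * ‖ξ‖ * c := by gcongr; exact real_inner_le_norm x ξ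
      _ = ‖x‖ * (c * ‖ξ‖) := by ring
      _ ≤ _ := by gcongr; exact hcH ξ
  have key : ∀ ξ : Euc N, ⟪x, ξ⟫ ≤ H ξ := by
    intro ξ
    rcases eq_or_ne ξ 0 with rfl | hξ
    · simp [h.map_zero]
    have hn : 0 < ‖ξ‖ := norm_pos_iff.2 hξ
    have hH : 0 < H ξ := lt_of_lt_of_le (by positivity) (hcH ξ)
    have h1 : ⟪x, ξ⟫ / H ξ ≤ dualNorm H x := le_csSup hbdd ⟨ξ, hξ, rfl⟩
    have h2 : dualNorm H x < 1 := hx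
    exact ((div_lt_one hH).1 (h1.trans_lt h2)).le
  intro ξ
  rw [real_inner_comm, abs_le]
  refine ⟨?_, key ξ⟩
  have := key (-ξ)
  rw [inner_neg_right, h.map_neg] at this
  linarith

open scoped Convolution in
theorem exists_contDiff_approx {N : ℕ} {φ : Euc N → ℝ} (hφ : ContDiff ℝ 1 φ)
    (hφc : HasCompactSupport φ) {δ : ℝ} (hδ : 0 < δ) :
    ∃ ψ : Euc N → ℝ, ContDiff ℝ (⊤ : ℕ∞) ψ ∧ HasCompactSupport ψ ∧
      (∀ x, |ψ x - φ x| ≤ (Metric.cthickening 1 (tsupport φ)).indicator (fun _ => δ) x) ∧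
      ∀ x, ‖gradient ψ x - gradient φ x‖ ≤
        (Metric.cthickening 1 (tsupport φ)).indicator (fun _ => δ) x := by
  have hu1 : UniformContinuous φ :=
    hφ.continuous.uniformContinuous_of_tendsto_cocompact (x := 0) hφc.is_zero_at_infty
  have hu2 : UniformContinuous (fderiv ℝ φ) :=
    (hφ.continuous_fderiv one_ne_zero).uniformContinuous_of_tendsto_cocompact
      (x := 0) (hφc.fderiv ℝ).is_zero_at_infty
  obtain ⟨η₁, hη₁, h1⟩ := Metric.uniformContinuous_iff.1 hu1 δ hδ
  obtain ⟨η₂, hη₂, h2⟩ := Metric.uniformContinuous_iff.1 hu2 δ hδ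
  set r := min 1 (min η₁ η₂) with hr
  have hr0 : 0 < r := by positivity
  let b : ContDiffBump (0 : Euc N) := ⟨r / 2, r, by positivity, by linarith⟩
  have hzero : ∀ x, x ∉ Metric.cthickening 1 (tsupport φ) → ∀ y ∈ Metric.ball x r,
      y ∉ tsupport φ := by
    intro x hx y hy hyt
    refine hx (Metric.mem_cthickening_of_dist_le x y 1 _ hyt ?_)
    rw [dist_comm]
    exact (Metric.mem_ball.1 hy).le.trans (min_le_left _ _)
  refine ⟨b.normed volume ⋆[ContinuousLinearMap.lsmul ℝ ℝ, volume] φ,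
    b.hasCompactSupport_normed.contDiff_convolution_left _ b.contDiff_normed
      hφ.continuous.locallyIntegrable, b.hasCompactSupport_normed.convolution _ hφc, ?_, ?_⟩
  · intro x
    rw [← Real.dist_eq]
    refine b.dist_normed_convolution_le hφ.continuous.aestronglyMeasurable fun y hy => ?_
    by_cases hx : x ∈ Metric.cthickening 1 (tsupport φ)
    · rw [indicator_of_mem hx]
      exact (h1 ((Metric.mem_ball.1 hy).trans_le ((min_le_right _ _).trans (min_le_left _ _)))).le
    · rw [indicator_of_notMem hx, image_eq_zero_of_notMem_tsupport (hzero x hx y hy),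
        image_eq_zero_of_notMem_tsupport (hzero x hx x (Metric.mem_ball_self hr0)), dist_self]
  · intro x
    have hfd := (hφc.hasFDerivAt_convolution_right (ContinuousLinearMap.lsmul ℝ ℝ)
      (μ := volume) (b.continuous_normed (μ := volume)).locallyIntegrable hφ x).fderiv
    have heq : (b.normed volume ⋆[(ContinuousLinearMap.lsmul ℝ ℝ).precompR (Euc N), volume]
        fderiv ℝ φ) x =
        (b.normed volume ⋆[ContinuousLinearMap.lsmul ℝ ℝ, volume] fderiv ℝ φ) x := by
      refine integral_congr_ae (ae_of_all _ fun t => ?_)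
      ext v
      simp
    rw [heq] at hfd
    have hn : ∀ f g : Euc N → ℝ, ‖gradient f x - gradient g x‖ =
        dist (fderiv ℝ f x) (fderiv ℝ g x) := by
      intro f g
      rw [← dist_eq_norm]
      exact LinearIsometryEquiv.dist_map _ _ _
    rw [hn, hfd]
    refine b.dist_normed_convolution_le
      (hφ.continuous_fderiv one_ne_zero).aestronglyMeasurable fun y hy => ?_
    have hz : ∀ y, y ∉ tsupport φ → fderiv ℝ φ y = 0 := fun y hy =>
      image_eq_zero_of_notMem_tsupport fun h => hy (tsupport_fderiv_subset ℝ h)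
    by_cases hx : x ∈ Metric.cthickening 1 (tsupport φ)
    · rw [indicator_of_mem hx]
      exact (h2 ((Metric.mem_ball.1 hy).trans_le ((min_le_right _ _).trans (min_le_right _ _)))).le
    · rw [indicator_of_notMem hx, hz _ (hzero x hx y hy),
        hz _ (hzero x hx x (Metric.mem_ball_self hr0)), dist_self]

theorem integral_inner_gradient_eq_of_contDiff_one {N : ℕ} {A : Euc N → Euc N} {g : Euc N → ℝ}
    (hA : LocallyIntegrable A) (hg : LocallyIntegrable g)
    (h : ∀ φ : Euc N → ℝ, ContDiff ℝ (⊤ : ℕ∞) φ → HasCompactSupport φ →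
      ∫ x, ⟪A x, gradient φ x⟫ = ∫ x, g x * φ x)
    {φ : Euc N → ℝ} (hφ : ContDiff ℝ 1 φ) (hφc : HasCompactSupport φ) :
    ∫ x, ⟪A x, gradient φ x⟫ = ∫ x, g x * φ x := by
  set S := Metric.cthickening 1 (tsupport φ) with hS
  have hSc : IsCompact S := hφc.isCompact.cthickening
  have hSm := hSc.measurableSet
  have hAS : IntegrableOn (fun x => ‖A x‖) S := (hA.integrableOn_isCompact hSc).norm
  have hgS : IntegrableOn (fun x => |g x|) S := (hg.integrableOn_isCompact hSc).norm
  have hi1 : ∀ u : Euc N → ℝ, ContDiff ℝ 1 u → HasCompactSupport u →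
      Integrable fun x => ⟪A x, gradient u x⟫ := by
    intro u hu huc
    have hc := hasCompactSupport_gradient huc
    obtain ⟨M, hM⟩ := (continuous_gradient_of_contDiff hu).bounded_above_of_compact_support hc
    have hAi := (hA.integrableOn_isCompact hc.isCompact).norm.const_mul M
    replace hAi := (integrable_indicator_iff (isClosed_tsupport _).measurableSet).2 hAi
    refine hAi.mono (hA.aestronglyMeasurable.inner
      (continuous_gradient_of_contDiff hu).aestronglyMeasurable) (ae_of_all _ fun x => ?_)
    by_cases hx : x ∈ tsupport (gradient u)
    · rw [indicator_of_mem hx]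
      refine (norm_inner_le_norm _ _).trans ?_
      rw [Real.norm_eq_abs, mul_comm]
      exact (mul_le_mul_of_nonneg_right (hM x) (norm_nonneg _)).trans (le_abs_self _)
    · simp [image_eq_zero_of_notMem_tsupport hx]
  have hi2 : ∀ u : Euc N → ℝ, ContDiff ℝ 1 u → HasCompactSupport u →
      Integrable fun x => g x * u x := by
    intro u hu huc
    have := hg.integrable_smul_right_of_hasCompactSupport hu.continuous huc
    simpa [mul_comm] using this
  have key : ∀ δ > 0, |(∫ x, ⟪A x, gradient φ x⟫) - ∫ x, g x * φ x| ≤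
      δ * ((∫ x in S, ‖A x‖) + ∫ x in S, |g x|) := by
    intro δ hδ
    obtain ⟨ψ, hψ, hψc, h1, h2⟩ := exists_contDiff_approx hφ hφc hδ
    have hψ1 : ContDiff ℝ 1 ψ := hψ.of_le (by exact_mod_cast le_top)
    have e1 : |(∫ x, ⟪A x, gradient φ x⟫) - ∫ x, ⟪A x, gradient ψ x⟫| ≤
        δ * ∫ x in S, ‖A x‖ := by
      rw [← integral_sub (hi1 φ hφ hφc) (hi1 ψ hψ1 hψc), ← integral_const_mul,
        ← integral_indicator hSm, ← Real.norm_eq_abs]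
      refine norm_integral_le_of_norm_le
        ((integrable_indicator_iff hSm).2 (hAS.const_mul δ)) (ae_of_all _ fun x => ?_)
      rw [← inner_sub_right]
      refine (norm_inner_le_norm _ _).trans ?_
      have := h2 x
      rw [norm_sub_rev] at this
      refine (mul_le_mul_of_nonneg_left this (norm_nonneg _)).trans (le_of_eq ?_)
      by_cases hx : x ∈ S
      · rw [indicator_of_mem hx, indicator_of_mem hx, mul_comm]
      · rw [indicator_of_notMem hx, indicator_of_notMem hx, mul_zero]
    have e2 : |(∫ x, g x * ψ x) - ∫ x, g x * φ x| ≤ δ * ∫ x in S, |g x| := by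
      rw [← integral_sub (hi2 ψ hψ1 hψc) (hi2 φ hφ hφc), ← integral_const_mul,
        ← integral_indicator hSm, ← Real.norm_eq_abs]
      refine norm_integral_le_of_norm_le
        ((integrable_indicator_iff hSm).2 (hgS.const_mul δ)) (ae_of_all _ fun x => ?_)
      rw [← mul_sub, Real.norm_eq_abs, abs_mul]
      refine (mul_le_mul_of_nonneg_left (h1 x) (abs_nonneg _)).trans (le_of_eq ?_)
      by_cases hx : x ∈ S
      · rw [indicator_of_mem hx, indicator_of_mem hx, mul_comm]
      · rw [indicator_of_notMem hx, indicator_of_notMem hx, mul_zero]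
    rw [h ψ hψ hψc] at e1
    calc _ ≤ _ := abs_sub_le _ (∫ x, g x * ψ x) _
      _ ≤ _ := add_le_add e1 e2
      _ = _ := by ring
  set B := (∫ x in S, ‖A x‖) + ∫ x in S, |g x| with hB
  have hB0 : 0 ≤ B := add_nonneg (integral_nonneg fun _ => norm_nonneg _)
    (integral_nonneg fun _ => abs_nonneg _)
  rw [← sub_eq_zero, ← abs_nonpos_iff]
  refine le_of_forall_pos_le_add fun θ hθ => ?_
  refine (key (θ / (B + 1)) (by positivity)).trans ?_
  rw [zero_add, div_mul_eq_mul_div, div_le_iff₀ (by positivity)]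
  nlinarith

/-- The vector field `H(∇z)^{N-1} (∇H)(∇z)` whose divergence is `Q_N z`. -/
def finslerFlux {N : ℕ} (H : Euc N → ℝ) (z : Euc N → ℝ) (x : Euc N) : Euc N :=
  H (gradient z x) ^ (N - 1) • gradient H (gradient z x)

theorem measurable_gradient {N : ℕ} (f : Euc N → ℝ) : Measurable (gradient f) :=
  (InnerProductSpace.toDual ℝ (Euc N)).symm.continuous.measurable.comp (measurable_fderiv ℝ f)

theorem gradient_comp_mul {N : ℕ} {z χ : Euc N → ℝ} {F : ℝ → ℝ} {x : Euc N} {d : ℝ}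
    (hF : HasDerivAt F d (z x)) (hz : DifferentiableAt ℝ z x) (hχ : DifferentiableAt ℝ χ x) :
    gradient (fun x => F (z x) * χ x) x = F (z x) • gradient χ x + (χ x * d) • gradient z x := by
  have h := ((hF.comp_hasFDerivAt x hz.hasFDerivAt).mul hχ.hasFDerivAt).fderiv
  have h2 : fderiv ℝ (fun x => F (z x) * χ x) x =
      F (z x) • fderiv ℝ χ x + χ x • d • fderiv ℝ z x := h
  simp only [gradient, h2, map_add, map_smulₛₗ, smul_smul]
  simp

namespace IsFinslerNorm

variable {N : ℕ} {H : Euc N → ℝ}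

theorem norm_finslerFlux_le (h : IsFinslerNorm N H) {C : ℝ} (hC : 0 < C)
    (hHC : ∀ ξ, H ξ ≤ C * ‖ξ‖) (z : Euc N → ℝ) (x : Euc N) :
    ‖finslerFlux H z x‖ ≤ C * H (gradient z x) ^ (N - 1) := by
  rw [finslerFlux, norm_smul, Real.norm_of_nonneg (pow_nonneg (h.nonneg _) _), mul_comm]
  exact mul_le_mul_of_nonneg_right (h.norm_gradient_le hC hHC _) (pow_nonneg (h.nonneg _) _)

theorem inner_finslerFlux_gradient (h : IsFinslerNorm N H) (hN : 2 ≤ N)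
    (hreg : FinslerRegular N H) (z : Euc N → ℝ) (x : Euc N) :
    ⟪finslerFlux H z x, gradient z x⟫ = H (gradient z x) ^ N := by
  rw [finslerFlux, real_inner_smul_left]
  rcases eq_or_ne (gradient z x) 0 with h0 | h0
  · rw [h0, inner_zero_right, mul_zero, h.map_zero, zero_pow (by omega)]
  have hd : DifferentiableAt ℝ H (gradient z x) :=
    (hreg.1.contDiffAt (isOpen_compl_singleton.mem_nhds h0)).differentiableAt two_ne_zero
  rw [h.inner_gradient_self hd, ← pow_succ]
  congr 1
  omega

theorem continuous_comp_gradient (h : IsFinslerNorm N H) {z : Euc N → ℝ} (hz : ContDiff ℝ 1 z) :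
    Continuous fun x => H (gradient z x) :=
  h.continuous.comp (continuous_gradient_of_contDiff hz)

theorem measurable_finslerFlux (h : IsFinslerNorm N H) {z : Euc N → ℝ} (hz : ContDiff ℝ 1 z) :
    Measurable (finslerFlux H z) :=
  ((h.continuous_comp_gradient hz).measurable.pow_const _).smul
    ((measurable_gradient H).comp (measurable_gradient z))

theorem locallyIntegrable_finslerFlux (h : IsFinslerNorm N H) {z : Euc N → ℝ}
    (hz : ContDiff ℝ 1 z) : LocallyIntegrable (finslerFlux H z) := by
  obtain ⟨C, hC, hHC⟩ := h.exists_le_mul_norm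
  have hc : Continuous fun x => C * H (gradient z x) ^ (N - 1) :=
    continuous_const.mul ((h.continuous_comp_gradient hz).pow _)
  refine hc.locallyIntegrable.mono (h.measurable_finslerFlux hz).aestronglyMeasurable
    (ae_of_all _ fun x => ?_)
  exact (h.norm_finslerFlux_le hC hHC z x).trans (le_abs_self _)

theorem integral_inner_finslerFlux (h : IsFinslerNorm N H) {z : Euc N → ℝ} (hz : ContDiff ℝ 1 z)
    (hsol : IsWeakSolution N H univ z (fun x => Real.exp (z x)))
    {φ : Euc N → ℝ} (hφ : ContDiff ℝ 1 φ) (hφc : HasCompactSupport φ) :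
    ∫ x, ⟪finslerFlux H z x, gradient φ x⟫ = ∫ x, Real.exp (z x) * φ x := by
  refine integral_inner_gradient_eq_of_contDiff_one (h.locallyIntegrable_finslerFlux hz)
    (hz.continuous.rexp.locallyIntegrable) (fun ψ hψ hψc => ?_) hφ hφc
  have := hsol ψ hψ hψc (subset_univ _)
  simpa only [setIntegral_univ, finslerFlux, real_inner_smul_left] using this

end IsFinslerNorm

theorem exists_cutoff (N : ℕ) : ∃ D : ℝ, 0 < D ∧ ∃ η : ℕ → Euc N → ℝ, ∀ n,
    ContDiff ℝ 1 (η n) ∧ HasCompactSupport (η n) ∧ (∀ x, 0 ≤ η n x) ∧ (∀ x, η n x ≤ 1) ∧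
    (∀ x ∈ Metric.closedBall (0 : Euc N) n, η n x = 1) ∧
    ∀ x, ‖gradient (η n) x‖ ≤ D / (n + 1) := by
  let b : ContDiffBump (0 : Euc N) := ⟨1, 2, by norm_num, by norm_num⟩
  have hb1 : ContDiff ℝ 1 b := b.contDiff
  obtain ⟨D, hD⟩ := (hb1.continuous_fderiv one_ne_zero).bounded_above_of_compact_support
    (b.hasCompactSupport.fderiv ℝ)
  refine ⟨max D 1, by positivity, fun n x => b (((n : ℝ) + 1)⁻¹ • x), fun n => ?_⟩
  have hn : (0 : ℝ) < (n : ℝ) + 1 := by positivity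
  refine ⟨hb1.comp (contDiff_const_smul _), ?_, fun x => b.nonneg, fun x => b.le_one,
    fun x hx => ?_, fun x => ?_⟩
  · exact b.hasCompactSupport.comp_smul (inv_ne_zero hn.ne')
  · apply b.one_of_mem_closedBall
    rw [mem_closedBall_zero_iff] at hx ⊢
    rw [norm_smul, norm_inv, Real.norm_of_nonneg hn.le, inv_mul_le_iff₀ hn]
    change ‖x‖ ≤ ((n : ℝ) + 1) * 1
    linarith
  · have : ‖gradient (fun x => b (((n : ℝ) + 1)⁻¹ • x)) x‖ =
        ‖fderiv ℝ (fun x => b (((n : ℝ) + 1)⁻¹ • x)) x‖ := LinearIsometryEquiv.norm_map _ _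
    rw [this, fderiv_comp_smul, norm_smul, norm_inv, Real.norm_of_nonneg hn.le, div_eq_inv_mul]
    gcongr
    exact (hD _).trans (le_max_left _ _)

theorem pow_pred_le_one_add_pow {a : ℝ} (ha : 0 ≤ a) (N : ℕ) : a ^ (N - 1) ≤ 1 + a ^ N := by
  rcases le_total a 1 with h | h
  · exact (pow_le_one₀ ha h).trans (by linarith [pow_nonneg ha N])
  · exact (pow_le_pow_right₀ h (Nat.sub_le N 1)).trans (by linarith)

theorem Continuous.integrable_mul_of_hasCompactSupport {N : ℕ} {f g : Euc N → ℝ}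
    (hf : Continuous f) (hg : Continuous g) (hgc : HasCompactSupport g) :
    Integrable fun x => f x * g x :=
  (hf.mul hg).integrable_of_hasCompactSupport hgc.mul_left

namespace IsFinslerNorm

variable {N : ℕ} {H : Euc N → ℝ}

theorem integrable_inner_finslerFlux (h : IsFinslerNorm N H) {z : Euc N → ℝ}
    (hz : ContDiff ℝ 1 z) {f : Euc N → ℝ} (hf : Continuous f) {χ : Euc N → ℝ}
    (hχ : ContDiff ℝ 1 χ) (hχc : HasCompactSupport χ) :
    Integrable fun x => f x * ⟪finslerFlux H z x, gradient χ x⟫ := by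
  obtain ⟨C, hC, hHC⟩ := h.exists_le_mul_norm
  have hc : Continuous fun x => |f x| * (C * H (gradient z x) ^ (N - 1)) :=
    hf.abs.mul (continuous_const.mul ((h.continuous_comp_gradient hz).pow _))
  refine (hc.integrable_mul_of_hasCompactSupport (continuous_gradient_of_contDiff hχ).norm
    (hasCompactSupport_gradient hχc).norm).mono ?_ (ae_of_all _ fun x => ?_)
  · exact (hf.measurable.mul ((h.measurable_finslerFlux hz).inner
      (measurable_gradient χ))).aestronglyMeasurable
  · rw [norm_mul, Real.norm_eq_abs (f x), mul_assoc]
    refine le_trans ?_ (le_abs_self _)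
    refine mul_le_mul_of_nonneg_left ?_ (abs_nonneg _)
    exact (norm_inner_le_norm _ _).trans
      (mul_le_mul_of_nonneg_right (h.norm_finslerFlux_le hC hHC z x) (norm_nonneg _))

/-- The weak equation tested with `F(z) χ`. -/
theorem integral_comp_mul_add (h : IsFinslerNorm N H) (hN : 2 ≤ N) (hreg : FinslerRegular N H)
    {z : Euc N → ℝ} (hz : ContDiff ℝ 1 z)
    (hsol : IsWeakSolution N H univ z (fun x => Real.exp (z x)))
    {F f : ℝ → ℝ} (hF : ∀ t, HasDerivAt F (f t) t) (hf : Continuous f)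
    {χ : Euc N → ℝ} (hχ : ContDiff ℝ 1 χ) (hχc : HasCompactSupport χ) :
    (∫ x, f (z x) * H (gradient z x) ^ N * χ x) +
      (∫ x, F (z x) * ⟪finslerFlux H z x, gradient χ x⟫) =
      ∫ x, Real.exp (z x) * (F (z x) * χ x) := by
  have hFc : ContDiff ℝ 1 F := by
    rw [contDiff_one_iff_deriv]
    refine ⟨fun t => (hF t).differentiableAt, ?_⟩
    rwa [funext fun t => (hF t).deriv]
  have hFz : Continuous fun x => F (z x) := hFc.continuous.comp hz.continuous
  refine Eq.trans ?_ (h.integral_inner_finslerFlux hz hsol (φ := fun x => F (z x) * χ x)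
    ((hFc.comp hz).mul hχ) hχc.mul_left)
  rw [← integral_add]
  · refine integral_congr_ae (ae_of_all _ fun x => ?_)
    have hg := gradient_comp_mul (hF (z x)) (hz.differentiable one_ne_zero x)
      (hχ.differentiable one_ne_zero x)
    dsimp only
    rw [hg, inner_add_right, real_inner_smul_right, real_inner_smul_right,
      h.inner_finslerFlux_gradient hN hreg]
    ring
  · exact ((hf.comp hz.continuous).mul
      ((h.continuous_comp_gradient hz).pow N)).integrable_mul_of_hasCompactSupport
      hχ.continuous hχc
  · exact h.integrable_inner_finslerFlux hz hFz hχ hχc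

theorem integrable_exp_mul_energy (h : IsFinslerNorm N H) (hN : 2 ≤ N)
    (hreg : FinslerRegular N H) {z : Euc N → ℝ} (hz : ContDiff ℝ 1 z) (hzle : ∀ x, z x ≤ 0)
    (hint : Integrable fun x => Real.exp (z x))
    (hsol : IsWeakSolution N H univ z (fun x => Real.exp (z x))) :
    Integrable fun x => Real.exp (z x) * H (gradient z x) ^ N := by
  obtain ⟨C, hC, hHC⟩ := h.exists_le_mul_norm
  obtain ⟨D, hD, η, hη⟩ := exists_cutoff N
  have hHg := h.continuous_comp_gradient hz
  set M := ∫ x, Real.exp (z x) with hM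
  have hM0 : 0 ≤ M := integral_nonneg fun x => (Real.exp_pos _).le
  have hloc : Continuous fun x => Real.exp (z x) * H (gradient z x) ^ N :=
    hz.continuous.rexp.mul (hHg.pow N)
  have hnn : ∀ x, 0 ≤ Real.exp (z x) * H (gradient z x) ^ N := fun x =>
    mul_nonneg (Real.exp_pos _).le (pow_nonneg (h.nonneg _) _)
  refine (aecover_closedBall (x := (0 : Euc N)) (r := fun n : ℕ => (n : ℝ))
    tendsto_natCast_atTop_atTop).integrable_of_integral_bounded_of_nonneg_ae (3 * M)
    (fun n => hloc.continuousOn.integrableOn_compact (isCompact_closedBall _ _))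
    (ae_of_all _ hnn) ?_
  have hlim : Tendsto (fun n : ℕ => N * C * D / ((n : ℝ) + 1)) atTop (𝓝 0) := by
    simpa [div_eq_mul_inv] using (tendsto_one_div_add_atTop_nhds_zero_nat (𝕜 := ℝ)).const_mul
      (N * C * D)
  filter_upwards [hlim.eventually_le_const (show (0 : ℝ) < 1 / 2 by norm_num)] with n hn
  obtain ⟨h1, h2, h3, h4, h5, h6⟩ := hη n
  set ε := N * C * D / ((n : ℝ) + 1) with hε
  have hε0 : 0 ≤ ε := by positivity
  have hN0 : N ≠ 0 := by omega
  have hcN : HasCompactSupport fun x => η n x ^ N :=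
    h2.comp_left (g := fun y : ℝ => y ^ N) (zero_pow hN0)
  have hgN : ∀ x, gradient (fun x => η n x ^ N) x =
      (N * η n x ^ (N - 1)) • gradient (η n) x := by
    intro x
    have := ((h1.differentiable one_ne_zero x).hasFDerivAt.pow N).fderiv
    simp only [gradient]
    rw [show fderiv ℝ (fun x => η n x ^ N) x = _ from this]
    simp
  have key := h.integral_comp_mul_add hN hreg hz hsol Real.hasDerivAt_exp Real.continuous_exp
    (h1.pow N) hcN
  set G : Euc N → ℝ := fun x => Real.exp (z x) * H (gradient z x) ^ N * η n x ^ N with hG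
  have hGi : Integrable G :=
    hloc.integrable_mul_of_hasCompactSupport (h1.continuous.pow N) hcN
  have hG0 : ∀ x, 0 ≤ G x := fun x => mul_nonneg (hnn x) (pow_nonneg (h3 x) _)
  have e1 : ∫ x, Real.exp (z x) * (Real.exp (z x) * η n x ^ N) ≤ M := by
    refine integral_mono ?_ hint fun x => ?_
    · exact hz.continuous.rexp.integrable_mul_of_hasCompactSupport
        (hz.continuous.rexp.mul (h1.continuous.pow N)) hcN.mul_left
    · have a1 : Real.exp (z x) ≤ 1 := Real.exp_le_one_iff.2 (hzle x)
      have a2 : η n x ^ N ≤ 1 := pow_le_one₀ (h3 x) (h4 x)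
      calc _ ≤ Real.exp (z x) * (1 * 1) := by
            gcongr
            exact pow_nonneg (h3 x) _
        _ = _ := by ring
  have e2 : -(∫ x, Real.exp (z x) * ⟪finslerFlux H z x, gradient (fun x => η n x ^ N) x⟫) ≤
      ε * (M + ∫ x, G x) := by
    rw [← integral_neg, hM, ← integral_add hint hGi, ← integral_const_mul]
    refine integral_mono (h.integrable_inner_finslerFlux hz hz.continuous.rexp
      (h1.pow N) hcN).neg ((hint.add hGi).const_mul _) fun x => ?_
    have a1 : |⟪finslerFlux H z x, gradient (η n) x⟫| ≤
        C * H (gradient z x) ^ (N - 1) * (D / (n + 1)) := by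
      refine (abs_real_inner_le_norm _ _).trans ?_
      have b1 := h.norm_finslerFlux_le hC hHC z x
      exact mul_le_mul b1 (h6 x) (norm_nonneg _) ((norm_nonneg _).trans b1)
    have a2 := pow_pred_le_one_add_pow (mul_nonneg (h.nonneg (gradient z x)) (h3 x)) N
    rw [mul_pow, mul_pow] at a2
    have a3 : 0 ≤ N * η n x ^ (N - 1) := mul_nonneg (Nat.cast_nonneg _) (pow_nonneg (h3 x) _)
    have a4 := (neg_le_abs _).trans a1
    simp only [hgN, real_inner_smul_right]
    calc -(Real.exp (z x) * (N * η n x ^ (N - 1) * ⟪finslerFlux H z x, gradient (η n) x⟫))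
        = Real.exp (z x) * (N * η n x ^ (N - 1) * -⟪finslerFlux H z x, gradient (η n) x⟫) := by
          ring
      _ ≤ Real.exp (z x) * (N * η n x ^ (N - 1) *
          (C * H (gradient z x) ^ (N - 1) * (D / (n + 1)))) := by gcongr
      _ = ε * (Real.exp (z x) * (H (gradient z x) ^ (N - 1) * η n x ^ (N - 1))) := by
          rw [hε]; ring
      _ ≤ ε * (Real.exp (z x) * (1 + H (gradient z x) ^ N * η n x ^ N)) := by gcongr
      _ = _ := by simp only [hG]; ring
  have e3 : ∫ x in Metric.closedBall (0 : Euc N) n, Real.exp (z x) * H (gradient z x) ^ N ≤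
      ∫ x, G x := by
    rw [← integral_indicator Metric.isClosed_closedBall.measurableSet]
    refine integral_mono ((integrable_indicator_iff Metric.isClosed_closedBall.measurableSet).2
      (hloc.continuousOn.integrableOn_compact (isCompact_closedBall _ _))) hGi fun x => ?_
    by_cases hx : x ∈ Metric.closedBall (0 : Euc N) n
    · simp only [indicator_of_mem hx, hG, h5 x hx, one_pow, mul_one]
      exact le_rfl
    · rw [indicator_of_notMem hx]
      exact hG0 x
  have e4 : 0 ≤ ∫ x, G x := integral_nonneg hG0
  have e5 : (∫ x, G x) ≤ M + ε * (M + ∫ x, G x) := by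
    have : (∫ x, G x) = ∫ x, Real.exp (z x) * H (gradient z x) ^ N * η n x ^ N := rfl
    linarith
  nlinarith

theorem integrable_comp_mul_energy (h : IsFinslerNorm N H) (hN : 2 ≤ N)
    (hreg : FinslerRegular N H) {z : Euc N → ℝ} (hz : ContDiff ℝ 1 z) (hzle : ∀ x, z x ≤ 0)
    (hint : Integrable fun x => Real.exp (z x))
    (hsol : IsWeakSolution N H univ z (fun x => Real.exp (z x)))
    {f : ℝ → ℝ} (hf : Continuous f) {B : ℝ} (hf0 : ∀ t, 0 ≤ f t)
    (hfB : ∀ t, f t ≤ B * Real.exp t) {j : ℕ} (hj : j ≤ N) :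
    Integrable fun x => f (z x) * H (gradient z x) ^ j := by
  have hB : 0 ≤ B := by
    have := (hf0 0).trans (hfB 0)
    simpa using this
  refine ((hint.add (h.integrable_exp_mul_energy hN hreg hz hzle hint hsol)).const_mul B).mono
    ((hf.comp hz.continuous).mul ((h.continuous_comp_gradient hz).pow j)).aestronglyMeasurable
    (ae_of_all _ fun x => ?_)
  rw [Real.norm_of_nonneg (mul_nonneg (hf0 _) (pow_nonneg (h.nonneg _) _))]
  refine le_trans ?_ (le_abs_self _)
  have hH := h.nonneg (gradient z x)
  have h1 : H (gradient z x) ^ j ≤ 1 + H (gradient z x) ^ N := by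
    rcases le_total (H (gradient z x)) 1 with h1 | h1
    · exact (pow_le_one₀ hH h1).trans (by linarith [pow_nonneg hH N])
    · exact (pow_le_pow_right₀ h1 hj).trans (by linarith)
  calc _ ≤ B * Real.exp (z x) * (1 + H (gradient z x) ^ N) := by
        gcongr
        exact hfB _
    _ = _ := by simp only [Pi.add_apply]; ring

theorem integral_deriv_comp_le (h : IsFinslerNorm N H) (hN : 2 ≤ N)
    (hreg : FinslerRegular N H) {z : Euc N → ℝ} (hz : ContDiff ℝ 1 z) (hzle : ∀ x, z x ≤ 0)
    (hint : Integrable fun x => Real.exp (z x))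
    (hsol : IsWeakSolution N H univ z (fun x => Real.exp (z x)))
    {F f : ℝ → ℝ} (hF : ∀ t, HasDerivAt F (f t) t) (hf : Continuous f) {B : ℝ}
    (hf0 : ∀ t, 0 ≤ f t) (hfB : ∀ t, f t ≤ B * Real.exp t)
    (hF0 : ∀ t, 0 ≤ F t) (hFB : ∀ t, F t ≤ B * Real.exp t) :
    ∫ x, f (z x) * H (gradient z x) ^ N ≤ ∫ x, Real.exp (z x) * F (z x) := by
  obtain ⟨C, hC, hHC⟩ := h.exists_le_mul_norm
  obtain ⟨D, hD, η, hη⟩ := exists_cutoff N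
  have hHg := h.continuous_comp_gradient hz
  have hFc : Continuous F := continuous_iff_continuousAt.2 fun t => (hF t).continuousAt
  have hi := h.integrable_comp_mul_energy hN hreg hz hzle hint hsol hf hf0 hfB le_rfl
  have hE := h.integrable_exp_mul_energy hN hreg hz hzle hint hsol
  have hiF : Integrable fun x => Real.exp (z x) * F (z x) := by
    refine (hint.const_mul B).mono (hz.continuous.rexp.mul
      (hFc.comp hz.continuous)).aestronglyMeasurable (ae_of_all _ fun x => ?_)
    rw [Real.norm_of_nonneg (mul_nonneg (Real.exp_pos _).le (hF0 _))]
    refine le_trans ?_ (le_abs_self _)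
    calc Real.exp (z x) * F (z x) ≤ 1 * (B * Real.exp (z x)) :=
          mul_le_mul (Real.exp_le_one_iff.2 (hzle x)) (hFB _) (hF0 _) zero_le_one
      _ = _ := one_mul _
  have hB : 0 ≤ B := by
    have := (hf0 0).trans (hfB 0)
    simpa using this
  set I := ∫ x, (Real.exp (z x) + Real.exp (z x) * H (gradient z x) ^ N) with hI
  have l1 : Tendsto (fun n : ℕ => ∫ x, f (z x) * H (gradient z x) ^ N * η n x) atTop
      (𝓝 (∫ x, f (z x) * H (gradient z x) ^ N)) := by
    refine tendsto_integral_of_dominated_convergence _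
      (fun n => (hi.aestronglyMeasurable.mul (hη n).1.continuous.aestronglyMeasurable))
      hi.norm (fun n => ae_of_all _ fun x => ?_) (ae_of_all _ fun x => ?_)
    · rw [norm_mul]
      refine mul_le_of_le_one_right (norm_nonneg _) ?_
      rw [Real.norm_of_nonneg ((hη n).2.2.1 x)]
      exact (hη n).2.2.2.1 x
    · refine tendsto_const_nhds.congr' ?_
      filter_upwards [eventually_ge_atTop ⌈‖x‖⌉₊] with n hn
      rw [(hη n).2.2.2.2.1 x (mem_closedBall_zero_iff.2 (Nat.ceil_le.1 hn)), mul_one]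
  have l2 : Tendsto (fun n : ℕ => (∫ x, Real.exp (z x) * F (z x)) +
      B * C * D * I * (1 / ((n : ℝ) + 1))) atTop (𝓝 (∫ x, Real.exp (z x) * F (z x))) := by
    simpa using ((tendsto_one_div_add_atTop_nhds_zero_nat (𝕜 := ℝ)).const_mul
      (B * C * D * I)).const_add (∫ x, Real.exp (z x) * F (z x))
  refine le_of_tendsto_of_tendsto' l1 l2 fun n => ?_
  obtain ⟨h1, h2, h3, h4, h5, h6⟩ := hη n
  have key := h.integral_comp_mul_add hN hreg hz hsol hF hf h1 h2
  have e1 : ∫ x, Real.exp (z x) * (F (z x) * η n x) ≤ ∫ x, Real.exp (z x) * F (z x) := by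
    refine integral_mono ?_ hiF fun x => ?_
    · exact hz.continuous.rexp.integrable_mul_of_hasCompactSupport
        ((hFc.comp hz.continuous).mul h1.continuous) h2.mul_left
    · exact mul_le_mul_of_nonneg_left (mul_le_of_le_one_right (hF0 _) (h4 x)) (Real.exp_pos _).le
  have e2 : -(∫ x, F (z x) * ⟪finslerFlux H z x, gradient (η n) x⟫) ≤
      B * C * D * I * (1 / ((n : ℝ) + 1)) := by
    rw [← integral_neg, mul_right_comm, hI, ← integral_const_mul]
    refine integral_mono (h.integrable_inner_finslerFlux hz (hFc.comp hz.continuous)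
      h1 h2).neg ((hint.add hE).const_mul _) fun x => ?_
    have a1 : |⟪finslerFlux H z x, gradient (η n) x⟫| ≤
        C * H (gradient z x) ^ (N - 1) * (D / (n + 1)) := by
      refine (abs_real_inner_le_norm _ _).trans ?_
      have b1 := h.norm_finslerFlux_le hC hHC z x
      exact mul_le_mul b1 (h6 x) (norm_nonneg _) ((norm_nonneg _).trans b1)
    have a2 := pow_pred_le_one_add_pow (h.nonneg (gradient z x)) N
    have a4 := (neg_le_abs _).trans a1
    have a5 := pow_nonneg (h.nonneg (gradient z x)) (N - 1)
    calc -(F (z x) * ⟪finslerFlux H z x, gradient (η n) x⟫)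
        = F (z x) * -⟪finslerFlux H z x, gradient (η n) x⟫ := by ring
      _ ≤ F (z x) * (C * H (gradient z x) ^ (N - 1) * (D / (n + 1))) :=
          mul_le_mul_of_nonneg_left a4 (hF0 _)
      _ ≤ (B * Real.exp (z x)) * (C * (1 + H (gradient z x) ^ N) * (D / (n + 1))) := by
          gcongr
          exact hFB _
      _ = _ := by ring
  linarith

end IsFinslerNorm

theorem mul_pow_mul_le_add {g s : ℝ} (hg : 0 ≤ g) (hs : 0 ≤ s) (n : ℕ) :
    (n + 1) * s ^ n * g ≤ g ^ (n + 1) + n * s ^ (n + 1) := by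
  induction n with
  | zero => simp
  | succ n ih =>
    have h1 := mul_le_mul_of_nonneg_left ih hg
    have h2 : 0 ≤ ((n : ℝ) + 1) * s ^ n * (g - s) ^ 2 := by positivity
    push_cast
    calc ((n : ℝ) + 1 + 1) * s ^ (n + 1) * g
        = g * ((n + 1) * s ^ n * g) - n * s ^ (n + 1) * g + (n + 1) * s ^ (n + 2)
          - (n + 1) * s ^ n * (g - s) ^ 2 := by ring
      _ ≤ g * (g ^ (n + 1) + n * s ^ (n + 1)) - n * s ^ (n + 1) * g + (n + 1) * s ^ (n + 2) := by
          linarith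
      _ = _ := by ring

/-- Jensen's inequality for `t ↦ t ^ N` with a weight. -/
theorem integral_mul_pow_le {α : Type*} [MeasurableSpace α] {μ : Measure α} {w g : α → ℝ}
    (hw : ∀ x, 0 ≤ w x) (hg : ∀ x, 0 ≤ g x) {n : ℕ} (hwi : Integrable w μ)
    (h1 : Integrable (fun x => w x * g x) μ) (hn : Integrable (fun x => w x * g x ^ (n + 1)) μ) :
    (∫ x, w x * g x ∂μ) ^ (n + 1) ≤ (∫ x, w x * g x ^ (n + 1) ∂μ) * (∫ x, w x ∂μ) ^ n := by
  set I := ∫ x, w x * g x ∂μ with hI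
  set J := ∫ x, w x * g x ^ (n + 1) ∂μ with hJ
  set P := ∫ x, w x ∂μ with hP
  have hI0 : 0 ≤ I := integral_nonneg fun x => mul_nonneg (hw x) (hg x)
  have hJ0 : 0 ≤ J := integral_nonneg fun x => mul_nonneg (hw x) (pow_nonneg (hg x) _)
  have hP0 : 0 ≤ P := integral_nonneg hw
  rcases hP0.eq_or_lt with h0 | hpos
  · have hae : w =ᵐ[μ] 0 := (integral_eq_zero_iff_of_nonneg hw hwi).1 h0.symm
    have hI00 : I = 0 := by
      rw [hI]
      refine integral_eq_zero_of_ae ?_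
      filter_upwards [hae] with x hx
      simp [hx]
    rw [hI00, zero_pow (Nat.succ_ne_zero n)]
    positivity
  · have hs : 0 ≤ I / P := div_nonneg hI0 hP0
    have key : (n + 1) * (I / P) ^ n * I ≤ J + n * (I / P) ^ (n + 1) * P := by
      rw [hI, ← integral_const_mul, ← hI, hJ, hP, ← integral_const_mul, ← hP,
        ← integral_add hn (hwi.const_mul _)]
      refine integral_mono (h1.const_mul _) (hn.add (hwi.const_mul _)) fun x => ?_
      have := mul_le_mul_of_nonneg_left (mul_pow_mul_le_add (hg x) hs n) (hw x)
      dsimp only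
      linarith
    have e1 : (I / P) ^ (n + 1) * P = (I / P) ^ n * I := by
      rw [pow_succ]; field_simp
    rw [mul_assoc (n : ℝ), e1] at key
    have e2 : (I / P) ^ n * I ≤ J := by linarith
    calc I ^ (n + 1) = (I / P) ^ n * I * P ^ n := by
          rw [div_pow, pow_succ]; field_simp
      _ ≤ J * P ^ n := by gcongr

/-- A smooth truncation at the levels `s < t`, of total height at least `L`. -/
theorem exists_truncation {s t L : ℝ} (hst : s < t) (hL : L < t - s) :
    ∃ F f : ℝ → ℝ, (∀ τ, HasDerivAt F (f τ) τ) ∧ Continuous f ∧ (∀ τ, 0 ≤ f τ) ∧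
      (∀ τ, f τ ≤ 1) ∧ (∀ τ ≤ s, f τ = 0) ∧ (∀ τ, t ≤ τ → f τ = 0) ∧
      (∀ τ ≤ s, F τ = 0) ∧ (∀ τ, t ≤ τ → F τ = F t) ∧ Monotone F ∧ L ≤ F t := by
  obtain ⟨δ, hδ, hδs, hδL⟩ : ∃ δ > 0, 2 * δ < t - s ∧ L ≤ t - s - 2 * δ := by
    refine ⟨min ((t - s) / 4) ((t - s - L) / 2), ?_, ?_, ?_⟩
    · exact lt_min (by linarith) (by linarith)
    · linarith [min_le_left ((t - s) / 4) ((t - s - L) / 2)]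
    · linarith [min_le_right ((t - s) / 4) ((t - s - L) / 2)]
  set f : ℝ → ℝ := fun τ => max 0 (min 1 (min ((τ - s) / δ) ((t - τ) / δ))) with hf
  have hfc : Continuous f := by fun_prop
  have hf0 : ∀ τ, 0 ≤ f τ := fun τ => le_max_left _ _
  have hf1 : ∀ τ, f τ ≤ 1 := fun τ => max_le zero_le_one (min_le_left _ _)
  have hfs : ∀ τ ≤ s, f τ = 0 := fun τ hτ => max_eq_left
    ((min_le_right _ _).trans ((min_le_left _ _).trans
      (div_nonpos_of_nonpos_of_nonneg (by linarith) hδ.le)))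
  have hft : ∀ τ, t ≤ τ → f τ = 0 := fun τ hτ => max_eq_left
    ((min_le_right _ _).trans ((min_le_right _ _).trans
      (div_nonpos_of_nonpos_of_nonneg (by linarith) hδ.le)))
  have hfi : ∀ a b, IntervalIntegrable f volume a b := fun a b => hfc.intervalIntegrable a b
  have hd : ∀ τ, HasDerivAt (fun τ => ∫ σ in s..τ, f σ) (f τ) τ := fun τ =>
    (hfc.integral_hasStrictDerivAt s τ).hasDerivAt
  have hmono : Monotone fun τ => ∫ σ in s..τ, f σ :=
    monotone_of_deriv_nonneg (fun τ => (hd τ).differentiableAt) fun τ => by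
      rw [(hd τ).deriv]
      exact hf0 τ
  refine ⟨fun τ => ∫ σ in s..τ, f σ, f, hd, hfc, hf0, hf1, hfs, hft, fun τ hτ => ?_,
    fun τ hτ => ?_, hmono, ?_⟩
  · refine intervalIntegral.integral_zero_ae (ae_of_all _ fun σ hσ => hfs σ ?_)
    rw [uIoc_of_ge hτ] at hσ
    exact hσ.2
  · dsimp only
    rw [← intervalIntegral.integral_add_adjacent_intervals (hfi s t) (hfi t τ)]
    simp only [add_eq_left]
    refine intervalIntegral.integral_zero_ae (ae_of_all _ fun σ hσ => hft σ ?_)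
    rw [uIoc_of_le hτ] at hσ
    exact hσ.1.le
  · calc L ≤ ∫ σ in (s + δ)..(t - δ), (1 : ℝ) := by
          rw [intervalIntegral.integral_const, smul_eq_mul]
          linarith
      _ ≤ ∫ σ in (s + δ)..(t - δ), f σ := by
          refine intervalIntegral.integral_mono_on (by linarith) (by simp) (hfi _ _)
            fun σ hσ => ?_
          refine le_max_of_le_right (le_min le_rfl (le_min ?_ ?_))
          · rw [le_div_iff₀ hδ]; linarith [hσ.1]
          · rw [le_div_iff₀ hδ]; linarith [hσ.2]
      _ ≤ ∫ σ in s..t, f σ :=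
          intervalIntegral.integral_mono_interval (by linarith) (by linarith) (by linarith)
            (ae_of_all _ hf0) (hfi _ _)

namespace IsFinslerNorm

variable {N : ℕ} {H : Euc N → ℝ}

/-- The isoperimetric inequality applied to a truncation of `z`. -/
theorem mul_le_integral_comp_mul (h : IsFinslerNorm N H) (hN : 2 ≤ N)
    (hreg : FinslerRegular N H) {z : Euc N → ℝ} (hz : ContDiff ℝ 1 z) (hzle : ∀ x, z x ≤ 0)
    (hint : Integrable fun x => Real.exp (z x))
    (hsol : IsWeakSolution N H univ z (fun x => Real.exp (z x)))
    {F f : ℝ → ℝ} (hF : ∀ t, HasDerivAt F (f t) t) (hf : Continuous f) {B : ℝ}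
    (hf0 : ∀ t, 0 ≤ f t) (hfB : ∀ t, f t ≤ B * Real.exp t)
    (hF0 : ∀ t, 0 ≤ F t) (hFB : ∀ t, F t ≤ B * Real.exp t)
    {k a L : ℝ} (hk : 0 < k) (hkv : volume (closedWulff H) = ENNReal.ofReal (k ^ N)) (ha : 0 < a)
    (hav : ENNReal.ofReal (a ^ N) < volume {x | L ≤ F (z x)}) (hL : 0 < L) :
    L * (N * k * a ^ (N - 1)) ≤ ∫ x, f (z x) * H (gradient z x) := by
  obtain ⟨C, hC, hHC⟩ := h.exists_le_mul_norm
  obtain ⟨D, hD, η, hη⟩ := exists_cutoff N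
  have hFc : ContDiff ℝ 1 F := by
    rw [contDiff_one_iff_deriv]
    refine ⟨fun t => (hF t).differentiableAt, ?_⟩
    rwa [funext fun t => (hF t).deriv]
  have hi : Integrable fun x => f (z x) * H (gradient z x) := by
    simpa using h.integrable_comp_mul_energy hN hreg hz hzle hint hsol hf hf0 hfB
      (show 1 ≤ N by omega)
  set M := ∫ x, Real.exp (z x) with hM
  have l2 : Tendsto (fun n : ℕ => (∫ x, f (z x) * H (gradient z x)) +
      B * C * D * (1 / ((n : ℝ) + 1)) * M) atTop (𝓝 (∫ x, f (z x) * H (gradient z x))) := by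
    simpa using (((tendsto_one_div_add_atTop_nhds_zero_nat (𝕜 := ℝ)).const_mul
      (B * C * D)).mul_const M).const_add (∫ x, f (z x) * H (gradient z x))
  have hvol : Tendsto (fun n : ℕ => volume ({x | L ≤ F (z x)} ∩ Metric.closedBall (0 : Euc N) n))
      atTop (𝓝 (volume {x | L ≤ F (z x)})) := by
    have := tendsto_measure_iUnion_atTop (μ := volume)
      (s := fun n : ℕ => {x | L ≤ F (z x)} ∩ Metric.closedBall (0 : Euc N) n)
      (fun m n hmn => inter_subset_inter_right _
        (Metric.closedBall_subset_closedBall (by exact_mod_cast hmn)))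
    rwa [← inter_iUnion, Metric.iUnion_closedBall_nat, inter_univ] at this
  refine ge_of_tendsto l2 ?_
  filter_upwards [hvol.eventually_const_lt hav] with n hn
  obtain ⟨h1, h2, h3, h4, h5, h6⟩ := hη n
  have hu : ContDiff ℝ 1 fun x => F (z x) * η n x := (hFc.comp hz).mul h1
  have huc : HasCompactSupport fun x => F (z x) * η n x := h2.mul_left
  refine (isoperimetric_contDiff hN h.continuous h.nonneg h.map_zero (isCompact_closedWulff h)
    (fun y hy => hy) hu huc (fun x => mul_nonneg (hF0 _) (h3 x)) hk hkv ha
    (hn.le.trans (measure_mono ?_)) hL).trans ?_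
  · rintro x ⟨hx1, hx2⟩
    change L ≤ F (z x) * η n x
    rw [h5 x hx2, mul_one]
    exact hx1
  rw [hM, ← integral_const_mul, ← integral_add hi (hint.const_mul _)]
  refine integral_mono ((h.continuous_comp_gradient hu).integrable_of_hasCompactSupport
    ((hasCompactSupport_gradient huc).comp_left h.map_zero)) (hi.add (hint.const_mul _))
    fun x => ?_
  dsimp only
  rw [gradient_comp_mul (hF (z x)) (hz.differentiable one_ne_zero x)
    (h1.differentiable one_ne_zero x)]
  refine (h.add_le _ _).trans ?_
  rw [h.map_smul, h.map_smul, abs_of_nonneg (hF0 _), abs_of_nonneg (mul_nonneg (h3 x) (hf0 _)),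
    add_comm]
  have e1 : η n x * f (z x) * H (gradient z x) ≤ f (z x) * H (gradient z x) :=
    mul_le_mul_of_nonneg_right (mul_le_of_le_one_left (hf0 _) (h4 x)) (h.nonneg _)
  have e2 : F (z x) * H (gradient (η n) x) ≤
      B * C * D * (1 / ((n : ℝ) + 1)) * Real.exp (z x) := by
    calc F (z x) * H (gradient (η n) x) ≤ (B * Real.exp (z x)) * (C * (D / (n + 1))) := by
          refine mul_le_mul (hFB _) ((hHC _).trans ?_) (h.nonneg _) ((hF0 _).trans (hFB _))
          exact mul_le_mul_of_nonneg_left (h6 x) hC.le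
      _ = _ := by ring
  exact add_le_add e1 e2

end IsFinslerNorm

theorem measure_lt_lt_top {N : ℕ} {z : Euc N → ℝ}
    (hint : Integrable fun x => Real.exp (z x)) (t : ℝ) : volume {x | t < z x} < ∞ := by
  refine lt_of_le_of_lt (measure_mono fun x hx => ?_)
    (hint.measure_norm_ge_lt_top (Real.exp_pos t))
  change Real.exp t ≤ ‖Real.exp (z x)‖
  rw [Real.norm_of_nonneg (Real.exp_pos _).le]
  exact Real.exp_le_exp.2 (le_of_lt hx)

namespace IsFinslerNorm

variable {N : ℕ} {H : Euc N → ℝ}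

theorem level_inequality (h : IsFinslerNorm N H) (hN : 2 ≤ N)
    (hreg : FinslerRegular N H) {z : Euc N → ℝ} (hz : ContDiff ℝ 1 z) (hzle : ∀ x, z x ≤ 0)
    (hint : Integrable fun x => Real.exp (z x))
    (hsol : IsWeakSolution N H univ z (fun x => Real.exp (z x)))
    {k : ℝ} (hk : 0 < k) (hkv : volume (closedWulff H) = ENNReal.ofReal (k ^ N))
    {s t : ℝ} (hst : s < t) :
    (N : ℝ) ^ N * k ^ N * (t - s) ^ (N - 1) * volume.real {x | t < z x} ^ (N - 1) ≤
      (∫ x in {x | s < z x}, Real.exp (z x)) *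
        (volume.real {x | s < z x} - volume.real {x | t < z x}) ^ (N - 1) := by
  have hms : ∀ τ, MeasurableSet {x | τ < z x} := fun τ =>
    measurableSet_lt measurable_const hz.continuous.measurable
  have hfin : ∀ τ, volume {x | τ < z x} ≠ ∞ := fun τ => (measure_lt_lt_top hint τ).ne
  have hsub : {x | t < z x} ⊆ {x | s < z x} := fun x hx => hst.trans hx
  set μs := volume.real {x | s < z x} with hμs
  set μt := volume.real {x | t < z x} with hμt
  set m := ∫ x in {x | s < z x}, Real.exp (z x) with hm
  have hle : μt ≤ μs := measureReal_mono hsub (hfin s)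
  have hm0 : 0 ≤ m := integral_nonneg fun x => (Real.exp_pos _).le
  have hμt0 : 0 ≤ μt := measureReal_nonneg
  have hR : 0 ≤ m * (μs - μt) ^ (N - 1) := mul_nonneg hm0 (pow_nonneg (by linarith) _)
  rcases hμt0.eq_or_lt with h0 | hpos
  · have : μt ^ (N - 1) = 0 := by rw [← h0, zero_pow (by omega)]
    rwa [this, mul_zero]
  have hN0 : (N : ℝ) ≠ 0 := by
    have : N ≠ 0 := by omega
    exact_mod_cast this
  set b := μt ^ (1 / (N : ℝ)) with hb
  have hb0 : 0 < b := Real.rpow_pos_of_pos hpos _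
  have hbN : b ^ N = μt := by
    rw [hb, ← Real.rpow_natCast, ← Real.rpow_mul hμt0, one_div_mul_cancel hN0, Real.rpow_one]
  have key : ∀ L a : ℝ, 0 < L → L < t - s → 0 < a → a < b →
      (N : ℝ) ^ N * k ^ N * L ^ (N - 1) * (a ^ N) ^ (N - 1) ≤ m * (μs - μt) ^ (N - 1) := by
    intro L a hL hLt ha hab
    obtain ⟨F, f, hF, hf, hf0, hf1, hfs, hft, hFs, hFt, hFm, hLF⟩ := exists_truncation hst hLt
    set L₀ := F t with hL₀
    have hL₀p : 0 < L₀ := hL.trans_le hLF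
    have hF0 : ∀ τ, 0 ≤ F τ := fun τ => by
      rcases le_total τ s with h1 | h1
      · exact (hFs τ h1).ge
      · rw [← hFs s le_rfl]; exact hFm h1
    have hFL : ∀ τ, F τ ≤ L₀ := fun τ => by
      rcases le_total τ t with h1 | h1
      · exact hFm h1
      · exact (hFt τ h1).le
    set B := (1 + L₀) * Real.exp (-s) with hB
    have hone : ∀ τ, s ≤ τ → 1 + L₀ ≤ B * Real.exp τ := fun τ hτ => by
      rw [hB, mul_assoc, ← Real.exp_add]
      exact le_mul_of_one_le_right (by linarith) (Real.one_le_exp (by linarith))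
    have hB0 : 0 ≤ B := mul_nonneg (by linarith) (Real.exp_pos _).le
    have hfB : ∀ τ, f τ ≤ B * Real.exp τ := fun τ => by
      rcases le_total τ s with h1 | h1
      · rw [hfs τ h1]; exact mul_nonneg hB0 (Real.exp_pos _).le
      · linarith [hone τ h1, hf1 τ]
    have hFB : ∀ τ, F τ ≤ B * Real.exp τ := fun τ => by
      rcases le_total τ s with h1 | h1
      · rw [hFs τ h1]; exact mul_nonneg hB0 (Real.exp_pos _).le
      · linarith [hone τ h1, hFL τ]
    have hav : ENNReal.ofReal (a ^ N) < volume {x | L₀ ≤ F (z x)} := by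
      have e1 : ENNReal.ofReal (a ^ N) < ENNReal.ofReal μt := by
        rw [ENNReal.ofReal_lt_ofReal_iff hpos, ← hbN]
        exact pow_lt_pow_left₀ hab ha.le (by omega)
      rw [hμt, measureReal_def, ENNReal.ofReal_toReal (hfin t)] at e1
      exact e1.trans_le (measure_mono fun x hx => (hFt (z x) (le_of_lt hx)).ge)
    have s1 := h.mul_le_integral_comp_mul hN hreg hz hzle hint hsol hF hf hf0 hfB hF0 hFB
      hk hkv ha hav hL₀p
    have hi : ∀ j ≤ N, Integrable fun x => f (z x) * H (gradient z x) ^ j := fun j hj =>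
      h.integrable_comp_mul_energy hN hreg hz hzle hint hsol hf hf0 hfB hj
    have hi0 : Integrable fun x => f (z x) := by simpa using hi 0 (Nat.zero_le N)
    have hi1 : Integrable fun x => f (z x) * H (gradient z x) := by
      simpa using hi 1 (by omega)
    obtain ⟨n, rfl⟩ : ∃ n, N = n + 1 := ⟨N - 1, by omega⟩
    simp only [Nat.add_sub_cancel] at *
    have s2 := integral_mul_pow_le (fun x => hf0 (z x)) (fun x => h.nonneg (gradient z x))
      hi0 hi1 (hi (n + 1) le_rfl)
    have s3 := h.integral_deriv_comp_le hN hreg hz hzle hint hsol hF hf hf0 hfB hF0 hFB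
    have s4 : ∫ x, Real.exp (z x) * F (z x) ≤ L₀ * m := by
      rw [hm, ← integral_indicator (hms s), ← integral_const_mul]
      refine integral_mono_of_nonneg
        (ae_of_all _ fun x => mul_nonneg (Real.exp_pos _).le (hF0 _))
        ((hint.indicator (hms s)).const_mul _) (ae_of_all _ fun x => ?_)
      dsimp only
      by_cases hx : s < z x
      · rw [indicator_of_mem (show x ∈ {x | s < z x} from hx), mul_comm]
        exact mul_le_mul_of_nonneg_right (hFL _) (Real.exp_pos _).le
      · rw [indicator_of_notMem (show x ∉ {x | s < z x} from hx), hFs _ (not_lt.1 hx)]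
        simp
    have s5 : ∫ x, f (z x) ≤ μs - μt := by
      rw [hμs, hμt, ← measureReal_sdiff hsub (hms t) (hfin s), ← integral_indicator_one
        ((hms s).diff (hms t))]
      refine integral_mono_of_nonneg (ae_of_all _ fun x => hf0 _)
        ((integrable_indicator_iff ((hms s).diff (hms t))).2 (integrableOn_const
          (measure_ne_top_of_subset sdiff_subset (hfin s)))) (ae_of_all _ fun x => ?_)
      by_cases hx : x ∈ {x | s < z x} \ {x | t < z x}
      · rw [indicator_of_mem hx]
        exact hf1 _
      · rw [indicator_of_notMem hx]
        by_cases h1 : s < z x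
        · have : t < z x := by
            by_contra h2
            exact hx ⟨h1, h2⟩
          exact (hft _ this.le).le
        · exact (hfs _ (not_lt.1 h1)).le
    have p0 : 0 ≤ ∫ x, f (z x) := integral_nonneg fun x => hf0 _
    have s6 : (L₀ * ((n + 1 : ℕ) * k * a ^ n)) ^ (n + 1) ≤ L₀ * m * (μs - μt) ^ n := by
      calc (L₀ * ((n + 1 : ℕ) * k * a ^ n)) ^ (n + 1)
          ≤ (∫ x, f (z x) * H (gradient z x)) ^ (n + 1) := by gcongr
        _ ≤ _ := s2
        _ ≤ _ := by
          gcongr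
          exact s3.trans s4
    have s7 : L₀ * (((n + 1 : ℕ) : ℝ) ^ (n + 1) * k ^ (n + 1) * L₀ ^ n * (a ^ (n + 1)) ^ n) ≤
        L₀ * (m * (μs - μt) ^ n) := by
      refine le_trans (le_of_eq ?_) (s6.trans (le_of_eq (by ring)))
      rw [← pow_mul, mul_pow, mul_pow, mul_pow, ← pow_mul, mul_comm n, pow_succ L₀]
      ring
    refine le_trans ?_ (le_of_mul_le_mul_left s7 hL₀p)
    gcongr
  have hlim : Tendsto (fun θ : ℝ => (N : ℝ) ^ N * k ^ N * (θ * (t - s)) ^ (N - 1) *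
      ((θ * b) ^ N) ^ (N - 1)) (𝓝[<] 1)
      (𝓝 ((N : ℝ) ^ N * k ^ N * (t - s) ^ (N - 1) * μt ^ (N - 1))) := by
    have hc : Continuous fun θ : ℝ => (N : ℝ) ^ N * k ^ N * (θ * (t - s)) ^ (N - 1) *
      ((θ * b) ^ N) ^ (N - 1) := by fun_prop
    have := (hc.tendsto 1).mono_left (nhdsWithin_le_nhds (s := Iio 1))
    simpa only [one_mul, hbN] using this
  refine le_of_tendsto hlim ?_
  filter_upwards [self_mem_nhdsWithin, mem_nhdsWithin_of_mem_nhds (lt_mem_nhds zero_lt_one)]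
    with θ h1 h2
  have h1 : θ < 1 := h1
  have hts : 0 < t - s := by linarith
  exact key _ _ (mul_pos h2 hts) (mul_lt_of_lt_one_left hts h1) (mul_pos h2 hb0)
    (mul_lt_of_lt_one_left hb0 h1)

end IsFinslerNorm

/-- Integration of the differential inequality between the distribution function of `v` and its
partial masses. -/
theorem mul_integral_le_rpow_div {α : Type*} [MeasurableSpace α] {ν : Measure α} {v : α → ℝ}
    (hvm : Measurable v) (hv0 : ∀ x, 0 < v x) (hv1 : ∀ x, v x ≤ 1) (hvi : Integrable v ν)
    {c p : ℝ} (hc : 0 ≤ c) (hp : 0 ≤ p)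
    (hlev : ∀ q r : ℝ, 0 < q → q < r →
      c * (Real.log r - Real.log q) * ν.real {x | r < v x} ≤
        (∫ x in {x | q < v x}, v x ∂ν) ^ p * (ν.real {x | q < v x} - ν.real {x | r < v x})) :
    c * ∫ x, v x ∂ν ≤ (∫ x, v x ∂ν) ^ (p + 1) / (p + 1) := by
  set M := ∫ x, v x ∂ν with hM
  set μ : ℝ → ℝ := fun r => ν.real {x | r < v x} with hμ
  set m : ℝ → ℝ := fun r => ∫ x in {x | r < v x}, v x ∂ν with hm
  have hms : ∀ r : ℝ, MeasurableSet {x | r < v x} := fun r => measurableSet_lt measurable_const hvm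
  have hfin : ∀ r, 0 < r → ν {x | r < v x} ≠ ∞ := fun r hr => (hvi.measure_gt_lt_top hr).ne
  have hsub : ∀ {q r : ℝ}, q ≤ r → {x | r < v x} ⊆ {x | q < v x} := fun hqr x hx =>
    lt_of_le_of_lt hqr hx
  have hm0 : ∀ r, 0 ≤ m r := fun r => integral_nonneg fun x => (hv0 x).le
  have hmanti : Antitone m := fun q r hqr => setIntegral_mono_set hvi.integrableOn
    (ae_of_all _ fun x => (hv0 x).le) (hsub hqr).eventuallyLE
  have hp1 : 0 < p + 1 := by linarith
  set g : ℝ → ℝ := fun r => -(m r ^ (p + 1)) with hg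
  have hgmono : Monotone g := fun q r hqr =>
    neg_le_neg (Real.rpow_le_rpow (hm0 r) (hmanti hqr) hp1.le)
  have hstep : ∀ q r, 0 < q → q < r → q * (μ q - μ r) ≤ m q - m r := by
    intro q r hq hqr
    have e1 : m q - m r = ∫ x in {x | q < v x} \ {x | r < v x}, v x ∂ν :=
      (setIntegral_sdiff (hms r) hvi.integrableOn (hsub hqr.le)).symm
    have e2 : μ q - μ r = ν.real ({x | q < v x} \ {x | r < v x}) :=
      (measureReal_sdiff (hsub hqr.le) (hms r) (hfin q hq)).symm
    rw [e1, e2]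
    exact setIntegral_ge_of_const_le_real ((hms q).diff (hms r))
      (measure_ne_top_of_subset sdiff_subset (hfin q hq)) (fun x hx => le_of_lt hx.1)
      hvi.integrableOn
  have hae : ∀ᵐ r, 0 < r → c * μ r ≤ deriv g r / (p + 1) := by
    filter_upwards [hmanti.neg.ae_differentiableAt] with r hd hr
    have hdm : DifferentiableAt ℝ m r := by simpa using hd.neg
    have hmd := hdm.hasDerivAt
    have hgd : HasDerivAt g (-(deriv m r * (p + 1) * m r ^ (p + 1 - 1))) r :=
      (hmd.rpow_const (Or.inr (by linarith))).neg
    rw [hgd.deriv, add_sub_cancel_right]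
    have hL : Tendsto (fun q => c * (slope Real.log r q * q) * μ r) (𝓝[<] r)
        (𝓝 (c * (r⁻¹ * r) * μ r)) := by
      have h1 := ((hasDerivAt_iff_tendsto_slope.1 (Real.hasDerivAt_log hr.ne')).mono_left
        (nhdsWithin_mono r (fun q (hq : q < r) => hq.ne)))
      have h2 : Tendsto (fun q : ℝ => q) (𝓝[<] r) (𝓝 r) := tendsto_id.mono_left nhdsWithin_le_nhds
      exact ((h1.mul h2).const_mul c).mul_const (μ r)
    have hR : Tendsto (fun q => m q ^ p * -slope m r q) (𝓝[<] r) (𝓝 (m r ^ p * -deriv m r)) := by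
      have h1 := ((hasDerivAt_iff_tendsto_slope.1 hmd).mono_left
        (nhdsWithin_mono r (fun q (hq : q < r) => hq.ne)))
      have h2 : Tendsto (fun q => m q ^ p) (𝓝[<] r) (𝓝 (m r ^ p)) :=
        (hdm.continuousAt.rpow_const (Or.inr hp)).tendsto.mono_left nhdsWithin_le_nhds
      exact h2.mul h1.neg
    have hle := le_of_tendsto_of_tendsto hL hR (by
      filter_upwards [self_mem_nhdsWithin, mem_nhdsWithin_of_mem_nhds (lt_mem_nhds hr)]
        with q hqr hq
      have hqr : q < r := hqr
      have h1 := hlev q r hq hqr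
      have h2 := hstep q r hq hqr
      have h3 : 0 ≤ m q ^ p := Real.rpow_nonneg (hm0 q) p
      have hrq : 0 < r - q := by linarith
      have e1 : slope Real.log r q = (Real.log r - Real.log q) / (r - q) := by
        rw [slope_def_field, ← neg_div_neg_eq]; ring_nf
      have e2 : -slope m r q = (m q - m r) / (r - q) := by
        rw [slope_def_field, ← neg_div_neg_eq]; ring_nf
      rw [e1, e2]
      calc c * ((Real.log r - Real.log q) / (r - q) * q) * μ r
          = (c * (Real.log r - Real.log q) * μ r) * (q / (r - q)) := by ring
        _ ≤ (m q ^ p * (μ q - μ r)) * (q / (r - q)) := by gcongr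
        _ = m q ^ p * (q * (μ q - μ r)) / (r - q) := by ring
        _ ≤ m q ^ p * (m q - m r) / (r - q) := by gcongr
        _ = _ := by ring)
    rw [inv_mul_cancel₀ hr.ne', mul_one] at hle
    refine hle.trans (le_of_eq ?_)
    field_simp
  have hlayer : M = ∫ r in Ioc (0 : ℝ) 1, μ r := by
    rw [hM, hvi.integral_eq_integral_meas_lt (ae_of_all _ fun x => (hv0 x).le)]
    refine setIntegral_eq_of_subset_of_forall_sdiff_eq_zero measurableSet_Ioi
      Ioc_subset_Ioi_self fun r hr => ?_
    have hr1 : 1 < r := by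
      by_contra h1
      exact hr.2 ⟨hr.1, not_lt.1 h1⟩
    have : {x | r < v x} = ∅ := by
      ext x
      simpa using (hv1 x).trans hr1.le
    simp [this]
  have hgi : IntervalIntegrable (deriv g) volume 0 1 :=
    (hgmono.monotoneOn _).intervalIntegrable_deriv
  have hgle : ∫ r in (0 : ℝ)..1, deriv g r ≤ M ^ (p + 1) := by
    have h1 := (hgmono.monotoneOn (uIcc (0 : ℝ) 1)).intervalIntegral_deriv_mem_uIcc
    rw [uIcc_of_le (sub_nonneg.2 (hgmono zero_le_one))] at h1
    refine h1.2.trans ?_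
    have e1 : m 0 = M := by
      have : {x | (0 : ℝ) < v x} = univ := by
        ext x
        simpa using hv0 x
      simp only [hm, this, setIntegral_univ]
      rfl
    have e2 := Real.rpow_nonneg (hm0 1) (p + 1)
    simp only [hg, e1]
    linarith
  calc c * M = ∫ r in Ioc (0 : ℝ) 1, c * μ r := by rw [integral_const_mul, ← hlayer]
    _ ≤ ∫ r in Ioc (0 : ℝ) 1, deriv g r / (p + 1) := by
        refine integral_mono_of_nonneg (ae_of_all _ fun r => mul_nonneg hc measureReal_nonneg)
          (hgi.1.div_const _) ?_
        refine (ae_restrict_iff' measurableSet_Ioc).2 ?_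
        filter_upwards [hae] with r hr hr0
        exact hr hr0.1
    _ = (∫ r in (0 : ℝ)..1, deriv g r) / (p + 1) := by
        rw [integral_div, intervalIntegral.integral_of_le zero_le_one]
    _ ≤ _ := by gcongr

theorem IsFinslerNorm.mass_lower_bound {N : ℕ} {H : Euc N → ℝ} (h : IsFinslerNorm N H)
    (hN : 2 ≤ N) (hreg : FinslerRegular N H) {z : Euc N → ℝ} (hz : ContDiff ℝ 1 z)
    (hzle : ∀ x, z x ≤ 0) (hint : Integrable fun x => Real.exp (z x))
    (hsol : IsWeakSolution N H univ z (fun x => Real.exp (z x)))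
    {k : ℝ} (hk : 0 < k) (hkv : volume (closedWulff H) = ENNReal.ofReal (k ^ N)) :
    ((N : ℝ) / ((N : ℝ) - 1)) ^ (N - 1) * (N : ℝ) ^ N * k ^ N ≤ ∫ x, Real.exp (z x) := by
  obtain ⟨n, rfl⟩ : ∃ n, N = n + 1 := ⟨N - 1, by omega⟩
  have hn0 : n ≠ 0 := by omega
  have hn : (0 : ℝ) < n := by exact_mod_cast Nat.pos_of_ne_zero hn0
  simp only [Nat.add_sub_cancel]
  set M := ∫ x, Real.exp (z x) with hM
  have hMpos : 0 < M := integral_exp_pos hint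
  set p : ℝ := (n : ℝ)⁻¹ with hp
  have hp0 : 0 < p := inv_pos.2 hn
  set b : ℝ := ((n + 1 : ℕ) : ℝ) ^ (n + 1) * k ^ (n + 1) with hb
  have hb0 : 0 ≤ b := by positivity
  have hroot : ∀ y : ℝ, 0 ≤ y → (y ^ p) ^ n = y := fun y hy => Real.rpow_inv_natCast_pow hy hn0
  have main := mul_integral_le_rpow_div (c := b ^ p) (p := p) hz.continuous.rexp.measurable
    (fun x => Real.exp_pos _) (fun x => Real.exp_le_one_iff.2 (hzle x)) hint
    (Real.rpow_nonneg hb0 _) hp0.le (fun q r hq hqr => ?_)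
  · rw [← hM, le_div_iff₀ (by positivity), Real.rpow_add_one hMpos.ne', mul_right_comm] at main
    have h1 : b ^ p * (p + 1) ≤ M ^ p := le_of_mul_le_mul_right main hMpos
    have h2 : (b ^ p * (p + 1)) ^ n ≤ (M ^ p) ^ n := by gcongr
    rw [hroot M hMpos.le, mul_pow, hroot b hb0] at h2
    refine le_trans (le_of_eq ?_) h2
    have e1 : (((n + 1 : ℕ) : ℝ) / (((n + 1 : ℕ) : ℝ) - 1)) = p + 1 := by
      rw [hp]
      push_cast
      rw [add_sub_cancel_right]
      field_simp
      ring
    rw [e1, hb]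
    ring
  · have hr : 0 < r := hq.trans hqr
    have hset : ∀ y : ℝ, 0 < y → {x | y < Real.exp (z x)} = {x | Real.log y < z x} := by
      intro y hy
      ext x
      exact (Real.log_lt_iff_lt_exp hy).symm
    have hlog : Real.log q < Real.log r := Real.log_lt_log hq hqr
    have hl := h.level_inequality hN hreg hz hzle hint hsol hk hkv hlog
    rw [hset q hq, hset r hr]
    simp only [Nat.add_sub_cancel] at hl
    have hm0 : 0 ≤ ∫ x in {x | Real.log q < z x}, Real.exp (z x) :=
      integral_nonneg fun x => (Real.exp_pos _).le
    have hd : 0 ≤ volume.real {x | Real.log q < z x} - volume.real {x | Real.log r < z x} :=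
      sub_nonneg.2 (measureReal_mono (fun x hx => hlog.trans hx)
        (measure_lt_lt_top hint _).ne)
    refine le_of_pow_le_pow_left₀ hn0 (mul_nonneg (Real.rpow_nonneg hm0 _) hd) ?_
    rw [mul_pow, mul_pow, mul_pow, hroot b hb0, hroot _ hm0]
    exact hl

end

/-- Lower bound on the total mass `∫ e^z` for entire solutions of the Finsler
Liouville equation (Lemma 5.1, whole-space case). -/
theorem liouville_mass_lower_bound (N : ℕ) (hN : 2 ≤ N) (H : Euc N → ℝ)
    (hnorm : IsFinslerNorm N H) (hreg : FinslerRegular N H)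
    (z : Euc N → ℝ) (hz : ContDiff ℝ 1 z) (hzle : ∀ x, z x ≤ 0)
    (hint : Integrable (fun x : Euc N => Real.exp (z x)))
    (hsol : IsWeakSolution N H Set.univ z (fun x => Real.exp (z x))) :
    ((N : ℝ) / ((N : ℝ) - 1)) ^ (N - 1) * (N : ℝ) ^ N * wulffVol N H
      ≤ ∫ x : Euc N, Real.exp (z x) := by
  have hN0 : N ≠ 0 := by omega
  rcases (measureReal_nonneg (μ := volume) (s := closedWulff H)).eq_or_lt with h0 | hpos
  · have hW : wulffVol N H = 0 :=
      le_antisymm ((wulffVol_le hnorm).trans h0.ge) ENNReal.toReal_nonneg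
    rw [hW, mul_zero]
    exact integral_nonneg fun x => (Real.exp_pos _).le
  · set V := volume.real (closedWulff H) with hV
    have hk : 0 < V ^ ((N : ℝ)⁻¹) := Real.rpow_pos_of_pos hpos _
    have hkN : (V ^ ((N : ℝ)⁻¹)) ^ N = V := Real.rpow_inv_natCast_pow hpos.le hN0
    have hkv : volume (closedWulff H) = ENNReal.ofReal ((V ^ ((N : ℝ)⁻¹)) ^ N) := by
      rw [hkN, hV, measureReal_def,
        ENNReal.ofReal_toReal (isCompact_closedWulff hnorm).measure_lt_top.ne]
    refine le_trans ?_ (hnorm.mass_lower_bound hN hreg hz hzle hint hsol hk hkv)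
    rw [hkN]
    have hN1 : (0 : ℝ) ≤ (N : ℝ) - 1 := by
      have : (2 : ℝ) ≤ N := by exact_mod_cast hN
      linarith
    refine mul_le_mul_of_nonneg_left (wulffVol_le hnorm) ?_
    positivity
end
end
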